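/- Strong-secrecy lower bound for the wiretap relay channel (noisy network coding with an eavesdropper): for a discrete memoryless relay channel p(y_r, y, z | x, x_r) on finite alphabets with transmitter input X, relay input X_r, relay output Y_r, legitimate receiver output Y, and eavesdropper output Z, the strong secrecy capacity satisfies C_s ≥ sup max{ R_NNC − R_{BC-Z}, min{ R_NNC − I(U;Z), R_{MAC-Y} − R_{MAC-Z} } }, where the supremum is over all joint pmfs of (U, X, U_r, X_r, Y_r, Y, Z, Ŷ_r) that factor as p(u,x) p(u_r, x_r) p(y_r, y, z | x, x_r) p(ŷ_r | u_r, y_r), and R_{BC-Y} := I(U; Y, Ŷ_r | U_r), R_{BC-Z} := I(U; Z, Ŷ_r | U_r), R_{MAC-Y} := I(U, U_r; Y) − I(Y_r; Ŷ_r | U, U_r, Y), R_{MAC-Z} := I(U, U_r; Z) − I(Y_r; Ŷ_r | U, U_r, Z), and R_NNC := min{R_{BC-Y}, R_{MAC-Y}}. -/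

import Mathlib

open scoped BigOperators Classical

noncomputable section

/-- `p` is a probability mass function on `α`: nonnegative and summing to one. -/
def IsPmf {α : Type*} (p : α → ℝ) : Prop := (∀ a, 0 ≤ p a) ∧ HasSum p 1

/-- Total variation distance between two pmfs on the same alphabet:
`‖p − q‖ = (1/2) Σ |p − q|`. -/
def TV {α : Type*} (p q : α → ℝ) : ℝ := (1 / 2) * ∑' a, |p a - q a|

/-- Shannon entropy (base 2) of a pmf. -/
def H2 {α : Type*} (p : α → ℝ) : ℝ := ∑' a, -(p a * Real.logb 2 (p a))

/-- Pushforward (marginalization) of a pmf along a map. -/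
def pmap {α β : Type*} (f : α → β) (p : α → ℝ) : β → ℝ :=
  fun b => ∑' a, if f a = b then p a else 0

/-- Mutual information `I(A;B)` (base 2) of a joint pmf on `α × β`. -/
def MI {α β : Type*} (p : α × β → ℝ) : ℝ :=
  H2 (pmap Prod.fst p) + H2 (pmap Prod.snd p) - H2 p

/-- Conditional mutual information `I(A;B|C)` (base 2) of a joint pmf on `α × β × γ`. -/
def CMI {α β γ : Type*} (p : α × β × γ → ℝ) : ℝ :=
  H2 (pmap (fun a => (a.1, a.2.2)) p) + H2 (pmap Prod.snd p) - H2 p -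
    H2 (pmap (fun a => a.2.2) p)

/-- The number of messages `⌈2^{nR}⌉` corresponding to rate `R` at blocklength `n`. -/
def nMsg (n : ℕ) (r : ℝ) : ℕ := ⌈(2 : ℝ) ^ ((n : ℝ) * r)⌉₊

/-- The uniform pmf on `{0, 1, …, M−1} ⊆ ℕ`. -/
def unifPmf (M : ℕ) (b : ℕ) : ℝ := if b < M then (M : ℝ)⁻¹ else 0

section RelayQuantities

variable {𝒳 𝒳r 𝒴r 𝒴 𝒵 𝒰 𝒰r 𝒴h : Type}

/-- The single-letter joint pmf of `(U, X, U_r, X_r, Y_r, Y, Z, Ŷ_r)` for the wiretap relay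
channel, factoring as `p(u,x) p(u_r,x_r) W(y_r,y,z|x,x_r) q(ŷ_r|u_r,y_r)`.
The components of `a` are, in order: `u, x, u_r, x_r, y_r, y, z, ŷ_r`. -/
def relayJoint (p₁ : 𝒰 × 𝒳 → ℝ) (p₂ : 𝒰r × 𝒳r → ℝ)
    (W : 𝒳 × 𝒳r → 𝒴r × 𝒴 × 𝒵 → ℝ) (q : 𝒰r × 𝒴r → 𝒴h → ℝ) :
    𝒰 × 𝒳 × 𝒰r × 𝒳r × 𝒴r × 𝒴 × 𝒵 × 𝒴h → ℝ :=
  fun a => p₁ (a.1, a.2.1) * p₂ (a.2.2.1, a.2.2.2.1) *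
    W (a.2.1, a.2.2.2.1) (a.2.2.2.2.1, a.2.2.2.2.2.1, a.2.2.2.2.2.2.1) *
    q (a.2.2.1, a.2.2.2.2.1) a.2.2.2.2.2.2.2

variable (p₁ : 𝒰 × 𝒳 → ℝ) (p₂ : 𝒰r × 𝒳r → ℝ)
  (W : 𝒳 × 𝒳r → 𝒴r × 𝒴 × 𝒵 → ℝ) (q : 𝒰r × 𝒴r → 𝒴h → ℝ)

/-- `R_BC-Y = I(U; Y Ŷ_r | U_r)`. -/
def RBCY : ℝ := CMI (pmap (fun a : 𝒰 × 𝒳 × 𝒰r × 𝒳r × 𝒴r × 𝒴 × 𝒵 × 𝒴h =>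
  (a.1, (a.2.2.2.2.2.1, a.2.2.2.2.2.2.2), a.2.2.1)) (relayJoint p₁ p₂ W q))

/-- `R_BC-Z = I(U; Z Ŷ_r | U_r)`. -/
def RBCZ : ℝ := CMI (pmap (fun a : 𝒰 × 𝒳 × 𝒰r × 𝒳r × 𝒴r × 𝒴 × 𝒵 × 𝒴h =>
  (a.1, (a.2.2.2.2.2.2.1, a.2.2.2.2.2.2.2), a.2.2.1)) (relayJoint p₁ p₂ W q))

/-- `R_MAC-Y = I(U U_r; Y) − I(Y_r; Ŷ_r | U U_r Y)`. -/
def RMACY : ℝ :=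
  MI (pmap (fun a : 𝒰 × 𝒳 × 𝒰r × 𝒳r × 𝒴r × 𝒴 × 𝒵 × 𝒴h =>
      ((a.1, a.2.2.1), a.2.2.2.2.2.1)) (relayJoint p₁ p₂ W q)) -
    CMI (pmap (fun a : 𝒰 × 𝒳 × 𝒰r × 𝒳r × 𝒴r × 𝒴 × 𝒵 × 𝒴h =>
      (a.2.2.2.2.1, a.2.2.2.2.2.2.2, (a.1, a.2.2.1, a.2.2.2.2.2.1))) (relayJoint p₁ p₂ W q))

/-- `R_MAC-Z = I(U U_r; Z) − I(Y_r; Ŷ_r | U U_r Z)`. -/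
def RMACZ : ℝ :=
  MI (pmap (fun a : 𝒰 × 𝒳 × 𝒰r × 𝒳r × 𝒴r × 𝒴 × 𝒵 × 𝒴h =>
      ((a.1, a.2.2.1), a.2.2.2.2.2.2.1)) (relayJoint p₁ p₂ W q)) -
    CMI (pmap (fun a : 𝒰 × 𝒳 × 𝒰r × 𝒳r × 𝒴r × 𝒴 × 𝒵 × 𝒴h =>
      (a.2.2.2.2.1, a.2.2.2.2.2.2.2, (a.1, a.2.2.1, a.2.2.2.2.2.2.1))) (relayJoint p₁ p₂ W q))

/-- `I(U;Z)`. -/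
def IUZ : ℝ := MI (pmap (fun a : 𝒰 × 𝒳 × 𝒰r × 𝒳r × 𝒴r × 𝒴 × 𝒵 × 𝒴h =>
  (a.1, a.2.2.2.2.2.2.1)) (relayJoint p₁ p₂ W q))

/-- `R_NNC = min{R_BC-Y, R_MAC-Y}`. -/
def RNNC : ℝ := min (RBCY p₁ p₂ W q) (RMACY p₁ p₂ W q)

end RelayQuantities

/-- The joint pmf of `(M, X^n, X_r^n, Y_r^n, Y^n, Z^n)` induced by a uniform message, a
stochastic encoder, stochastic causal relay-encoding functions and `n` memoryless uses of
the relay channel `W`. -/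
def relayInduced {𝒳 𝒳r 𝒴r 𝒴 𝒵 : Type} (n M : ℕ)
    (W : 𝒳 × 𝒳r → 𝒴r × 𝒴 × 𝒵 → ℝ)
    (enc : ℕ → (Fin n → 𝒳) → ℝ)
    (relay : (t : Fin n) → (Fin t.1 → 𝒴r) → (Fin t.1 → 𝒳r) → 𝒳r → ℝ) :
    ℕ × (Fin n → 𝒳) × (Fin n → 𝒳r) × (Fin n → 𝒴r) × (Fin n → 𝒴) × (Fin n → 𝒵) → ℝ :=
  fun a => unifPmf M a.1 * enc a.1 a.2.1 *
    (∏ t : Fin n, relay t (fun j => a.2.2.2.1 ⟨j.1, lt_trans j.2 t.isLt⟩)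
      (fun j => a.2.2.1 ⟨j.1, lt_trans j.2 t.isLt⟩) (a.2.2.1 t)) *
    ∏ t, W (a.2.1 t, a.2.2.1 t) (a.2.2.2.1 t, a.2.2.2.2.1 t, a.2.2.2.2.2 t)

set_option linter.unusedSectionVars false
namespace WR

/-- finite pmf -/
def isP {α : Type*} [Fintype α] (p : α → ℝ) : Prop := (∀ a, 0 ≤ p a) ∧ ∑ a, p a = 1

/-- natural-log entropy -/
def Hn {α : Type*} [Fintype α] (p : α → ℝ) : ℝ := ∑ a, Real.negMulLog (p a)

/-- marginal -/
def mg {α β : Type*} [Fintype α] (f : α → β) (p : α → ℝ) (b : β) : ℝ :=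
  ∑ a, if f a = b then p a else 0

section basic
variable {α β γ : Type*} [Fintype α] [Fintype β] [Fintype γ]

lemma isP.le_one {p : α → ℝ} (h : isP p) (a : α) : p a ≤ 1 := by
  rw [← h.2]; exact Finset.single_le_sum (fun i _ => h.1 i) (Finset.mem_univ a)

lemma isP.nonempty {p : α → ℝ} (h : isP p) : Nonempty α := by
  by_contra hn
  rw [not_nonempty_iff] at hn
  have := h.2
  simp at this

lemma isP_iff {p : α → ℝ} : IsPmf p ↔ isP p := by
  unfold IsPmf isP
  constructor
  · rintro ⟨h1, h2⟩; exact ⟨h1, (hasSum_fintype p).unique h2⟩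
  · rintro ⟨h1, h2⟩; exact ⟨h1, h2 ▸ hasSum_fintype p⟩

lemma mg_nonneg {f : α → β} {p : α → ℝ} (h : ∀ a, 0 ≤ p a) (b : β) : 0 ≤ mg f p b :=
  Finset.sum_nonneg fun a _ => by split_ifs <;> simp [h]

lemma sum_mg_mul (f : α → β) (p : α → ℝ) (φ : β → ℝ) :
    ∑ b, mg f p b * φ b = ∑ a, p a * φ (f a) := by
  unfold mg
  simp_rw [Finset.sum_mul]
  rw [Finset.sum_comm]
  refine Finset.sum_congr rfl fun a _ => ?_
  simp [ite_mul]

lemma sum_mg (f : α → β) (p : α → ℝ) : ∑ b, mg f p b = ∑ a, p a := by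
  simpa using sum_mg_mul f p (fun _ => 1)

lemma isP.mg {p : α → ℝ} (h : isP p) (f : α → β) : isP (mg f p) :=
  ⟨mg_nonneg h.1, by rw [sum_mg, h.2]⟩

lemma mg_mg (f : α → β) (g : β → γ) (p : α → ℝ) : mg g (mg f p) = mg (fun a => g (f a)) p := by
  funext c
  have := sum_mg_mul f p (fun b => if g b = c then 1 else 0)
  simp only [mul_ite, mul_one, mul_zero] at this
  exact this

lemma le_mg {p : α → ℝ} (h : ∀ a, 0 ≤ p a) (f : α → β) (a : α) : p a ≤ mg f p (f a) := by
  unfold mg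
  have := Finset.single_le_sum (f := fun a' => if f a' = f a then p a' else 0)
    (fun i _ => by split_ifs <;> simp [h]) (Finset.mem_univ a)
  simpa using this

lemma l1_mg (f : α → β) (p q : α → ℝ) : ∑ b, |mg f p b - mg f q b| ≤ ∑ a, |p a - q a| := by
  have h : ∀ b, |mg f p b - mg f q b| ≤ mg f (fun a => |p a - q a|) b := by
    intro b
    unfold mg
    rw [← Finset.sum_sub_distrib]
    refine (Finset.abs_sum_le_sum_abs _ _).trans (Finset.sum_le_sum fun a _ => ?_)
    split_ifs <;> simp
  refine (Finset.sum_le_sum fun b _ => h b).trans ?_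
  rw [sum_mg]

lemma mg_eq_sum {f : α → β} (e : β × γ ≃ α) (hf : ∀ x, f (e x) = x.1) (p : α → ℝ) (b : β) :
    mg f p b = ∑ c, p (e (b, c)) := by
  unfold mg
  rw [← e.sum_comp, Fintype.sum_prod_type]
  simp_rw [hf]
  rw [Finset.sum_comm]
  refine Finset.sum_congr rfl fun c _ => ?_
  simp

lemma mg_fst (p : α × β → ℝ) (a : α) : mg Prod.fst p a = ∑ b, p (a, b) :=
  mg_eq_sum (Equiv.refl _) (fun _ => rfl) p a

lemma mg_snd (p : α × β → ℝ) (b : β) : mg Prod.snd p b = ∑ a, p (a, b) :=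
  mg_eq_sum (Equiv.prodComm _ _) (fun _ => rfl) p b

lemma Hn_equiv (e : α ≃ β) (p : β → ℝ) : Hn (fun a => p (e a)) = Hn p :=
  e.sum_comp (fun b => Real.negMulLog (p b))

lemma Hn_mg_inj (f : α → β) (hf : Function.Injective f) (p : α → ℝ) : Hn (mg f p) = Hn p := by
  have h1 : ∀ a, mg f p (f a) = p a := by
    intro a; unfold mg
    rw [Finset.sum_eq_single a]
    · simp
    · intro b _ hb; rw [if_neg]; exact fun h => hb (hf h)
    · simp
  have h := sum_mg_mul f p (fun b => - Real.log (mg f p b))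
  unfold Hn Real.negMulLog
  simp only [h1, mul_neg] at h
  simp only [neg_mul]
  exact h

lemma Hn_mg_le {p : α → ℝ} (hp : ∀ a, 0 ≤ p a) (f : α → β) : Hn (mg f p) ≤ Hn p := by
  have h := sum_mg_mul f p (fun b => - Real.log (mg f p b))
  unfold Hn Real.negMulLog
  simp only [neg_mul, mul_neg] at h ⊢
  rw [h]
  refine Finset.sum_le_sum fun a _ => ?_
  rcases (hp a).eq_or_lt with h0 | h0
  · simp [← h0]
  · have := Real.log_le_log h0 (le_mg hp f a)
    nlinarith

lemma gibbs {p q : α → ℝ} (hp : isP p) (hq : ∀ a, 0 ≤ q a) (hq1 : ∑ a, q a ≤ 1)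
    (hac : ∀ a, 0 < p a → 0 < q a) :
    ∑ a, p a * Real.log (q a) ≤ ∑ a, p a * Real.log (p a) := by
  have : ∀ a, p a * Real.log (q a) - p a * Real.log (p a) ≤ q a - p a := by
    intro a
    rcases (hp.1 a).eq_or_lt with h0 | h0
    · simp [← h0, hq a]
    · have hq0 := hac a h0
      have := Real.log_le_sub_one_of_pos (div_pos hq0 h0)
      rw [Real.log_div hq0.ne' h0.ne'] at this
      have h2 := mul_le_mul_of_nonneg_left this h0.le
      have h3 : p a * (q a / p a - 1) = q a - p a := by field_simp
      linarith
  have h := Finset.sum_le_sum fun a (_ : a ∈ Finset.univ) => this a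
  rw [Finset.sum_sub_distrib, Finset.sum_sub_distrib, hp.2] at h
  linarith

lemma Hn_mg_eq (f : α → β) (p : α → ℝ) : Hn (mg f p) = - ∑ a, p a * Real.log (mg f p (f a)) := by
  have h := sum_mg_mul f p (fun b => Real.log (mg f p b))
  rw [← h]; unfold Hn Real.negMulLog; simp

/-- submodularity of entropy -/
lemma Hn_submod (p : α × β → ℝ) (hp : isP p) (φ : α → γ) :
    Hn p + Hn (mg (fun x => φ x.1) p) ≤ Hn (mg Prod.fst p) + Hn (mg (fun x => (φ x.1, x.2)) p) := by
  set p1 := mg Prod.fst p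
  set p2 := mg (fun x : α × β => (φ x.1, x.2)) p
  set p3 := mg (fun x : α × β => φ x.1) p
  have n1 : ∀ a, 0 ≤ p1 a := mg_nonneg hp.1
  have n2 : ∀ a, 0 ≤ p2 a := mg_nonneg hp.1
  have n3 : ∀ a, 0 ≤ p3 a := mg_nonneg hp.1
  have hg := gibbs hp (q := fun x => p1 x.1 * p2 (φ x.1, x.2) / p3 (φ x.1))
    (fun a => div_nonneg (mul_nonneg (n1 _) (n2 _)) (n3 _))
    (by
      rw [Fintype.sum_prod_type]
      have h23 : ∀ c, ∑ b, p2 (c, b) = p3 c := by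
        intro c
        rw [← mg_fst p2 c]
        show mg Prod.fst (mg _ p) c = _
        rw [mg_mg]
      calc ∑ a, ∑ b, p1 a * p2 (φ a, b) / p3 (φ a) = ∑ a, p1 a * (p3 (φ a) / p3 (φ a)) := by
            refine Finset.sum_congr rfl fun a _ => ?_
            rw [← h23, Finset.sum_div, Finset.mul_sum]
            refine Finset.sum_congr rfl fun b _ => by rw [mul_div_assoc]
        _ ≤ ∑ a, p1 a := Finset.sum_le_sum fun a _ =>
            mul_le_of_le_one_right (n1 a) (div_self_le_one _)
        _ = 1 := (hp.mg _).2)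
    (by
      intro a ha
      have l1 := le_mg hp.1 Prod.fst a
      have l2 := le_mg hp.1 (fun x : α × β => (φ x.1, x.2)) a
      have l3 := le_mg hp.1 (fun x : α × β => φ x.1) a
      exact div_pos (mul_pos (ha.trans_le l1) (ha.trans_le l2)) (ha.trans_le l3))
  have e1 := Hn_mg_eq Prod.fst p
  have e2 := Hn_mg_eq (fun x : α × β => (φ x.1, x.2)) p
  have e3 := Hn_mg_eq (fun x : α × β => φ x.1) p
  have e0 : Hn p = - ∑ a, p a * Real.log (p a) := by unfold Hn Real.negMulLog; simp
  have e4 : ∑ a, p a * Real.log (p1 a.1 * p2 (φ a.1, a.2) / p3 (φ a.1)) =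
      ∑ a, p a * Real.log (p1 a.1) + ∑ a, p a * Real.log (p2 (φ a.1, a.2))
        - ∑ a, p a * Real.log (p3 (φ a.1)) := by
    rw [← Finset.sum_add_distrib, ← Finset.sum_sub_distrib]
    refine Finset.sum_congr rfl fun a _ => ?_
    rcases (hp.1 a).eq_or_lt with h0 | ha
    · simp [← h0]
    · have l1 := le_mg hp.1 Prod.fst a
      have l2 := le_mg hp.1 (fun x : α × β => (φ x.1, x.2)) a
      have l3 := le_mg hp.1 (fun x : α × β => φ x.1) a
      have l1 : 0 < p1 a.1 := ha.trans_le l1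
      have l2 : 0 < p2 (φ a.1, a.2) := ha.trans_le l2
      have l3 : 0 < p3 (φ a.1) := ha.trans_le l3
      rw [Real.log_div (mul_pos l1 l2).ne' l3.ne', Real.log_mul l1.ne' l2.ne']
      ring
  rw [e0]
  have e1' : Hn p1 = _ := e1
  have e2' : Hn p2 = _ := e2
  have e3' : Hn p3 = _ := e3
  rw [e1', e2', e3']
  rw [e4] at hg
  linarith

lemma MI_nonneg' (p : α × β → ℝ) (hp : isP p) :
    Hn p ≤ Hn (mg Prod.fst p) + Hn (mg Prod.snd p) := by
  have h := Hn_submod p hp (fun _ => ())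
  have h1 : Hn (mg (fun x : α × β => ()) p) = 0 := by
    unfold Hn
    have : mg (fun x : α × β => ()) p () = 1 := by unfold mg; simp [hp.2]
    simp [this]
  have h2 : Hn (mg (fun x : α × β => ((), x.2)) p) = Hn (mg Prod.snd p) := by
    rw [← Hn_mg_inj (fun b : β => ((), b)) (fun a b h => by simpa using h), mg_mg]
  linarith

lemma negMulLog_diff {a b : ℝ} (ha : 0 ≤ a) (hab : a ≤ b) (hb1 : b ≤ 1) :
    |Real.negMulLog a - Real.negMulLog b| ≤ Real.negMulLog (b - a) + (b - a) := by
  rcases hab.eq_or_lt with h | h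
  · subst h; simp
  rcases ha.eq_or_lt with h0 | h0
  · subst h0
    simp [abs_of_nonneg (Real.negMulLog_nonneg h.le hb1), h.le]
  have hb : 0 < b := h0.trans h
  have hd : 0 < b - a := sub_pos.2 h
  have la : Real.log a ≤ Real.log b := Real.log_le_log h0 h.le
  have ld : Real.log (b - a) ≤ Real.log b := Real.log_le_log hd (by linarith)
  have hub : Real.log b - Real.log a ≤ b / a - 1 := by
    rw [← Real.log_div hb.ne' h0.ne']; exact Real.log_le_sub_one_of_pos (div_pos hb h0)
  have hub2 : a * (Real.log b - Real.log a) ≤ b - a := by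
    have := mul_le_mul_of_nonneg_left hub h0.le
    have e : a * (b / a - 1) = b - a := by field_simp
    linarith
  have lb : Real.log b ≤ 0 := Real.log_nonpos hb.le hb1
  unfold Real.negMulLog
  rw [abs_le]
  constructor
  · nlinarith
  · have : Real.log (b - a) ≤ 0 := ld.trans lb
    nlinarith

/-- continuity of entropy -/
lemma Hn_cont {p q : α → ℝ} (hp : isP p) (hq : isP q) :
    |Hn p - Hn q| ≤ (∑ a, |p a - q a|) * Real.log (Fintype.card α) + 1 := by
  have hne := hp.nonempty
  have hA : (0 : ℝ) < Fintype.card α := by exact_mod_cast Fintype.card_pos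
  have h : ∀ a, |Real.negMulLog (p a) - Real.negMulLog (q a)| ≤
      |p a - q a| * Real.log (Fintype.card α) + (Fintype.card α : ℝ)⁻¹ := by
    intro a
    have h1 : |Real.negMulLog (p a) - Real.negMulLog (q a)| ≤
        Real.negMulLog |p a - q a| + |p a - q a| := by
      rcases le_total (p a) (q a) with h | h
      · rw [abs_sub_comm (p a) (q a), abs_of_nonneg (sub_nonneg.2 h)]
        exact negMulLog_diff (hp.1 a) h (hq.le_one a)
      · rw [abs_of_nonneg (sub_nonneg.2 h), abs_sub_comm]
        exact negMulLog_diff (hq.1 a) h (hp.le_one a)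
    refine h1.trans ?_
    set d := |p a - q a|
    rcases (abs_nonneg (p a - q a)).eq_or_lt with h0 | h0
    · have : d = 0 := h0.symm
      rw [this]; simp
    · have h0 : 0 < d := h0
      have := Real.log_le_sub_one_of_pos (x := (d * Fintype.card α)⁻¹) (by positivity)
      rw [Real.log_inv, Real.log_mul h0.ne' hA.ne'] at this
      have h2 := mul_le_mul_of_nonneg_left this h0.le
      have e : d * ((d * Fintype.card α)⁻¹ - 1) = (Fintype.card α : ℝ)⁻¹ - d := by field_simp
      unfold Real.negMulLog
      linarith
  unfold Hn
  rw [← Finset.sum_sub_distrib]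
  refine (Finset.abs_sum_le_sum_abs _ _).trans ((Finset.sum_le_sum fun a _ => h a).trans ?_)
  rw [Finset.sum_add_distrib, ← Finset.sum_mul]
  simp [hA.ne']

lemma Hn_chain (p : α → ℝ) (k : α → β → ℝ) (hk : ∀ a, p a ≠ 0 → ∑ b, k a b = 1) :
    Hn (fun x : α × β => p x.1 * k x.1 x.2) = Hn p + ∑ a, p a * Hn (k a) := by
  unfold Hn
  rw [Fintype.sum_prod_type, ← Finset.sum_add_distrib]
  refine Finset.sum_congr rfl fun a _ => ?_
  simp_rw [Real.negMulLog_mul]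
  rw [Finset.sum_add_distrib, ← Finset.sum_mul, Finset.mul_sum]
  by_cases h : p a = 0
  · simp [h]
  · rw [hk a h, one_mul]

lemma Hn_unif (p : α → ℝ) (c : ℝ) (hp : isP p) (h : ∀ a, p a = c) : Hn p = - Real.log c := by
  unfold Hn Real.negMulLog
  have h2 := hp.2
  simp_rw [h] at h2 ⊢
  rw [Finset.sum_const] at *
  rw [nsmul_eq_mul] at *
  linear_combination (- Real.log c) * h2

end basic
end WR

set_option linter.unusedSectionVars false
namespace WR

section pi
variable {ι α β : Type*} [Fintype ι] [DecidableEq ι] [Fintype α] [Fintype β]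

lemma sum_pi_prod (f : ι → α → ℝ) : ∑ c : ι → α, ∏ i, f i (c i) = ∏ i, ∑ a, f i a := by
  rw [Finset.prod_univ_sum, Fintype.piFinset_univ]

lemma isP_pi {p : ι → α → ℝ} (hp : ∀ i, isP (p i)) : isP (fun c : ι → α => ∏ i, p i (c i)) :=
  ⟨fun c => Finset.prod_nonneg fun i _ => (hp i).1 _, by
    rw [sum_pi_prod]; exact Finset.prod_eq_one fun i _ => (hp i).2⟩

lemma exp_pi_one {p : ι → α → ℝ} (hp : ∀ i, isP (p i)) (j : ι) (φ : α → ℝ) :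
    ∑ c : ι → α, (∏ i, p i (c i)) * φ (c j) = ∑ a, p j a * φ a := by
  have h : ∀ c : ι → α, (∏ i, p i (c i)) * φ (c j) =
      ∏ i, (p i (c i) * if i = j then φ (c i) else 1) := by
    intro c; rw [Finset.prod_mul_distrib]; simp
  simp_rw [h]
  rw [sum_pi_prod (fun i a => p i a * if i = j then φ a else 1), Finset.prod_eq_single j]
  · simp
  · intro i _ hi; simp [hi, (hp i).2]
  · simp

lemma exp_pi_mul {p : ι → α → ℝ} (hp : ∀ i, isP (p i)) {j k : ι} (hjk : j ≠ k) (g h : α → ℝ) :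
    ∑ c : ι → α, (∏ i, p i (c i)) * (g (c j) * h (c k)) =
      (∑ a, p j a * g a) * ∑ a, p k a * h a := by
  have e : ∀ c : ι → α, (∏ i, p i (c i)) * (g (c j) * h (c k)) =
      ∏ i, (p i (c i) * ((if i = j then g (c i) else 1) * if i = k then h (c i) else 1)) := by
    intro c; rw [Finset.prod_mul_distrib, Finset.prod_mul_distrib]; simp
  simp_rw [e]
  rw [sum_pi_prod (fun i a => p i a * ((if i = j then g a else 1) * if i = k then h a else 1)),
    ← Finset.mul_prod_erase _ _ (Finset.mem_univ j),
    ← Finset.mul_prod_erase _ _ (Finset.mem_erase.2 ⟨hjk.symm, Finset.mem_univ k⟩),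
    Finset.prod_eq_one]
  · simp [hjk, hjk.symm]
  · intro i hi
    simp only [Finset.mem_erase] at hi
    simp [hi.1, hi.2.1, (hp i).2]

lemma exp_pi_two {p : ι → α → ℝ} (hp : ∀ i, isP (p i)) {j k : ι} (hjk : j ≠ k) (f : α → α → ℝ) :
    ∑ c : ι → α, (∏ i, p i (c i)) * f (c j) (c k) =
      ∑ a, ∑ b, p j a * p k b * f a b := by
  have e : ∀ c : ι → α, (∏ i, p i (c i)) * f (c j) (c k) =
      ∑ a, (∏ i, p i (c i)) * ((if c j = a then 1 else 0) * f a (c k)) := by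
    intro c
    rw [← Finset.mul_sum]; simp
  simp_rw [e]
  rw [Finset.sum_comm]
  refine Finset.sum_congr rfl fun a _ => ?_
  rw [exp_pi_mul hp hjk (fun x => if x = a then 1 else 0) (f a)]
  simp [Finset.mul_sum, mul_assoc]

lemma var_pi {p : α → ℝ} (hp : isP p) (g : α → ℝ) (hg : ∑ a, p a * g a = 0) :
    ∑ c : ι → α, (∏ i, p (c i)) * (∑ k, g (c k)) ^ 2 = Fintype.card ι * ∑ a, p a * g a ^ 2 := by
  have e : ∀ c : ι → α, (∏ i, p (c i)) * (∑ k, g (c k)) ^ 2 =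
      ∑ j, ∑ k, (∏ i, p (c i)) * (g (c j) * g (c k)) := by
    intro c
    rw [sq, Finset.sum_mul_sum, Finset.mul_sum]
    refine Finset.sum_congr rfl fun j _ => ?_
    rw [Finset.mul_sum]
  simp_rw [e]
  rw [Finset.sum_comm]
  have : ∀ j : ι, ∑ c : ι → α, ∑ k, (∏ i, p (c i)) * (g (c j) * g (c k)) =
      ∑ a, p a * g a ^ 2 := by
    intro j
    rw [Finset.sum_comm, Finset.sum_eq_single j]
    · rw [exp_pi_one (p := fun _ => p) (fun _ => hp) j (fun a => g a * g a)]
      simp [sq]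
    · intro k _ hk
      rw [exp_pi_mul (p := fun _ => p) (fun _ => hp) hk.symm, hg]; simp
    · simp
  rw [Finset.sum_congr rfl fun j _ => this j]
  simp

lemma Hn_pi {p : ι → α → ℝ} (hp : ∀ i, isP (p i)) :
    Hn (fun c : ι → α => ∏ i, p i (c i)) = ∑ i, Hn (p i) := by
  unfold Hn
  have e : ∀ c : ι → α, Real.negMulLog (∏ i, p i (c i)) =
      ∑ j, (∏ i, p i (c i)) * (- Real.log (p j (c j))) := by
    intro c
    rw [← Finset.mul_sum]
    by_cases h : ∏ i, p i (c i) = 0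
    · simp [h]
    · unfold Real.negMulLog
      have h' := Finset.prod_ne_zero_iff.1 h
      rw [Real.log_prod (fun i hi => h' i hi)]
      simp
  simp_rw [e]
  rw [Finset.sum_comm]
  refine Finset.sum_congr rfl fun j _ => ?_
  rw [exp_pi_one hp j (fun a => - Real.log (p j a))]
  simp [Real.negMulLog]

lemma Hn_iid {p : α → ℝ} (hp : isP p) :
    Hn (fun c : ι → α => ∏ i, p (c i)) = Fintype.card ι * Hn p := by
  rw [Hn_pi (p := fun _ => p) (fun _ => hp)]; simp

lemma mg_pi (p : ι → α → ℝ) (f : ι → α → β) (s : ι → β) :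
    mg (fun (c : ι → α) i => f i (c i)) (fun c => ∏ i, p i (c i)) s = ∏ i, mg (f i) (p i) (s i) := by
  unfold mg
  rw [← sum_pi_prod (fun i a => if f i a = s i then p i a else 0)]
  refine Finset.sum_congr rfl fun c _ => ?_
  by_cases h : (fun i => f i (c i)) = s
  · rw [if_pos h]
    refine Finset.prod_congr rfl fun i _ => ?_
    rw [if_pos (congrFun h i)]
  · rw [if_neg h]
    have : ∃ i, f i (c i) ≠ s i := by
      by_contra hh; push Not at hh; exact h (funext hh)
    obtain ⟨i, hi⟩ := this
    exact (Finset.prod_eq_zero (Finset.mem_univ i) (if_neg hi)).symm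

end pi

section oneshot
variable {ι α β : Type*} [Fintype ι] [DecidableEq ι] [Fintype α] [Fintype β]

lemma exp_abs_le {μ X : α → ℝ} (hμ : isP μ) {t : ℝ} (ht : 0 ≤ t) (h : ∑ a, μ a * X a ^ 2 ≤ t ^ 2) :
    ∑ a, μ a * |X a| ≤ t := by
  set m := ∑ a, μ a * |X a| with hm
  have h0 : 0 ≤ ∑ a, μ a * (|X a| - m) ^ 2 :=
    Finset.sum_nonneg fun a _ => mul_nonneg (hμ.1 a) (sq_nonneg _)
  have e : ∑ a, μ a * (|X a| - m) ^ 2 = ∑ a, μ a * X a ^ 2 - m ^ 2 := by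
    have : ∀ a, μ a * (|X a| - m) ^ 2 = μ a * X a ^ 2 - 2 * m * (μ a * |X a|) + m ^ 2 * μ a := by
      intro a
      have := sq_abs (X a)
      linear_combination μ a * this
    simp_rw [this]
    rw [Finset.sum_add_distrib, Finset.sum_sub_distrib, ← Finset.mul_sum, ← Finset.mul_sum, hμ.2,
      ← hm]
    ring
  exact abs_le_of_sq_le_sq' (by linarith) ht |>.2

/-- one-shot soft covering -/
lemma softcover [Nonempty ι] {p : α → ℝ} (hp : isP p) (W : α → β → ℝ) (hW : ∀ a, isP (W a))
    (q : β → ℝ) (hq : ∀ b, q b = ∑ a, p a * W a b) {G : ℝ} (hG : 0 < G) :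
    ∑ c : ι → α, (∏ i, p (c i)) * ∑ b, |(Fintype.card ι : ℝ)⁻¹ * ∑ k, W (c k) b - q b| ≤
      2 * (∑ a, p a * ∑ b, if G * q b < W a b then W a b else 0) +
        Real.sqrt (G / Fintype.card ι) := by
  set K : ℝ := ((Fintype.card ι : ℕ) : ℝ) with hK
  have hK0 : 0 < K := by rw [hK]; exact_mod_cast Fintype.card_pos
  set W1 : α → β → ℝ := fun a b => if G * q b < W a b then 0 else W a b with hW1
  set W2 : α → β → ℝ := fun a b => if G * q b < W a b then W a b else 0 with hW2
  have hs : ∀ a b, W a b = W1 a b + W2 a b := by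
    intro a b; simp only [hW1, hW2]; split_ifs <;> simp
  have n1 : ∀ a b, 0 ≤ W1 a b := by intro a b; simp only [hW1]; split_ifs <;> simp [(hW a).1]
  have n2 : ∀ a b, 0 ≤ W2 a b := by intro a b; simp only [hW2]; split_ifs <;> simp [(hW a).1]
  have hqn : ∀ b, 0 ≤ q b := fun b => by
    rw [hq]; exact Finset.sum_nonneg fun a _ => mul_nonneg (hp.1 a) ((hW a).1 b)
  have hq1 : ∑ b, q b = 1 := by
    simp_rw [hq]; rw [Finset.sum_comm]; simp_rw [← Finset.mul_sum]
    simp [(hW _).2, hp.2]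
  set q1 : β → ℝ := fun b => ∑ a, p a * W1 a b
  set q2 : β → ℝ := fun b => ∑ a, p a * W2 a b
  have hq12 : ∀ b, q b = q1 b + q2 b := by
    intro b; rw [hq]; simp only [q1, q2]; rw [← Finset.sum_add_distrib]
    refine Finset.sum_congr rfl fun a _ => ?_
    rw [hs]; ring
  have hq2n : ∀ b, 0 ≤ q2 b := fun b => Finset.sum_nonneg fun a _ => mul_nonneg (hp.1 a) (n2 _ _)
  have hμ : isP (fun c : ι → α => ∏ i, p (c i)) := isP_pi (p := fun _ => p) (fun _ => hp)
  set s := Real.sqrt (G / K)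
  have hs2 : s ^ 2 = G / K := Real.sq_sqrt (by positivity)
  -- first part
  have A1 : ∀ b, ∑ c : ι → α, (∏ i, p (c i)) * |K⁻¹ * ∑ k, (W1 (c k) b - q1 b)| ≤ q b * s := by
    intro b
    apply exp_abs_le hμ (mul_nonneg (hqn b) (Real.sqrt_nonneg _))
    have : ∀ c : ι → α, (∏ i, p (c i)) * (K⁻¹ * ∑ k, (W1 (c k) b - q1 b)) ^ 2 =
        K⁻¹ ^ 2 * ((∏ i, p (c i)) * (∑ k, (W1 (c k) b - q1 b)) ^ 2) := fun c => by ring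
    simp_rw [this]
    rw [← Finset.mul_sum, var_pi hp (fun a => W1 a b - q1 b)]
    · have e : ∑ a, p a * (W1 a b - q1 b) ^ 2 ≤ G * q b * q b := by
        have e1 : ∑ a, p a * (W1 a b - q1 b) ^ 2 = ∑ a, p a * W1 a b ^ 2 - q1 b ^ 2 := by
          have : ∀ a, p a * (W1 a b - q1 b) ^ 2 =
            p a * W1 a b ^ 2 - 2 * q1 b * (p a * W1 a b) + q1 b ^ 2 * p a := fun a => by ring
          simp_rw [this]
          rw [Finset.sum_add_distrib, Finset.sum_sub_distrib, ← Finset.mul_sum, ← Finset.mul_sum,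
            hp.2]
          simp only [q1]; ring
        have e2 : ∑ a, p a * W1 a b ^ 2 ≤ ∑ a, G * q b * (p a * W1 a b) := by
          refine Finset.sum_le_sum fun a _ => ?_
          have : W1 a b ≤ G * q b := by
            simp only [hW1]; split_ifs with h
            · exact mul_nonneg hG.le (hqn b)
            · exact not_lt.1 h
          have h3 := mul_le_mul_of_nonneg_left this (mul_nonneg (hp.1 a) (n1 a b))
          nlinarith
        rw [← Finset.mul_sum] at e2
        have e3 : q1 b ≤ q b := by rw [hq12]; linarith [hq2n b]
        have e4 : G * q b * q1 b ≤ G * q b * q b :=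
          mul_le_mul_of_nonneg_left e3 (mul_nonneg hG.le (hqn b))
        have e5 : ∑ a, p a * W1 a b = q1 b := rfl
        rw [e5] at e2
        nlinarith [sq_nonneg (q1 b)]
      rw [mul_pow, hs2, ← hK]
      calc K⁻¹ ^ 2 * (K * ∑ a, p a * (W1 a b - q1 b) ^ 2)
          = K⁻¹ * ∑ a, p a * (W1 a b - q1 b) ^ 2 := by field_simp
        _ ≤ K⁻¹ * (G * q b * q b) := mul_le_mul_of_nonneg_left e (by positivity)
        _ = q b ^ 2 * (G / K) := by field_simp
    · simp_rw [mul_sub]; rw [Finset.sum_sub_distrib, ← Finset.sum_mul, hp.2]; simp [q1]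
  have A2 : ∀ b, ∑ c : ι → α, (∏ i, p (c i)) * (K⁻¹ * ∑ k, W2 (c k) b + q2 b) = 2 * q2 b := by
    intro b
    simp_rw [mul_add]
    rw [Finset.sum_add_distrib, ← Finset.sum_mul, hμ.2]
    have : ∀ c : ι → α, (∏ i, p (c i)) * (K⁻¹ * ∑ k, W2 (c k) b) =
        K⁻¹ * ∑ k, (∏ i, p (c i)) * W2 (c k) b := by
      intro c; rw [← Finset.mul_sum]; ring
    simp_rw [this]
    rw [← Finset.mul_sum, Finset.sum_comm]
    rw [Finset.sum_congr rfl fun k _ => exp_pi_one (p := fun _ => p) (fun _ => hp) k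
      (fun a => W2 a b)]
    rw [Finset.sum_const, Finset.card_univ, nsmul_eq_mul, ← hK]
    have : ∑ a, p a * W2 a b = q2 b := rfl
    rw [this]; field_simp; ring
  have A3 : ∀ (c : ι → α) b, |K⁻¹ * ∑ k, W (c k) b - q b| ≤
      |K⁻¹ * ∑ k, (W1 (c k) b - q1 b)| + (K⁻¹ * ∑ k, W2 (c k) b + q2 b) := by
    intro c b
    have e : K⁻¹ * ∑ k, W (c k) b - q b = K⁻¹ * ∑ k, (W1 (c k) b - q1 b) +
        (K⁻¹ * ∑ k, W2 (c k) b - q2 b) := by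
      simp_rw [hs]
      rw [Finset.sum_add_distrib, Finset.sum_sub_distrib, Finset.sum_const, Finset.card_univ,
        nsmul_eq_mul, ← hK, hq12]
      field_simp; ring
    rw [e]
    refine (abs_add_le _ _).trans (add_le_add le_rfl ?_)
    have h1 : 0 ≤ K⁻¹ * ∑ k, W2 (c k) b :=
      mul_nonneg (by positivity) (Finset.sum_nonneg fun k _ => n2 _ _)
    rw [abs_le]; constructor <;> linarith [hq2n b]
  calc ∑ c : ι → α, (∏ i, p (c i)) * ∑ b, |K⁻¹ * ∑ k, W (c k) b - q b|
      ≤ ∑ c : ι → α, (∏ i, p (c i)) * ∑ b, (|K⁻¹ * ∑ k, (W1 (c k) b - q1 b)| +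
          (K⁻¹ * ∑ k, W2 (c k) b + q2 b)) :=
        Finset.sum_le_sum fun c _ => mul_le_mul_of_nonneg_left
          (Finset.sum_le_sum fun b _ => A3 c b) (hμ.1 c)
    _ = ∑ b, (∑ c : ι → α, (∏ i, p (c i)) * |K⁻¹ * ∑ k, (W1 (c k) b - q1 b)| +
          ∑ c : ι → α, (∏ i, p (c i)) * (K⁻¹ * ∑ k, W2 (c k) b + q2 b)) := by
        simp_rw [Finset.mul_sum]
        rw [Finset.sum_comm]
        refine Finset.sum_congr rfl fun b _ => ?_
        rw [← Finset.sum_add_distrib]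
        refine Finset.sum_congr rfl fun c _ => ?_
        ring
    _ ≤ ∑ b, (q b * s + 2 * q2 b) :=
        Finset.sum_le_sum fun b _ => add_le_add (A1 b) (A2 b).le
    _ = _ := by
        rw [Finset.sum_add_distrib, ← Finset.sum_mul, hq1, ← Finset.mul_sum]
        have : ∑ b, q2 b = ∑ a, p a * ∑ b, W2 a b := by
          simp only [q2]; rw [Finset.sum_comm]
          simp_rw [Finset.mul_sum]
        rw [this]; ring

/-- one-shot channel coding -/
lemma chancode {p : α → ℝ} (hp : isP p) (W : α → β → ℝ) (hW : ∀ a, isP (W a))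
    (q : β → ℝ) (hq : ∀ b, q b = ∑ a, p a * W a b) {G : ℝ} (hG : 0 < G) (i : ι) :
    ∑ c : ι → α, (∏ k, p (c k)) * (∑ b, W (c i) b *
        if (G * q b < W (c i) b ∧ ∀ j, j ≠ i → ¬ G * q b < W (c j) b) then 0 else 1) ≤
      (∑ a, p a * ∑ b, if G * q b < W a b then 0 else W a b) + Fintype.card ι / G := by
  have hqn : ∀ b, 0 ≤ q b := fun b => by
    rw [hq]; exact Finset.sum_nonneg fun a _ => mul_nonneg (hp.1 a) ((hW a).1 b)
  have hμ : isP (fun c : ι → α => ∏ i, p (c i)) := isP_pi (p := fun _ => p) (fun _ => hp)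
  have A : ∀ (c : ι → α), (∑ b, W (c i) b *
      if (G * q b < W (c i) b ∧ ∀ j, j ≠ i → ¬ G * q b < W (c j) b) then 0 else 1) ≤
      (∑ b, if G * q b < W (c i) b then 0 else W (c i) b) +
        ∑ j ∈ Finset.univ.erase i, ∑ b, W (c i) b * (if G * q b < W (c j) b then 1 else 0) := by
    intro c
    rw [Finset.sum_comm, ← Finset.sum_add_distrib]
    refine Finset.sum_le_sum fun b _ => ?_
    have hn : 0 ≤ ∑ j ∈ Finset.univ.erase i, W (c i) b * (if G * q b < W (c j) b then (1:ℝ) else 0) :=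
      Finset.sum_nonneg fun j _ => mul_nonneg ((hW _).1 _) (by split_ifs <;> simp)
    by_cases h1 : G * q b < W (c i) b
    · by_cases h2 : ∀ j, j ≠ i → ¬ G * q b < W (c j) b
      · rw [if_pos ⟨h1, h2⟩, if_pos h1]; simpa using hn
      · rw [if_neg (fun h => h2 h.2), if_pos h1]
        push Not at h2
        obtain ⟨j, hj, hj2⟩ := h2
        have := Finset.single_le_sum (f := fun j => W (c i) b * (if G * q b < W (c j) b then (1:ℝ) else 0))
          (fun j _ => mul_nonneg ((hW _).1 _) (by split_ifs <;> simp))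
          (Finset.mem_erase.2 ⟨hj, Finset.mem_univ j⟩)
        simp only [if_pos hj2] at this
        simpa using this
    · rw [if_neg (fun h => h1 h.1), if_neg h1]; linarith
  have B : ∀ j, j ≠ i → ∑ c : ι → α, (∏ k, p (c k)) *
      ∑ b, W (c i) b * (if G * q b < W (c j) b then 1 else 0) ≤ 1 / G := by
    intro j hj
    rw [exp_pi_two (p := fun _ => p) (fun _ => hp) hj.symm
      (fun a a' => ∑ b, W a b * (if G * q b < W a' b then 1 else 0))]
    have e : ∑ a, ∑ a', p a * p a' * ∑ b, W a b * (if G * q b < W a' b then (1:ℝ) else 0) =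
        ∑ a', p a' * ∑ b, q b * (if G * q b < W a' b then (1:ℝ) else 0) := by
      rw [Finset.sum_comm]
      refine Finset.sum_congr rfl fun a' _ => ?_
      simp_rw [hq, Finset.sum_mul, Finset.mul_sum]
      rw [Finset.sum_comm]
      refine Finset.sum_congr rfl fun b _ => Finset.sum_congr rfl fun a _ => by ring
    rw [e]
    calc _ ≤ ∑ a', p a' * ∑ b, (1 / G) * W a' b := by
          refine Finset.sum_le_sum fun a _ => mul_le_mul_of_nonneg_left
            (Finset.sum_le_sum fun b _ => ?_) (hp.1 a)
          split_ifs with h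
          · rw [one_div, mul_one, ← div_eq_inv_mul, le_div_iff₀ hG]; linarith
          · simpa using mul_nonneg (inv_nonneg.2 hG.le) ((hW a).1 b)
      _ = 1 / G := by
          simp_rw [← Finset.mul_sum, (hW _).2, ← Finset.sum_mul, hp.2]; ring
  calc _ ≤ ∑ c : ι → α, (∏ k, p (c k)) * ((∑ b, if G * q b < W (c i) b then 0 else W (c i) b) +
        ∑ j ∈ Finset.univ.erase i, ∑ b, W (c i) b * (if G * q b < W (c j) b then 1 else 0)) :=
        Finset.sum_le_sum fun c _ => mul_le_mul_of_nonneg_left (A c) (hμ.1 c)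
    _ = (∑ a, p a * ∑ b, if G * q b < W a b then 0 else W a b) +
        ∑ j ∈ Finset.univ.erase i, ∑ c : ι → α, (∏ k, p (c k)) *
          ∑ b, W (c i) b * (if G * q b < W (c j) b then 1 else 0) := by
        simp_rw [mul_add]
        rw [Finset.sum_add_distrib, exp_pi_one (p := fun _ => p) (fun _ => hp) i
          (fun a => ∑ b, if G * q b < W a b then 0 else W a b)]
        congr 1
        rw [Finset.sum_comm]
        simp_rw [Finset.mul_sum]
    _ ≤ (∑ a, p a * ∑ b, if G * q b < W a b then 0 else W a b) +
        ∑ j ∈ Finset.univ.erase i, 1 / G :=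
        add_le_add le_rfl (Finset.sum_le_sum fun j hj => B j (Finset.ne_of_mem_erase hj))
    _ ≤ _ := by
        refine add_le_add le_rfl ?_
        rw [Finset.sum_const, nsmul_eq_mul, mul_one_div]
        gcongr
        exact Finset.card_le_univ _

lemma cheby {P : α → ℝ} (hP : isP P) (f : α → ℝ) (μ : ℝ) (hμ : μ = ∑ a, P a * f a)
    {δ : ℝ} (hδ : 0 < δ) {n : ℕ} (hn : 0 < n) :
    ∑ c : Fin n → α, (∏ i, P (c i)) * (if n * δ ≤ |∑ i, (f (c i) - μ)| then 1 else 0) ≤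
      (∑ a, P a * (f a - μ) ^ 2) / (n * δ ^ 2) := by
  have hn' : (0:ℝ) < n := by exact_mod_cast hn
  have hv := var_pi (ι := Fin n) hP (fun a => f a - μ) (by
    simp_rw [mul_sub]; rw [Finset.sum_sub_distrib, ← Finset.sum_mul, hP.2, hμ]; ring)
  rw [le_div_iff₀ (by positivity)]
  have : (∑ c : Fin n → α, (∏ i, P (c i)) * (if n * δ ≤ |∑ i, (f (c i) - μ)| then 1 else 0)) *
      (n * δ) ^ 2 ≤ ∑ c : Fin n → α, (∏ i, P (c i)) * (∑ k, (f (c k) - μ)) ^ 2 := by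
    rw [Finset.sum_mul]
    refine Finset.sum_le_sum fun c _ => ?_
    rw [mul_assoc]
    refine mul_le_mul_of_nonneg_left ?_ (Finset.prod_nonneg fun i _ => hP.1 _)
    split_ifs with h
    · rw [one_mul, ← sq_abs (∑ k, (f (c k) - μ))]
      exact pow_le_pow_left₀ (by positivity) h 2
    · rw [zero_mul]; positivity
  rw [hv, Fintype.card_fin] at this
  have h3 : (n:ℝ) * ((∑ c : Fin n → α, (∏ i, P (c i)) *
      (if n * δ ≤ |∑ i, (f (c i) - μ)| then 1 else 0)) * (n * δ ^ 2)) ≤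
      n * ∑ a, P a * (f a - μ) ^ 2 := by
    calc _ = _ := by ring
      _ ≤ _ := this
  exact le_of_mul_le_mul_left h3 hn'

/-- law of large numbers for likelihood ratios, upper tail -/
lemma lln_up {P : α → ℝ} (hP : isP P) (num den : α → ℝ) (hnd : ∀ a, 0 < P a → 0 < num a ∧ 0 < den a)
    {δ : ℝ} (hδ : 0 < δ) {n : ℕ} (hn : 0 < n) (μ : ℝ)
    (hμ : μ = ∑ a, P a * (Real.log (num a) - Real.log (den a))) :
    ∑ c : Fin n → α, (∏ i, P (c i)) *
      (if Real.exp (n * (μ + δ)) * ∏ i, den (c i) < ∏ i, num (c i) then 1 else 0) ≤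
      (∑ a, P a * (Real.log (num a) - Real.log (den a) - μ) ^ 2) / (n * δ ^ 2) := by
  refine le_trans ?_ (cheby hP (fun a => Real.log (num a) - Real.log (den a)) μ hμ hδ hn)
  refine Finset.sum_le_sum fun c _ => ?_
  rcases (Finset.prod_nonneg fun i _ => hP.1 (c i)).eq_or_lt with h0 | h0
  · rw [← h0]; simp
  refine mul_le_mul_of_nonneg_left ?_ h0.le
  have hpos : ∀ i, 0 < P (c i) := fun i =>
    (hP.1 _).lt_of_ne' (Finset.prod_ne_zero_iff.1 h0.ne' i (Finset.mem_univ i))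
  split_ifs with h1 h2
  · exact le_rfl
  · exfalso; apply h2
    have hd : 0 < ∏ i, den (c i) := Finset.prod_pos fun i _ => (hnd _ (hpos i)).2
    have hl := Real.log_lt_log (by positivity) h1
    rw [Real.log_mul (Real.exp_pos _).ne' hd.ne', Real.log_exp,
      Real.log_prod (fun i _ => (hnd _ (hpos i)).2.ne'),
      Real.log_prod (fun i _ => (hnd _ (hpos i)).1.ne')] at hl
    refine le_trans ?_ (le_abs_self _)
    rw [Finset.sum_sub_distrib, Finset.sum_sub_distrib]
    simp only [Finset.sum_const, Finset.card_univ, Fintype.card_fin, nsmul_eq_mul]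
    linarith
  · exact zero_le_one
  · exact le_rfl

/-- law of large numbers for likelihood ratios, lower tail -/
lemma lln_dn {P : α → ℝ} (hP : isP P) (num den : α → ℝ) (hnd : ∀ a, 0 < P a → 0 < num a ∧ 0 < den a)
    {δ : ℝ} (hδ : 0 < δ) {n : ℕ} (hn : 0 < n) (μ : ℝ)
    (hμ : μ = ∑ a, P a * (Real.log (num a) - Real.log (den a))) :
    ∑ c : Fin n → α, (∏ i, P (c i)) *
      (if Real.exp (n * (μ - δ)) * ∏ i, den (c i) < ∏ i, num (c i) then 0 else 1) ≤
      (∑ a, P a * (Real.log (num a) - Real.log (den a) - μ) ^ 2) / (n * δ ^ 2) := by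
  refine le_trans ?_ (cheby hP (fun a => Real.log (num a) - Real.log (den a)) μ hμ hδ hn)
  refine Finset.sum_le_sum fun c _ => ?_
  rcases (Finset.prod_nonneg fun i _ => hP.1 (c i)).eq_or_lt with h0 | h0
  · rw [← h0]; simp
  refine mul_le_mul_of_nonneg_left ?_ h0.le
  have hpos : ∀ i, 0 < P (c i) := fun i =>
    (hP.1 _).lt_of_ne' (Finset.prod_ne_zero_iff.1 h0.ne' i (Finset.mem_univ i))
  split_ifs with h1 h2 h2
  · exact zero_le_one
  · exact le_rfl
  · exact le_rfl
  · exfalso; apply h2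
    have hd : 0 < ∏ i, den (c i) := Finset.prod_pos fun i _ => (hnd _ (hpos i)).2
    have hN : 0 < ∏ i, num (c i) := Finset.prod_pos fun i _ => (hnd _ (hpos i)).1
    have hl := Real.log_le_log hN (not_lt.1 h1)
    rw [Real.log_mul (Real.exp_pos _).ne' hd.ne', Real.log_exp,
      Real.log_prod (fun i _ => (hnd _ (hpos i)).2.ne'),
      Real.log_prod (fun i _ => (hnd _ (hpos i)).1.ne')] at hl
    refine le_trans ?_ (neg_le_abs _)
    rw [Finset.sum_sub_distrib, Finset.sum_sub_distrib]
    simp only [Finset.sum_const, Finset.card_univ, Fintype.card_fin, nsmul_eq_mul]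
    linarith

end oneshot
end WR

set_option linter.unusedSectionVars false
namespace WR

section wt
variable {α β : Type*} [Fintype α] [Fintype β]

/-- output law -/
def out (p : α → ℝ) (W : α → β → ℝ) (b : β) : ℝ := ∑ a, p a * W a b

/-- mutual information in nats -/
def info (p : α → ℝ) (W : α → β → ℝ) : ℝ := Hn (out p W) - ∑ a, p a * Hn (W a)

/-- information variance -/
def tailC (p : α → ℝ) (W : α → β → ℝ) : ℝ :=
  ∑ x : α × β, p x.1 * W x.1 x.2 * (Real.log (W x.1 x.2) - Real.log (out p W x.2) - info p W) ^ 2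

lemma isP_joint {p : α → ℝ} (hp : isP p) {W : α → β → ℝ} (hW : ∀ a, isP (W a)) :
    isP (fun x : α × β => p x.1 * W x.1 x.2) :=
  ⟨fun x => mul_nonneg (hp.1 _) ((hW _).1 _), by
    rw [Fintype.sum_prod_type]; simp_rw [← Finset.mul_sum, (hW _).2]; simp [hp.2]⟩

lemma isP_out {p : α → ℝ} (hp : isP p) {W : α → β → ℝ} (hW : ∀ a, isP (W a)) : isP (out p W) :=
  ⟨fun b => Finset.sum_nonneg fun a _ => mul_nonneg (hp.1 a) ((hW a).1 b), by
    unfold out; rw [Finset.sum_comm]; simp_rw [← Finset.mul_sum, (hW _).2]; simp [hp.2]⟩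

lemma info_eq (p : α → ℝ) (W : α → β → ℝ) : info p W =
    ∑ x : α × β, p x.1 * W x.1 x.2 * (Real.log (W x.1 x.2) - Real.log (out p W x.2)) := by
  rw [Fintype.sum_prod_type]
  simp_rw [mul_sub, Finset.sum_sub_distrib]
  have h1 : ∑ a, ∑ b, p a * W a b * Real.log (out p W b) = - Hn (out p W) := by
    rw [Finset.sum_comm]
    simp_rw [← Finset.sum_mul]
    unfold Hn Real.negMulLog
    simp [out]
  have h2 : ∑ a, ∑ b, p a * W a b * Real.log (W a b) = - ∑ a, p a * Hn (W a) := by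
    rw [← Finset.sum_neg_distrib]
    refine Finset.sum_congr rfl fun a _ => ?_
    unfold Hn Real.negMulLog
    rw [← mul_neg, ← Finset.sum_neg_distrib, Finset.mul_sum]
    refine Finset.sum_congr rfl fun b _ => by ring
  rw [h1, h2]; unfold info; ring

lemma info_nonneg {p : α → ℝ} (hp : isP p) {W : α → β → ℝ} (hW : ∀ a, isP (W a)) :
    0 ≤ info p W := by
  have h := MI_nonneg' _ (isP_joint hp hW)
  rw [Hn_chain p W (fun a _ => (hW a).2)] at h
  have h1 : mg Prod.fst (fun x : α × β => p x.1 * W x.1 x.2) = p := by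
    funext a; rw [mg_fst]; simp [← Finset.mul_sum, (hW a).2]
  have h2 : mg Prod.snd (fun x : α × β => p x.1 * W x.1 x.2) = out p W := by
    funext a; rw [mg_snd]; rfl
  rw [h1, h2] at h
  unfold info; linarith

lemma tailC_nonneg {p : α → ℝ} (hp : isP p) {W : α → β → ℝ} (hW : ∀ a, isP (W a)) :
    0 ≤ tailC p W :=
  Finset.sum_nonneg fun x _ => mul_nonneg ((isP_joint hp hW).1 x) (sq_nonneg _)

lemma joint_pos {p : α → ℝ} (hp : isP p) {W : α → β → ℝ} (hW : ∀ a, isP (W a)) (x : α × β)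
    (hx : 0 < p x.1 * W x.1 x.2) : 0 < W x.1 x.2 ∧ 0 < out p W x.2 := by
  refine ⟨(hW x.1).1 x.2 |>.lt_of_ne (fun h => by rw [← h] at hx; simp at hx), hx.trans_le ?_⟩
  exact Finset.single_le_sum (f := fun a => p a * W a x.2)
    (fun i _ => mul_nonneg (hp.1 i) ((hW i).1 _)) (Finset.mem_univ x.1)

lemma sum_arrow_prod {n : ℕ} (F : (Fin n → α) → (Fin n → β) → ℝ) :
    ∑ a, ∑ b, F a b = ∑ c : Fin n → α × β, F (fun i => (c i).1) (fun i => (c i).2) := by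
  rw [← Fintype.sum_prod_type', ← (Equiv.arrowProdEquivProdArrow (Fin n) (fun _ => α) (fun _ => β)).sum_comp]
  rfl

lemma tail_up {p : α → ℝ} (hp : isP p) {W : α → β → ℝ} (hW : ∀ a, isP (W a))
    {δ : ℝ} (hδ : 0 < δ) {n : ℕ} (hn : 0 < n) :
    ∑ a : Fin n → α, (∏ i, p (a i)) * ∑ b : Fin n → β,
      (if Real.exp (n * (info p W + δ)) * ∏ i, out p W (b i) < ∏ i, W (a i) (b i) then
        ∏ i, W (a i) (b i) else 0) ≤ tailC p W / (n * δ ^ 2) := by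
  have := lln_up (isP_joint hp hW) (fun x => W x.1 x.2) (fun x => out p W x.2)
    (joint_pos hp hW) hδ hn (info p W) (info_eq p W)
  refine le_trans (le_of_eq ?_) this
  simp_rw [Finset.mul_sum]
  rw [sum_arrow_prod (fun a b => (∏ i, p (a i)) *
    (if Real.exp (n * (info p W + δ)) * ∏ i, out p W (b i) < ∏ i, W (a i) (b i) then
        ∏ i, W (a i) (b i) else 0))]
  refine Finset.sum_congr rfl fun c _ => ?_
  rw [Finset.prod_mul_distrib]
  split_ifs <;> simp

lemma tail_dn {p : α → ℝ} (hp : isP p) {W : α → β → ℝ} (hW : ∀ a, isP (W a))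
    {δ : ℝ} (hδ : 0 < δ) {n : ℕ} (hn : 0 < n) :
    ∑ a : Fin n → α, (∏ i, p (a i)) * ∑ b : Fin n → β,
      (if Real.exp (n * (info p W - δ)) * ∏ i, out p W (b i) < ∏ i, W (a i) (b i) then
        0 else ∏ i, W (a i) (b i)) ≤ tailC p W / (n * δ ^ 2) := by
  have := lln_dn (isP_joint hp hW) (fun x => W x.1 x.2) (fun x => out p W x.2)
    (joint_pos hp hW) hδ hn (info p W) (info_eq p W)
  refine le_trans (le_of_eq ?_) this
  simp_rw [Finset.mul_sum]
  rw [sum_arrow_prod (fun a b => (∏ i, p (a i)) *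
    (if Real.exp (n * (info p W - δ)) * ∏ i, out p W (b i) < ∏ i, W (a i) (b i) then
        0 else ∏ i, W (a i) (b i)))]
  refine Finset.sum_congr rfl fun c _ => ?_
  rw [Finset.prod_mul_distrib]
  split_ifs <;> simp

lemma out_pi {p : α → ℝ} {W : α → β → ℝ} {n : ℕ} (b : Fin n → β) :
    ∏ i, out p W (b i) = ∑ a : Fin n → α, (∏ i, p (a i)) * ∏ i, W (a i) (b i) := by
  simp_rw [← Finset.prod_mul_distrib]
  rw [sum_pi_prod (fun i a => p a * W a (b i))]; rfl

lemma exists_le_of_exp {μ f : α → ℝ} (hμ : isP μ) {t : ℝ} (h : ∑ a, μ a * f a ≤ t) :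
    ∃ a, f a ≤ t := by
  by_contra hh
  push Not at hh
  have : ∑ a, μ a * t < ∑ a, μ a * f a := by
    apply Finset.sum_lt_sum
    · intro a _; exact mul_le_mul_of_nonneg_left (hh a).le (hμ.1 a)
    · have : ∃ a, μ a ≠ 0 := by
        by_contra h0; push Not at h0
        have := hμ.2; simp [h0] at this
      obtain ⟨a, ha⟩ := this
      exact ⟨a, Finset.mem_univ a, mul_lt_mul_of_pos_left (hh a) ((hμ.1 a).lt_of_ne' ha)⟩
  rw [← Finset.sum_mul, hμ.2] at this
  linarith

lemma exp_curry {ι κ : Type*} [Fintype ι] [Fintype κ] [DecidableEq ι] [DecidableEq κ]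
    {p : α → ℝ} (hp : isP p) (m : ι) (φ : (κ → α) → ℝ) :
    ∑ c : ι × κ → α, (∏ i, p (c i)) * φ (fun k => c (m, k)) =
      ∑ c : κ → α, (∏ i, p (c i)) * φ c := by
  rw [← (Equiv.curry ι κ α).symm.sum_comp]
  simp_rw [Fintype.prod_prod_type]
  have := exp_pi_one (ι := ι) (p := fun _ (c : κ → α) => ∏ i, p (c i))
    (fun _ => isP_pi (p := fun _ => p) fun _ => hp) m φ
  rw [← this]
  rfl

end wt

lemma ceil_le_two {x : ℝ} (hx : 1 ≤ x) : (⌈x⌉₊ : ℝ) ≤ 2 * x := by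
  have := Nat.ceil_lt_add_one (by linarith : 0 ≤ x)
  linarith

/-- one-shot wiretap coding -/
lemma wiretap_oneshot {α β γ ι κ : Type*} [Fintype α] [Fintype β] [Fintype γ] [Fintype ι] [Fintype κ]
    [DecidableEq ι] [DecidableEq κ] [Nonempty ι] [Nonempty κ]
    {p : α → ℝ} (hp : isP p) (WY : α → β → ℝ) (hWY : ∀ a, isP (WY a))
    (WZ : α → γ → ℝ) (hWZ : ∀ a, isP (WZ a)) {GY GZ : ℝ} (hGY : 0 < GY) (hGZ : 0 < GZ) {ε : ℝ}
    (hε : ((∑ a, p a * ∑ b, if GY * out p WY b < WY a b then 0 else WY a b) +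
        (Fintype.card ι * Fintype.card κ : ℝ) / GY) +
      (2 * (∑ a, p a * ∑ b, if GZ * out p WZ b < WZ a b then WZ a b else 0) +
        Real.sqrt (GZ / Fintype.card κ)) ≤ ε) :
    ∃ (c : ι → κ → α) (dec : β → ι),
      (Fintype.card ι : ℝ)⁻¹ * ∑ m, (Fintype.card κ : ℝ)⁻¹ * ∑ k, ∑ b, WY (c m k) b *
        (if dec b = m then 0 else 1) ≤ ε ∧
      (Fintype.card ι : ℝ)⁻¹ * ∑ m, ∑ z, |(Fintype.card κ : ℝ)⁻¹ * ∑ k, WZ (c m k) z - out p WZ z| ≤ ε := by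
  have hI : (0:ℝ) < Fintype.card ι := by exact_mod_cast Fintype.card_pos
  have hK : (0:ℝ) < Fintype.card κ := by exact_mod_cast Fintype.card_pos
  have hμ : isP (fun c : ι × κ → α => ∏ i, p (c i)) := isP_pi (p := fun _ => p) (fun _ => hp)
  set Suc : (ι × κ → α) → ι × κ → β → ℝ := fun c i b =>
    if (GY * out p WY b < WY (c i) b ∧ ∀ j, j ≠ i → ¬ GY * out p WY b < WY (c j) b) then 0 else 1
    with hSuc
  set E1 : (ι × κ → α) → ℝ := fun c => (Fintype.card ι : ℝ)⁻¹ * ∑ m, (Fintype.card κ : ℝ)⁻¹ *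
    ∑ k, ∑ b, WY (c (m, k)) b * Suc c (m, k) b with hE1
  set E2 : (ι × κ → α) → ℝ := fun c => (Fintype.card ι : ℝ)⁻¹ * ∑ m,
    ∑ z, |(Fintype.card κ : ℝ)⁻¹ * ∑ k, WZ (c (m, k)) z - out p WZ z| with hE2
  have n1 : ∀ c, 0 ≤ E1 c := fun c => by
    refine mul_nonneg (by positivity) (Finset.sum_nonneg fun m _ => mul_nonneg (by positivity)
      (Finset.sum_nonneg fun k _ => Finset.sum_nonneg fun b _ => mul_nonneg ((hWY _).1 _) ?_))
    simp only [hSuc]; split_ifs <;> simp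
  have n2 : ∀ c, 0 ≤ E2 c := fun c =>
    mul_nonneg (by positivity) (Finset.sum_nonneg fun m _ => Finset.sum_nonneg fun k _ => abs_nonneg _)
  have b1 : ∑ c, (∏ i, p (c i)) * E1 c ≤ (∑ a, p a * ∑ b, if GY * out p WY b < WY a b then 0 else WY a b) +
        (Fintype.card ι * Fintype.card κ : ℝ) / GY := by
    have e : ∑ c, (∏ i, p (c i)) * E1 c = (Fintype.card ι : ℝ)⁻¹ * ∑ m, (Fintype.card κ : ℝ)⁻¹ *
        ∑ k, ∑ c : ι × κ → α, (∏ i, p (c i)) * ∑ b, WY (c (m, k)) b * Suc c (m, k) b := by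
      simp only [hE1]
      have : ∀ c : ι × κ → α, (∏ i, p (c i)) * ((Fintype.card ι : ℝ)⁻¹ * ∑ m, (Fintype.card κ : ℝ)⁻¹ *
        ∑ k, ∑ b, WY (c (m, k)) b * Suc c (m, k) b) = (Fintype.card ι : ℝ)⁻¹ * ∑ m, (Fintype.card κ : ℝ)⁻¹ *
        ∑ k, ((∏ i, p (c i)) * ∑ b, WY (c (m, k)) b * Suc c (m, k) b) := by
        intro c
        simp_rw [← Finset.mul_sum]; ring
      simp_rw [this]
      rw [← Finset.mul_sum, Finset.sum_comm]
      congr 1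
      refine Finset.sum_congr rfl fun m _ => ?_
      rw [← Finset.mul_sum, Finset.sum_comm]
    rw [e]
    have hb : ∀ m k, ∑ c : ι × κ → α, (∏ i, p (c i)) * ∑ b, WY (c (m, k)) b * Suc c (m, k) b ≤
      (∑ a, p a * ∑ b, if GY * out p WY b < WY a b then 0 else WY a b) +
        (Fintype.card ι * Fintype.card κ : ℝ) / GY := by
      intro m k
      have := chancode hp WY hWY (out p WY) (fun b => rfl) hGY (m, k)
      rw [Fintype.card_prod, Nat.cast_mul] at this
      convert this using 0
    calc _ ≤ (Fintype.card ι : ℝ)⁻¹ * ∑ m : ι, (Fintype.card κ : ℝ)⁻¹ * ∑ k : κ,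
        ((∑ a, p a * ∑ b, if GY * out p WY b < WY a b then 0 else WY a b) +
        (Fintype.card ι * Fintype.card κ : ℝ) / GY) := by
          gcongr with m _ k _
          exact hb m k
      _ = _ := by
        simp only [Finset.sum_const, Finset.card_univ, nsmul_eq_mul]
        field_simp
  have b2 : ∑ c, (∏ i, p (c i)) * E2 c ≤
      (2 * (∑ a, p a * ∑ b, if GZ * out p WZ b < WZ a b then WZ a b else 0) +
        Real.sqrt (GZ / Fintype.card κ)) := by
    have e : ∑ c, (∏ i, p (c i)) * E2 c = (Fintype.card ι : ℝ)⁻¹ * ∑ m,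
        ∑ c : ι × κ → α, (∏ i, p (c i)) *
          ∑ z, |(Fintype.card κ : ℝ)⁻¹ * ∑ k, WZ (c (m, k)) z - out p WZ z| := by
      simp only [hE2]
      rw [Finset.sum_comm, Finset.mul_sum]
      simp_rw [← Finset.mul_sum]
      rw [Finset.mul_sum]
      refine Finset.sum_congr rfl fun c _ => by ring
    rw [e]
    have hb : ∀ m, ∑ c : ι × κ → α, (∏ i, p (c i)) *
          ∑ z, |(Fintype.card κ : ℝ)⁻¹ * ∑ k, WZ (c (m, k)) z - out p WZ z| ≤
          2 * (∑ a, p a * ∑ b, if GZ * out p WZ b < WZ a b then WZ a b else 0) +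
            Real.sqrt (GZ / Fintype.card κ) := by
      intro m
      rw [exp_curry hp m (fun c => ∑ z, |(Fintype.card κ : ℝ)⁻¹ * ∑ k, WZ (c k) z - out p WZ z|)]
      exact softcover hp WZ hWZ (out p WZ) (fun b => rfl) hGZ
    calc _ ≤ (Fintype.card ι : ℝ)⁻¹ * ∑ m : ι, _ :=
          mul_le_mul_of_nonneg_left (Finset.sum_le_sum fun m _ => hb m) (by positivity)
      _ = _ := by
        simp only [Finset.sum_const, Finset.card_univ, nsmul_eq_mul]
        field_simp
  obtain ⟨c, hc⟩ := exists_le_of_exp (f := fun c => E1 c + E2 c) hμ (t := ε) (by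
    simp_rw [mul_add]; rw [Finset.sum_add_distrib]; linarith)
  refine ⟨fun m k => c (m, k), fun b => if h : ∃ i, GY * out p WY b < WY (c i) b then
    (Classical.choose h).1 else Classical.arbitrary ι, ?_, ?_⟩
  · refine le_trans ?_ (le_trans (le_add_of_nonneg_right (n2 c)) hc)
    simp only [hE1]
    gcongr with m _ k _ b _
    · exact (hWY _).1 b
    · simp only [hSuc]
      by_cases hs : (GY * out p WY b < WY (c (m, k)) b ∧ ∀ j, j ≠ (m, k) → ¬ GY * out p WY b < WY (c j) b)
      · have hex : ∃ i, GY * out p WY b < WY (c i) b := ⟨_, hs.1⟩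
        have : Classical.choose hex = (m, k) := by
          by_contra hne
          exact hs.2 _ hne (Classical.choose_spec hex)
        rw [if_pos hs, if_pos]
        rw [dif_pos hex, this]
      · rw [if_neg hs]; split_ifs <;> simp
  · exact le_trans (le_add_of_nonneg_left (n1 c)) hc

/-- wiretap coding over a DMC -/
lemma wiretap_dmc {α β γ : Type*} [Fintype α] [Fintype β] [Fintype γ]
    {p : α → ℝ} (hp : isP p) (WY : α → β → ℝ) (hWY : ∀ a, isP (WY a))
    (WZ : α → γ → ℝ) (hWZ : ∀ a, isP (WZ a)) {r : ℝ} (hr : 0 ≤ r)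
    (hI : r < info p WY - info p WZ) {ε : ℝ} (hε : 0 < ε) :
    ∃ N : ℕ, 0 < N ∧ ∀ M : ℕ, M = ⌈Real.exp (N * r)⌉₊ → ∃ K : ℕ, 0 < K ∧
    ∃ (c : Fin M → Fin K → (Fin N → α)) (dec : (Fin N → β) → Fin M),
      (M : ℝ)⁻¹ * ∑ m, (K : ℝ)⁻¹ * ∑ k, ∑ b : Fin N → β, (∏ i, WY (c m k i) (b i)) *
        (if dec b = m then 0 else 1) ≤ ε ∧
      (M : ℝ)⁻¹ * ∑ m, ∑ z : Fin N → γ, |(K : ℝ)⁻¹ * ∑ k, ∏ i, WZ (c m k i) (z i) -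
        ∏ i, out p WZ (z i)| ≤ ε := by
  set δ := (info p WY - info p WZ - r) / 4 with hδd
  have hδ : 0 < δ := by rw [hδd]; linarith
  have hIZ := info_nonneg hp hWZ
  have lim : Filter.Tendsto (fun N : ℕ => (tailC p WY / (N * δ ^ 2) + 4 * Real.exp (-(N * δ))) +
      (2 * (tailC p WZ / (N * δ ^ 2)) + Real.sqrt (Real.exp (-(N * δ))))) Filter.atTop (nhds 0) := by
    have hc : Filter.Tendsto (fun N : ℕ => (N:ℝ)) Filter.atTop Filter.atTop :=
      tendsto_natCast_atTop_atTop
    have h1 : ∀ C : ℝ, Filter.Tendsto (fun N : ℕ => C / (N * δ ^ 2)) Filter.atTop (nhds 0) := fun C =>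
      Filter.Tendsto.const_div_atTop (hc.atTop_mul_const (by positivity)) C
    have h2 : Filter.Tendsto (fun N : ℕ => Real.exp (-(N * δ))) Filter.atTop (nhds 0) :=
      Real.tendsto_exp_neg_atTop_nhds_zero.comp (hc.atTop_mul_const hδ)
    have h3 := (Real.continuous_sqrt.tendsto 0).comp h2
    rw [Real.sqrt_zero] at h3
    simpa using ((h1 (tailC p WY)).add (h2.const_mul 4)).add (((h1 (tailC p WZ)).const_mul 2).add h3)
  obtain ⟨N, hN, hN1⟩ := ((lim.eventually (ge_mem_nhds hε)).and (Filter.eventually_gt_atTop 0)).exists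
  refine ⟨N, hN1, fun M hM => ?_⟩
  set K := ⌈Real.exp (N * (info p WZ + 2 * δ))⌉₊ with hKd
  have hK : 0 < K := Nat.ceil_pos.2 (Real.exp_pos _)
  have hM0 : 0 < M := by rw [hM]; exact Nat.ceil_pos.2 (Real.exp_pos _)
  have : Nonempty (Fin M) := ⟨⟨0, hM0⟩⟩
  have : Nonempty (Fin K) := ⟨⟨0, hK⟩⟩
  have hM2 : (M:ℝ) ≤ 2 * Real.exp (N * r) := by
    rw [hM]; exact ceil_le_two (Real.one_le_exp (by positivity))
  have hK2 : (K:ℝ) ≤ 2 * Real.exp (N * (info p WZ + 2 * δ)) := by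
    rw [hKd]; exact ceil_le_two (Real.one_le_exp (by positivity))
  have hK3 : Real.exp (N * (info p WZ + 2 * δ)) ≤ K := Nat.le_ceil _
  have key := wiretap_oneshot (ι := Fin M) (κ := Fin K) (p := fun a : Fin N → α => ∏ i, p (a i))
    (isP_pi (p := fun _ => p) fun _ => hp)
    (fun a (b : Fin N → β) => ∏ i, WY (a i) (b i)) (fun a => isP_pi fun i => hWY (a i))
    (fun a (b : Fin N → γ) => ∏ i, WZ (a i) (b i)) (fun a => isP_pi fun i => hWZ (a i))
    (GY := Real.exp (N * (info p WY - δ))) (GZ := Real.exp (N * (info p WZ + δ)))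
    (Real.exp_pos _) (Real.exp_pos _) (ε := ε)
  have o1 : ∀ b : Fin N → β, out (fun a : Fin N → α => ∏ i, p (a i))
    (fun a (b : Fin N → β) => ∏ i, WY (a i) (b i)) b = ∏ i, out p WY (b i) := fun b => (out_pi b).symm
  have o2 : ∀ b : Fin N → γ, out (fun a : Fin N → α => ∏ i, p (a i))
    (fun a (b : Fin N → γ) => ∏ i, WZ (a i) (b i)) b = ∏ i, out p WZ (b i) := fun b => (out_pi b).symm
  simp only [o1, o2, Fintype.card_fin] at key
  obtain ⟨c, dec, h1, h2⟩ := key (by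
    refine le_trans ?_ hN
    have t1 := tail_dn hp hWY hδ hN1
    have t2 := tail_up hp hWZ hδ hN1
    have t3 : (M * K : ℝ) / Real.exp (N * (info p WY - δ)) ≤ 4 * Real.exp (-(N * δ)) := by
      rw [div_le_iff₀ (Real.exp_pos _), mul_assoc, ← Real.exp_add]
      calc (M * K : ℝ) ≤ (2 * Real.exp (N * r)) * (2 * Real.exp (N * (info p WZ + 2 * δ))) := by gcongr
        _ = 4 * Real.exp (N * r + N * (info p WZ + 2 * δ)) := by rw [Real.exp_add]; ring
        _ ≤ _ := by
          gcongr 4 * Real.exp ?_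
          have : info p WY = info p WZ + r + 4 * δ := by rw [hδd]; ring
          rw [this]; nlinarith
    have t4 : Real.sqrt (Real.exp (N * (info p WZ + δ)) / K) ≤ Real.sqrt (Real.exp (-(N * δ))) := by
      apply Real.sqrt_le_sqrt
      rw [div_le_iff₀ (by positivity)]
      calc _ = Real.exp (-(N * δ)) * Real.exp (N * (info p WZ + 2 * δ)) := by
            rw [← Real.exp_add]; ring_nf
        _ ≤ _ := by gcongr
    gcongr)
  exact ⟨K, hK, c, dec, h1, h2⟩

end WR

set_option linter.unusedSectionVars false
namespace WR

lemma sum_snoc {n : ℕ} {α : Type*} [Fintype α] (F : (Fin (n + 1) → α) → ℝ) :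
    ∑ c, F c = ∑ c : Fin n → α, ∑ a, F (Fin.snoc (α := fun _ => α) c a) := by
  rw [← (Fin.snocEquiv (fun _ : Fin (n + 1) => α)).sum_comp, Fintype.sum_prod_type, Finset.sum_comm]
  rfl

lemma causal_sum {S : Type*} [Fintype S] (n : ℕ) (k : (t : Fin n) → (Fin t.1 → S) → S → ℝ)
    (hk : ∀ t h, ∑ s, k t h s = 1) :
    ∑ s : Fin n → S, ∏ t : Fin n, k t (fun j => s ⟨j.1, lt_trans j.2 t.isLt⟩) (s t) = 1 := by
  induction n with
  | zero => simp
  | succ n ih =>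
    rw [sum_snoc]
    have h1 := ih (fun t => k t.castSucc) (fun t h => hk _ _)
    rw [← h1]
    refine Finset.sum_congr rfl fun c _ => ?_
    simp_rw [Fin.prod_univ_castSucc]
    have e1 : ∀ (a : S) (t : Fin n), k t.castSucc
        (fun j => Fin.snoc (α := fun _ => S) c a ⟨j.1, lt_trans j.2 t.castSucc.isLt⟩)
        (Fin.snoc (α := fun _ => S) c a t.castSucc) =
        k t.castSucc (fun j => c ⟨j.1, lt_trans j.2 t.isLt⟩) (c t) := by
      intro a t
      rw [Fin.snoc_castSucc]
      congr 1
      funext j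
      exact Fin.snoc_castSucc (α := fun _ => S) a c ⟨j.1, lt_trans j.2 t.isLt⟩
    have e2 : ∀ (a : S), k (Fin.last n)
        (fun j => Fin.snoc (α := fun _ => S) c a ⟨j.1, lt_trans j.2 (Fin.last n).isLt⟩)
        (Fin.snoc (α := fun _ => S) c a (Fin.last n)) =
        k (Fin.last n) (fun j => c ⟨j.1, j.2⟩) a := by
      intro a
      rw [Fin.snoc_last]
      congr 1
      funext j
      exact Fin.snoc_castSucc (α := fun _ => S) a c ⟨j.1, j.2⟩
    simp_rw [e1, e2]
    rw [← Finset.mul_sum, hk, mul_one]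
    rfl

section outer
variable {X Xr Yr Y Z : Type} [Fintype X] [Fintype Xr] [Fintype Yr] [Fintype Y] [Fintype Z]

/-- product of relay kernels -/
def RL {Xr Yr : Type} {n : ℕ} (relay : (t : Fin n) → (Fin t.1 → Yr) → (Fin t.1 → Xr) → Xr → ℝ)
    (yr : Fin n → Yr) (xr : Fin n → Xr) : ℝ :=
  ∏ t : Fin n, relay t (fun j => yr ⟨j.1, lt_trans j.2 t.isLt⟩)
      (fun j => xr ⟨j.1, lt_trans j.2 t.isLt⟩) (xr t)

/-- effective channel -/
def Chn {n : ℕ} (relay : (t : Fin n) → (Fin t.1 → Yr) → (Fin t.1 → Xr) → Xr → ℝ)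
    (W : X × Xr → Yr × Y × Z → ℝ) (e : (Fin n → X) → ℝ) (o : (Fin n → Y) × (Fin n → Z)) : ℝ :=
  ∑ w : (Fin n → X) × (Fin n → Xr) × (Fin n → Yr), e w.1 * RL relay w.2.2 w.2.1 *
    ∏ t, W (w.1 t, w.2.1 t) (w.2.2 t, o.1 t, o.2 t)

lemma isP_Chn {n : ℕ} {relay : (t : Fin n) → (Fin t.1 → Yr) → (Fin t.1 → Xr) → Xr → ℝ}
    (hrelay : ∀ t yp xp, isP (relay t yp xp))
    {W : X × Xr → Yr × Y × Z → ℝ} (hW : ∀ x, isP (W x)) {e : (Fin n → X) → ℝ} (he : isP e) :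
    isP (Chn relay W e) := by
  constructor
  · intro o
    refine Finset.sum_nonneg fun w _ => mul_nonneg (mul_nonneg (he.1 _)
      (Finset.prod_nonneg fun t _ => (hrelay _ _ _).1 _)) (Finset.prod_nonneg fun t _ => (hW _).1 _)
  · unfold Chn
    rw [Finset.sum_comm, Fintype.sum_prod_type]
    simp_rw [mul_assoc, ← Finset.mul_sum]
    have key : ∀ x : Fin n → X, ∑ v : (Fin n → Xr) × (Fin n → Yr), RL relay v.2 v.1 *
        ∑ o : (Fin n → Y) × (Fin n → Z), ∏ t, W (x t, v.1 t) (v.2 t, o.1 t, o.2 t) = 1 := by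
      intro x
      have h := causal_sum n (S := Xr × Yr × Y × Z)
        (fun t h s => relay t (fun j => (h j).2.1) (fun j => (h j).1) s.1 * W (x t, s.1) s.2) (by
          intro t h
          rw [Fintype.sum_prod_type]
          simp_rw [← Finset.mul_sum, (hW _).2, mul_one]
          exact (hrelay _ _ _).2)
      rw [← h]
      simp_rw [Finset.mul_sum, Fintype.sum_prod_type]
      rw [← (Equiv.arrowProdEquivProdArrow (Fin n) (fun _ => Xr) (fun _ => Yr × Y × Z)).symm.sum_comp,
        Fintype.sum_prod_type]
      refine Finset.sum_congr rfl fun xr _ => ?_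
      rw [← (Equiv.arrowProdEquivProdArrow (Fin n) (fun _ => Yr) (fun _ => Y × Z)).symm.sum_comp,
        Fintype.sum_prod_type]
      refine Finset.sum_congr rfl fun yr _ => ?_
      rw [← (Equiv.arrowProdEquivProdArrow (Fin n) (fun _ => Y) (fun _ => Z)).symm.sum_comp,
        Fintype.sum_prod_type]
      refine Finset.sum_congr rfl fun y _ => ?_
      refine Finset.sum_congr rfl fun z _ => ?_
      rw [Finset.prod_mul_distrib]
      rfl
    rw [← he.2]
    refine Finset.sum_congr rfl fun x _ => ?_
    rw [key x, mul_one]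

/-- split a long sequence into blocks -/
def blk (N T : ℕ) (S : Type*) : (Fin (N * T) → S) ≃ (Fin N → Fin T → S) :=
  (Equiv.arrowCongr finProdFinEquiv.symm (Equiv.refl S)).trans (Equiv.curry _ _ _)

lemma blk_apply {N T : ℕ} {S : Type*} (x : Fin (N * T) → S) (i : Fin N) (s : Fin T) :
    blk N T S x i s = x (finProdFinEquiv (i, s)) := rfl

lemma prod_blk {N T : ℕ} (F : Fin (N * T) → ℝ) :
    ∏ t, F t = ∏ i : Fin N, ∏ s : Fin T, F (finProdFinEquiv (i, s)) := by
  rw [← finProdFinEquiv.prod_comp, Fintype.prod_prod_type]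

/-- relay repeated with resets -/
def relRep {N T : ℕ} (relay : (t : Fin T) → (Fin t.1 → Yr) → (Fin t.1 → Xr) → Xr → ℝ) :
    (t : Fin (N * T)) → (Fin t.1 → Yr) → (Fin t.1 → Xr) → Xr → ℝ := fun t yp xp =>
  relay ⟨t.1 % T, Nat.mod_lt _ (Nat.pos_of_ne_zero fun h => by
      subst h; exact absurd t.2 (by simp))⟩
    (fun j => yp ⟨T * (t.1 / T) + j.1, by
      have := j.2; have h2 := Nat.div_add_mod t.1 T; simp only at this; omega⟩)
    (fun j => xp ⟨T * (t.1 / T) + j.1, by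
      have := j.2; have h2 := Nat.div_add_mod t.1 T; simp only at this; omega⟩)

lemma rel_congr {T : ℕ} (relay : (t : Fin T) → (Fin t.1 → Yr) → (Fin t.1 → Xr) → Xr → ℝ)
    {s s' : Fin T} (h : s = s') (y : Fin s.1 → Yr) (y' : Fin s'.1 → Yr) (x : Fin s.1 → Xr)
    (x' : Fin s'.1 → Xr) (hy : ∀ j h1 h2, y ⟨j, h1⟩ = y' ⟨j, h2⟩)
    (hx : ∀ j h1 h2, x ⟨j, h1⟩ = x' ⟨j, h2⟩) (a : Xr) : relay s y x a = relay s' y' x' a := by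
  subst h
  have : y = y' := funext fun j => hy j.1 j.2 j.2
  have : x = x' := funext fun j => hx j.1 j.2 j.2
  subst_vars; rfl

lemma RL_rep {N T : ℕ} (relay : (t : Fin T) → (Fin t.1 → Yr) → (Fin t.1 → Xr) → Xr → ℝ)
    (yr : Fin (N * T) → Yr) (xr : Fin (N * T) → Xr) :
    RL (relRep (N := N) relay) yr xr = ∏ i, RL relay (blk N T Yr yr i) (blk N T Xr xr i) := by
  unfold RL
  rw [prod_blk]
  refine Finset.prod_congr rfl fun i _ => Finset.prod_congr rfl fun s _ => ?_
  have hs := s.2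
  have hv : ((finProdFinEquiv (i, s) : Fin (N * T)) : ℕ) = s.1 + T * i.1 := rfl
  have hm : (s.1 + T * i.1) % T = s.1 := by rw [Nat.add_mul_mod_self_left, Nat.mod_eq_of_lt hs]
  have hd : (s.1 + T * i.1) / T = i.1 := by
    rw [Nat.add_mul_div_left _ _ (by omega), Nat.div_eq_of_lt hs, zero_add]
  unfold relRep
  apply rel_congr
  · apply Fin.ext
    simp only [hv, hm]
  · intro j h1 h2
    rw [blk_apply]
    change yr _ = yr _
    congr 1
    apply Fin.ext
    simp only [hv, hd, finProdFinEquiv_apply_val]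
    ring
  · intro j h1 h2
    rw [blk_apply]
    change xr _ = xr _
    congr 1
    apply Fin.ext
    simp only [hv, hd, finProdFinEquiv_apply_val]
    ring

lemma Chn_rep {N T : ℕ} (relay : (t : Fin T) → (Fin t.1 → Yr) → (Fin t.1 → Xr) → Xr → ℝ)
    (W : X × Xr → Yr × Y × Z → ℝ) (e : Fin N → (Fin T → X) → ℝ)
    (o : (Fin (N * T) → Y) × (Fin (N * T) → Z)) :
    Chn (relRep (N := N) relay) W (fun x => ∏ i, e i (blk N T X x i)) o =
      ∏ i, Chn relay W (e i) (blk N T Y o.1 i, blk N T Z o.2 i) := by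
  unfold Chn
  rw [← sum_pi_prod (fun i (w : (Fin T → X) × (Fin T → Xr) × (Fin T → Yr)) => e i w.1 * RL relay w.2.2 w.2.1 *
    ∏ t, W (w.1 t, w.2.1 t) (w.2.2 t, (blk N T Y o.1 i, blk N T Z o.2 i).1 t,
      (blk N T Y o.1 i, blk N T Z o.2 i).2 t))]
  rw [← ((Equiv.prodCongr (blk N T X) ((Equiv.prodCongr (blk N T Xr) (blk N T Yr)).trans
      (Equiv.arrowProdEquivProdArrow (Fin N) (fun _ => Fin T → Xr) (fun _ => Fin T → Yr)).symm)).trans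
      (Equiv.arrowProdEquivProdArrow (Fin N) (fun _ => Fin T → X)
        (fun _ => (Fin T → Xr) × (Fin T → Yr))).symm).sum_comp]
  refine Finset.sum_congr rfl fun w _ => ?_
  rw [RL_rep, prod_blk, Finset.prod_mul_distrib, Finset.prod_mul_distrib]
  rfl

lemma Chn_smul {n : ℕ} (relay : (t : Fin n) → (Fin t.1 → Yr) → (Fin t.1 → Xr) → Xr → ℝ)
    (W : X × Xr → Yr × Y × Z → ℝ) {κ : Type*} [Fintype κ] (a : ℝ) (e : κ → (Fin n → X) → ℝ)
    (o : (Fin n → Y) × (Fin n → Z)) :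
    Chn relay W (fun x => a * ∑ k, e k x) o = a * ∑ k, Chn relay W (e k) o := by
  unfold Chn
  rw [Finset.sum_comm, Finset.mul_sum]
  refine Finset.sum_congr rfl fun w _ => ?_
  rw [← Finset.sum_mul, ← Finset.sum_mul]; ring

lemma tsum_nat_prod {β : Type*} [Fintype β] (M : ℕ) (f : ℕ × β → ℝ)
    (hf : ∀ m b, M ≤ m → f (m, b) = 0) : ∑' a, f a = ∑ m : Fin M, ∑ b, f (m.1, b) := by
  rw [tsum_eq_sum (s := Finset.range M ×ˢ Finset.univ), Finset.sum_product,
    ← Fin.sum_univ_eq_sum_range (fun m => ∑ b, f (m, b))]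
  rintro ⟨m, b⟩ h
  apply hf
  simpa using h

/-- the finite form of the conclusion suffices -/
lemma finite_form {n M : ℕ} (hM : 0 < M) (W : X × Xr → Yr × Y × Z → ℝ)
    (enc : ℕ → (Fin n → X) → ℝ)
    (relay : (t : Fin n) → (Fin t.1 → Yr) → (Fin t.1 → Xr) → Xr → ℝ)
    (dec : (Fin n → Y) → Fin M) {ε : ℝ} (qz : (Fin n → Z) → ℝ)
    (h1 : (M : ℝ)⁻¹ * ∑ m : Fin M, ∑ y, (∑ z, Chn relay W (enc m.1) (y, z)) *
      (if dec y = m then 0 else 1) ≤ ε)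
    (h2 : (M : ℝ)⁻¹ * ∑ m : Fin M, ∑ z, |(∑ y, Chn relay W (enc m.1) (y, z)) - qz z| ≤ ε) :
      (∑' a : ℕ × (Fin n → X) × (Fin n → Xr) × (Fin n → Yr) × (Fin n → Y) × (Fin n → Z),
          relayInduced n M W enc relay a *
            (if (fun y => (dec y).1) a.2.2.2.2.1 = a.1 then 0 else 1)) ≤ ε ∧
      TV
        (pmap (fun a : ℕ × (Fin n → X) × (Fin n → Xr) × (Fin n → Yr) × (Fin n → Y) ×
            (Fin n → Z) => (a.1, a.2.2.2.2.2))
          (relayInduced n M W enc relay))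
        (fun mz : ℕ × (Fin n → Z) => unifPmf M mz.1 *
          pmap (fun a : ℕ × (Fin n → X) × (Fin n → Xr) × (Fin n → Yr) × (Fin n → Y) ×
              (Fin n → Z) => a.2.2.2.2.2)
            (relayInduced n M W enc relay) mz.2) ≤ ε := by
  have hM' : (0:ℝ) < M := by exact_mod_cast hM
  have hz : ∀ m b, M ≤ m → relayInduced n M W enc relay (m, b) = 0 := by
    intro m b h
    unfold relayInduced unifPmf
    simp [not_lt.2 h]
  have hv : ∀ (m : Fin M) b, relayInduced n M W enc relay (m.1, b) = (M:ℝ)⁻¹ *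
      (enc m.1 b.1 * RL relay b.2.2.1 b.2.1 * ∏ t, W (b.1 t, b.2.1 t) (b.2.2.1 t, b.2.2.2.1 t, b.2.2.2.2 t)) := by
    intro m b
    unfold relayInduced unifPmf RL
    simp only [m.2, if_true]; ring
  have hs : ∀ (m : Fin M) (φ : (Fin n → Y) → (Fin n → Z) → ℝ),
      ∑ b : (Fin n → X) × (Fin n → Xr) × (Fin n → Yr) × (Fin n → Y) × (Fin n → Z),
        relayInduced n M W enc relay (m.1, b) * φ b.2.2.2.1 b.2.2.2.2 =
      (M:ℝ)⁻¹ * ∑ y, ∑ z, Chn relay W (enc m.1) (y, z) * φ y z := by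
    intro m φ
    simp_rw [hv]
    unfold Chn
    simp_rw [Finset.sum_mul]
    rw [← Fintype.sum_prod_type' (fun y z => ∑ w : (Fin n → X) × (Fin n → Xr) × (Fin n → Yr),
      enc m.1 w.1 * RL relay w.2.2 w.2.1 *
      (∏ t, W (w.1 t, w.2.1 t) (w.2.2 t, y t, z t)) * φ y z)]
    rw [Finset.sum_comm]
    simp_rw [Fintype.sum_prod_type, Finset.mul_sum]
    refine Finset.sum_congr rfl fun _ _ => Finset.sum_congr rfl fun _ _ =>
      Finset.sum_congr rfl fun _ _ => Finset.sum_congr rfl fun _ _ => Finset.sum_congr rfl fun _ _ => ?_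
    ring
  constructor
  · rw [tsum_nat_prod M _ (fun m b h => by rw [hz m b h, zero_mul])]
    refine le_trans (le_of_eq ?_) h1
    rw [Finset.mul_sum]
    refine Finset.sum_congr rfl fun m _ => ?_
    have := hs m (fun y z => if dec y = m then 0 else 1)
    simp only [Fin.ext_iff] at this ⊢
    rw [this]
    simp_rw [Finset.sum_mul]
  · set PZ : Fin M → (Fin n → Z) → ℝ := fun m z => ∑ y, Chn relay W (enc m.1) (y, z) with hPZ
    have p1 : ∀ (m : Fin M) z, pmap (fun a : ℕ × (Fin n → X) × (Fin n → Xr) × (Fin n → Yr) × (Fin n → Y) ×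
            (Fin n → Z) => (a.1, a.2.2.2.2.2)) (relayInduced n M W enc relay) (m.1, z) = (M:ℝ)⁻¹ * PZ m z := by
      intro m z
      unfold pmap
      rw [tsum_nat_prod M _ (fun m b h => by rw [hz m b h, ite_self])]
      rw [Finset.sum_eq_single m]
      · have := hs m (fun y z' => if z' = z then 1 else 0)
        simp only [mul_ite, mul_one, mul_zero, Finset.sum_ite_eq', Finset.mem_univ, if_true] at this
        simp only [Prod.mk.injEq, true_and]
        exact this
      · intro m' _ hm'
        refine Finset.sum_eq_zero fun b _ => if_neg ?_
        rw [Prod.mk.injEq]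
        exact fun h => hm' (Fin.ext h.1)
      · simp
    have p1' : ∀ m z, M ≤ m → pmap (fun a : ℕ × (Fin n → X) × (Fin n → Xr) × (Fin n → Yr) × (Fin n → Y) ×
            (Fin n → Z) => (a.1, a.2.2.2.2.2)) (relayInduced n M W enc relay) (m, z) = 0 := by
      intro m z hm
      unfold pmap
      rw [tsum_nat_prod M _ (fun m b h => by rw [hz m b h, ite_self])]
      refine Finset.sum_eq_zero fun m' _ => Finset.sum_eq_zero fun b _ => if_neg ?_
      rw [Prod.mk.injEq]
      rintro ⟨h, -⟩
      have := m'.2; simp only at h; omega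
    have p2 : ∀ z, pmap (fun a : ℕ × (Fin n → X) × (Fin n → Xr) × (Fin n → Yr) × (Fin n → Y) ×
            (Fin n → Z) => a.2.2.2.2.2) (relayInduced n M W enc relay) z = (M:ℝ)⁻¹ * ∑ m, PZ m z := by
      intro z
      unfold pmap
      rw [tsum_nat_prod M _ (fun m b h => by rw [hz m b h, ite_self]), Finset.mul_sum]
      refine Finset.sum_congr rfl fun m _ => ?_
      have := hs m (fun y z' => if z' = z then 1 else 0)
      simp only [mul_ite, mul_one, mul_zero, Finset.sum_ite_eq', Finset.mem_univ, if_true] at this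
      convert this
    unfold TV
    rw [tsum_nat_prod M _ (fun m z h => by
      rw [p1' m z h]; unfold unifPmf; simp [not_lt.2 h])]
    have bd : ∀ (m : Fin M) z, |pmap (fun a : ℕ × (Fin n → X) × (Fin n → Xr) × (Fin n → Yr) × (Fin n → Y) ×
            (Fin n → Z) => (a.1, a.2.2.2.2.2)) (relayInduced n M W enc relay) (m.1, z) -
          unifPmf M m.1 * pmap (fun a : ℕ × (Fin n → X) × (Fin n → Xr) × (Fin n → Yr) × (Fin n → Y) ×
            (Fin n → Z) => a.2.2.2.2.2) (relayInduced n M W enc relay) z| ≤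
          (M:ℝ)⁻¹ * (|PZ m z - qz z| + (M:ℝ)⁻¹ * ∑ m', |PZ m' z - qz z|) := by
      intro m z
      rw [p1, p2]
      unfold unifPmf
      rw [if_pos m.2, ← mul_sub, abs_mul, abs_of_pos (inv_pos.2 hM')]
      refine mul_le_mul_of_nonneg_left ?_ (by positivity)
      have e : PZ m z - (M:ℝ)⁻¹ * ∑ m', PZ m' z =
          (PZ m z - qz z) - (M:ℝ)⁻¹ * ∑ m', (PZ m' z - qz z) := by
        rw [Finset.sum_sub_distrib, Finset.sum_const, Finset.card_univ, Fintype.card_fin,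
          nsmul_eq_mul]
        field_simp; ring
      rw [e]
      refine (abs_sub _ _).trans (add_le_add le_rfl ?_)
      rw [abs_mul, abs_of_pos (inv_pos.2 hM')]
      exact mul_le_mul_of_nonneg_left (Finset.abs_sum_le_sum_abs _ _) (by positivity)
    refine le_trans (mul_le_mul_of_nonneg_left (Finset.sum_le_sum fun m _ =>
      Finset.sum_le_sum fun z _ => bd m z) (by norm_num)) ?_
    refine le_trans (le_of_eq ?_) h2
    simp_rw [← Finset.mul_sum, Finset.sum_add_distrib, ← Finset.mul_sum]
    rw [Finset.sum_const, Finset.card_univ, Fintype.card_fin, nsmul_eq_mul,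
      Finset.sum_comm (s := (Finset.univ : Finset (Fin n → Z)))]
    field_simp
    ring

end outer
end WR

set_option linter.unusedSectionVars false
namespace WR

lemma sum_blk {N T : ℕ} {S : Type*} [Fintype S] (F : (Fin N → Fin T → S) → ℝ) :
    ∑ z : Fin (N * T) → S, F (blk N T S z) = ∑ z, F z := (blk N T S).sum_comp F

lemma nMsg_eq (N T : ℕ) (R : ℝ) : nMsg (N * T) R = ⌈Real.exp (N * (T * (R * Real.log 2)))⌉₊ := by
  unfold nMsg
  rw [Real.rpow_def_of_pos (by norm_num)]
  congr 2
  push_cast; ring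

theorem outer {X Xr Yr Y Z A : Type} [Fintype X] [Fintype Xr] [Fintype Yr] [Fintype Y] [Fintype Z]
    [Fintype A] (W : X × Xr → Yr × Y × Z → ℝ) (hW : ∀ x, isP (W x)) {T : ℕ} (hT : 0 < T)
    {pA : A → ℝ} (hpA : isP pA) (enc1 : A → (Fin T → X) → ℝ) (henc1 : ∀ a, isP (enc1 a))
    (relay1 : (t : Fin T) → (Fin t.1 → Yr) → (Fin t.1 → Xr) → Xr → ℝ)
    (hrelay1 : ∀ t yp xp, isP (relay1 t yp xp)) {R : ℝ} (hR0 : 0 ≤ R)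
    (hR : T * (R * Real.log 2) < info pA (fun a y => ∑ z, Chn relay1 W (enc1 a) (y, z)) -
      info pA (fun a z => ∑ y, Chn relay1 W (enc1 a) (y, z))) :
    ∀ ε > (0 : ℝ), ∃ (n : ℕ) (enc : ℕ → (Fin n → X) → ℝ)
      (relay : (t : Fin n) → (Fin t.1 → Yr) → (Fin t.1 → Xr) → Xr → ℝ)
      (dec : (Fin n → Y) → ℕ),
      0 < n ∧
      (∀ m, IsPmf (enc m)) ∧
      (∀ t yp xp, IsPmf (relay t yp xp)) ∧
      (∑' a : ℕ × (Fin n → X) × (Fin n → Xr) × (Fin n → Yr) × (Fin n → Y) × (Fin n → Z),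
          relayInduced n (nMsg n R) W enc relay a *
            (if dec a.2.2.2.2.1 = a.1 then 0 else 1)) ≤ ε ∧
      TV
        (pmap (fun a : ℕ × (Fin n → X) × (Fin n → Xr) × (Fin n → Yr) × (Fin n → Y) ×
            (Fin n → Z) => (a.1, a.2.2.2.2.2))
          (relayInduced n (nMsg n R) W enc relay))
        (fun mz : ℕ × (Fin n → Z) => unifPmf (nMsg n R) mz.1 *
          pmap (fun a : ℕ × (Fin n → X) × (Fin n → Xr) × (Fin n → Yr) × (Fin n → Y) ×
              (Fin n → Z) => a.2.2.2.2.2)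
            (relayInduced n (nMsg n R) W enc relay) mz.2) ≤ ε := by
  intro ε hε
  have hC : ∀ a, isP (Chn relay1 W (enc1 a)) := fun a => isP_Chn hrelay1 hW (henc1 a)
  set ΓY : A → (Fin T → Y) → ℝ := fun a y => ∑ z, Chn relay1 W (enc1 a) (y, z) with hΓY
  set ΓZ : A → (Fin T → Z) → ℝ := fun a z => ∑ y, Chn relay1 W (enc1 a) (y, z) with hΓZ
  have hY : ∀ a, isP (ΓY a) := fun a => by
    refine ⟨fun y => Finset.sum_nonneg fun z _ => (hC a).1 _, ?_⟩
    rw [← (hC a).2, Fintype.sum_prod_type]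
  have hZ : ∀ a, isP (ΓZ a) := fun a => by
    refine ⟨fun y => Finset.sum_nonneg fun z _ => (hC a).1 _, ?_⟩
    rw [← (hC a).2, Fintype.sum_prod_type, Finset.sum_comm]
  obtain ⟨N, hN, hrest⟩ := wiretap_dmc hpA ΓY hY ΓZ hZ (r := T * (R * Real.log 2))
    (mul_nonneg (by positivity) (mul_nonneg hR0 (Real.log_nonneg (by norm_num)))) hR hε
  have hM : 0 < nMsg (N * T) R := by rw [nMsg_eq]; exact Nat.ceil_pos.2 (Real.exp_pos _)
  obtain ⟨M, hMd⟩ : ∃ M, M = nMsg (N * T) R := ⟨_, rfl⟩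
  obtain ⟨K, hK, c, dec, h1, h2⟩ := hrest M (hMd.trans (nMsg_eq N T R))
  rw [← hMd] at hM
  have hK' : (0:ℝ) < K := by exact_mod_cast hK
  set enc0 : Fin M → (Fin (N * T) → X) → ℝ := fun m x =>
    (K:ℝ)⁻¹ * ∑ k, ∏ i, enc1 (c m k i) (blk N T X x i) with henc0
  have henc0P : ∀ m, isP (enc0 m) := by
    intro m
    refine ⟨fun x => mul_nonneg (by positivity) (Finset.sum_nonneg fun k _ =>
      Finset.prod_nonneg fun i _ => (henc1 _).1 _), ?_⟩
    simp only [henc0]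
    rw [sum_blk (fun x => (K:ℝ)⁻¹ * ∑ k, ∏ i, enc1 (c m k i) (x i)), ← Finset.mul_sum,
      Finset.sum_comm]
    have : ∀ k, ∑ x : Fin N → Fin T → X, ∏ i, enc1 (c m k i) (x i) = 1 := fun k =>
      (isP_pi fun i => henc1 (c m k i)).2
    simp [this, hK'.ne']
  set enc : ℕ → (Fin (N * T) → X) → ℝ := fun m => if h : m < M then enc0 ⟨m, h⟩ else enc0 ⟨0, hM⟩
    with henc
  have hencm : ∀ m : Fin M, enc m.1 = enc0 m := fun m => by simp [henc]
  have hCh : ∀ (m : Fin M) (o : (Fin (N * T) → Y) × (Fin (N * T) → Z)),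
      Chn (relRep (N := N) relay1) W (enc m.1) o =
      (K:ℝ)⁻¹ * ∑ k, ∏ i, Chn relay1 W (enc1 (c m k i)) (blk N T Y o.1 i, blk N T Z o.2 i) := by
    intro m o
    rw [hencm]; simp only [henc0]
    rw [Chn_smul _ _ _ (fun k x => ∏ i, enc1 (c m k i) (blk N T X x i))]
    congr 1
    refine Finset.sum_congr rfl fun k _ => ?_
    exact Chn_rep relay1 W (fun i => enc1 (c m k i)) o
  have hCY : ∀ (m : Fin M) y, ∑ z, Chn (relRep (N := N) relay1) W (enc m.1) (y, z) =
      (K:ℝ)⁻¹ * ∑ k, ∏ i, ΓY (c m k i) (blk N T Y y i) := by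
    intro m y
    simp_rw [hCh]
    rw [← Finset.mul_sum, Finset.sum_comm]
    congr 1
    refine Finset.sum_congr rfl fun k _ => ?_
    simp only [hΓY]
    rw [sum_blk (fun z => ∏ i, Chn relay1 W (enc1 (c m k i)) (blk N T Y y i, z i)),
      sum_pi_prod (fun i z => Chn relay1 W (enc1 (c m k i)) (blk N T Y y i, z))]
  have hCZ : ∀ (m : Fin M) z, ∑ y, Chn (relRep (N := N) relay1) W (enc m.1) (y, z) =
      (K:ℝ)⁻¹ * ∑ k, ∏ i, ΓZ (c m k i) (blk N T Z z i) := by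
    intro m z
    simp_rw [hCh]
    rw [← Finset.mul_sum, Finset.sum_comm]
    congr 1
    refine Finset.sum_congr rfl fun k _ => ?_
    simp only [hΓZ]
    rw [sum_blk (fun y => ∏ i, Chn relay1 W (enc1 (c m k i)) (y i, blk N T Z z i)),
      sum_pi_prod (fun i y => Chn relay1 W (enc1 (c m k i)) (y, blk N T Z z i))]
  have fin := finite_form (n := N * T) hM W enc (relRep (N := N) relay1)
    (fun y => dec (blk N T Y y)) (ε := ε)
    (fun z => ∏ i, out pA ΓZ (blk N T Z z i)) (by
      simp_rw [hCY]
      refine le_trans (le_of_eq ?_) h1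
      congr 1
      refine Finset.sum_congr rfl fun m _ => ?_
      rw [sum_blk (fun y => ((K:ℝ)⁻¹ * ∑ k, ∏ i, ΓY (c m k i) (y i)) * if dec y = m then 0 else 1)]
      simp_rw [mul_assoc]
      rw [← Finset.mul_sum, Finset.sum_comm]
      simp_rw [Finset.sum_mul]) (by
      simp_rw [hCZ]
      refine le_trans (le_of_eq ?_) h2
      congr 1
      refine Finset.sum_congr rfl fun m _ => ?_
      rw [sum_blk (fun z => |(K:ℝ)⁻¹ * ∑ k, ∏ i, ΓZ (c m k i) (z i) - ∏ i, out pA ΓZ (z i)|)])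
  refine ⟨N * T, enc, relRep (N := N) relay1, fun y => (dec (blk N T Y y)).1, Nat.mul_pos hN hT,
    fun m => isP_iff.2 ?_, fun t yp xp => isP_iff.2 (hrelay1 _ _ _), hMd ▸ fin.1, hMd ▸ fin.2⟩
  simp only [henc]; split_ifs
  · exact henc0P _
  · exact henc0P _

end WR

set_option linter.unusedSectionVars false
namespace WR

section path
variable {S S' Λ : Type*} [Fintype S] [Fintype S'] [Fintype Λ] [Nonempty Λ]

/-- law of (outputs, final state) of a hidden Markov chain started uniformly -/
def pl (K : Λ → S × Λ → ℝ) : (B : ℕ) → (Fin B → S) × Λ → ℝ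
  | 0 => fun _ => (Fintype.card Λ : ℝ)⁻¹
  | B + 1 => fun x => ∑ l, pl K B (Fin.init (α := fun _ => S) x.1, l) * K l (x.1 (Fin.last B), x.2)

def mapK (f : S → S') (K : Λ → S × Λ → ℝ) (l : Λ) (x : S' × Λ) : ℝ :=
  ∑ s, if f s = x.1 then K l (s, x.2) else 0

def augK (K : Λ → S × Λ → ℝ) (l : Λ) (x : (S × Λ) × Λ) : ℝ :=
  if x.1.2 = l then K l (x.1.1, x.2) else 0

/-- the uniform distribution is invariant -/
def uinv (K : Λ → S × Λ → ℝ) : Prop := ∀ l', ∑ l, ∑ s, K l (s, l') = 1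

lemma cardpos : (0:ℝ) < Fintype.card Λ := by exact_mod_cast Fintype.card_pos

lemma pl_snoc (K : Λ → S × Λ → ℝ) (B : ℕ) (s : Fin B → S) (b : S) (l' : Λ) :
    pl K (B + 1) (Fin.snoc (α := fun _ => S) s b, l') = ∑ l, pl K B (s, l) * K l (b, l') := by
  simp only [pl, Fin.init_snoc, Fin.snoc_last]

lemma sum_path (B : ℕ) (F : (Fin (B + 1) → S) × Λ → ℝ) :
    ∑ x, F x = ∑ s : Fin B → S, ∑ b, ∑ l', F (Fin.snoc (α := fun _ => S) s b, l') := by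
  rw [Fintype.sum_prod_type, sum_snoc]

lemma isP_pl {K : Λ → S × Λ → ℝ} (hK : ∀ l, isP (K l)) (B : ℕ) : isP (pl K B) := by
  induction B with
  | zero =>
    refine ⟨fun x => by simp [pl], ?_⟩
    rw [Fintype.sum_prod_type]
    simp [pl, (cardpos (Λ := Λ)).ne']
  | succ B ih =>
    refine ⟨fun x => Finset.sum_nonneg fun l _ => mul_nonneg (ih.1 _) ((hK l).1 _), ?_⟩
    rw [sum_path]
    simp_rw [pl_snoc]
    rw [← ih.2, Fintype.sum_prod_type]
    refine Finset.sum_congr rfl fun s _ => ?_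
    calc ∑ b, ∑ l', ∑ l, pl K B (s, l) * K l (b, l')
        = ∑ x : S × Λ, ∑ l, pl K B (s, l) * K l x := by rw [Fintype.sum_prod_type]
      _ = ∑ l, pl K B (s, l) := by
        rw [Finset.sum_comm]; simp_rw [← Finset.mul_sum, (hK _).2, mul_one]

lemma sum3 {α β γ : Type*} [Fintype α] [Fintype β] [Fintype γ] (f : α → γ → ℝ) (g : γ → β → ℝ) :
    ∑ s, ∑ b, ∑ l, f s l * g l b = ∑ l, (∑ s, f s l) * ∑ b, g l b := by
  simp_rw [Finset.sum_mul_sum]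
  rw [Finset.sum_comm (s := (Finset.univ : Finset γ))]
  refine Finset.sum_congr rfl fun s _ => ?_
  rw [Finset.sum_comm]

lemma pl_marg {K : Λ → S × Λ → ℝ} (hu : uinv K) (B : ℕ) (l : Λ) :
    ∑ s, pl K B (s, l) = (Fintype.card Λ : ℝ)⁻¹ := by
  induction B generalizing l with
  | zero => simp [pl]
  | succ B ih =>
    rw [sum_snoc]
    simp_rw [pl_snoc]
    rw [sum3 (fun (s : Fin B → S) l' => pl K B (s, l')) (fun l' b => K l' (b, l))]
    simp_rw [ih]; rw [← Finset.mul_sum, hu l, mul_one]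

lemma mg_left {α : Type*} [Fintype α] {β : Type*} (f : α → β) (p : α × Λ → ℝ) (b : β) (l : Λ) :
    mg (fun x : α × Λ => (f x.1, x.2)) p (b, l) = ∑ a, if f a = b then p (a, l) else 0 := by
  unfold mg
  rw [Fintype.sum_prod_type]
  refine Finset.sum_congr rfl fun a _ => ?_
  simp only [Prod.mk.injEq]
  by_cases h : f a = b <;> simp [h]

lemma pl_map (f : S → S') (K : Λ → S × Λ → ℝ) (B : ℕ) :
    mg (fun x : (Fin B → S) × Λ => (fun i => f (x.1 i), x.2)) (pl K B) = pl (mapK f K) B := by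
  induction B with
  | zero =>
    funext ⟨s, l⟩
    rw [mg_left (fun (s : Fin 0 → S) i => f (s i))]
    simp [pl, Subsingleton.elim _ s]
  | succ B ih =>
    funext ⟨s, l⟩
    obtain ⟨s', b', rfl⟩ : ∃ s' b', s = Fin.snoc (α := fun _ => S') s' b' :=
      ⟨_, _, (Fin.snoc_init_self s).symm⟩
    rw [mg_left (fun (s : Fin (B + 1) → S) i => f (s i)), pl_snoc, sum_snoc]
    simp_rw [pl_snoc, ← ih, mg_left (fun (s : Fin B → S) i => f (s i)), mapK]
    refine Eq.trans ?_ ((sum3 (fun (c : Fin B → S) l => if (fun i => f (c i)) = s' then pl K B (c, l) else 0)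
      (fun l' a => if f a = b' then K l' (a, l) else 0)).trans (by congr!))
    have : ∀ (c : Fin B → S) (a : S), ((fun i => f (Fin.snoc (α := fun _ => S) c a i)) =
        Fin.snoc (α := fun _ => S') s' b') ↔ ((fun i => f (c i)) = s' ∧ f a = b') := by
      intro c a
      have e : (fun i => f (Fin.snoc (α := fun _ => S) c a i)) =
        Fin.snoc (α := fun _ => S') (fun i => f (c i)) (f a) := Fin.comp_snoc f c a
      rw [e, Fin.snoc_inj]
    refine Finset.sum_congr rfl fun c _ => Finset.sum_congr rfl fun a _ => ?_
    by_cases h1 : (fun i => f (c i)) = s' <;> by_cases h2 : f a = b' <;> simp [this, h1, h2]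

lemma isP_mapK (f : S → S') {K : Λ → S × Λ → ℝ} (hK : ∀ l, isP (K l)) (l : Λ) :
    isP (mapK f K l) := by
  have : mapK f K l = mg (fun x : S × Λ => (f x.1, x.2)) (K l) := by
    funext ⟨s, l'⟩; rw [mg_left]; rfl
  rw [this]; exact (hK l).mg _

lemma mapK_eq_mg (f : S → S') (K : Λ → S × Λ → ℝ) (l : Λ) :
    mapK f K l = mg (fun x : S × Λ => (f x.1, x.2)) (K l) := by
  funext ⟨s, l'⟩; rw [mg_left]; rfl

lemma uinv_mapK (f : S → S') {K : Λ → S × Λ → ℝ} (hK : uinv K) : uinv (mapK f K) := by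
  intro l'
  rw [← hK l']
  refine Finset.sum_congr rfl fun l _ => ?_
  unfold mapK
  rw [Finset.sum_comm]
  simp

lemma l1_mapK (f : S → S') (K K' : Λ → S × Λ → ℝ) (l : Λ) :
    ∑ x, |mapK f K l x - mapK f K' l x| ≤ ∑ x, |K l x - K' l x| := by
  rw [mapK_eq_mg, mapK_eq_mg]; exact l1_mg _ _ _

lemma sum_aug (F : Λ → S × Λ → ℝ) (l : Λ) (G : (S × Λ) × Λ → ℝ)
    (hG : ∀ s l0 l', G ((s, l0), l') = if l0 = l then F l (s, l') else 0) :
    ∑ x, G x = ∑ x, F l x := by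
  simp only [Fintype.sum_prod_type, hG]
  refine Finset.sum_congr rfl fun s _ => ?_
  rw [Finset.sum_comm]; simp

lemma isP_augK {K : Λ → S × Λ → ℝ} (hK : ∀ l, isP (K l)) (l : Λ) : isP (augK K l) := by
  constructor
  · intro x; unfold augK; split_ifs
    · exact (hK l).1 _
    · exact le_rfl
  · rw [sum_aug K l (augK K l) (fun _ _ _ => rfl), (hK l).2]

lemma uinv_augK {K : Λ → S × Λ → ℝ} (hK : uinv K) : uinv (augK K) := by
  intro l'
  rw [← hK l']
  refine Finset.sum_congr rfl fun l _ => ?_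
  rw [Fintype.sum_prod_type]
  simp [augK]

lemma l1_augK (K K' : Λ → S × Λ → ℝ) (l : Λ) :
    ∑ x, |augK K l x - augK K' l x| = ∑ x, |K l x - K' l x| := by
  refine sum_aug (fun l x => |K l x - K' l x|) l _ ?_
  intro s l0 l'
  unfold augK
  by_cases h : l0 = l <;> simp [h]

lemma map_augK (f : S → S') (K : Λ → S × Λ → ℝ) :
    mapK (fun x : S × Λ => (f x.1, x.2)) (augK K) = augK (mapK f K) := by
  funext l ⟨⟨s, l0⟩, l'⟩
  unfold mapK augK
  rw [Fintype.sum_prod_type]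
  by_cases h : l0 = l
  · subst h
    simp only [Prod.mk.injEq, if_true]
    refine Finset.sum_congr rfl fun a _ => ?_
    by_cases h : f a = s <;> simp [h]
  · simp only [Prod.mk.injEq, if_neg h]
    refine Finset.sum_eq_zero fun a _ => Finset.sum_eq_zero fun b _ => ?_
    by_cases hb : b = l
    · subst hb; simp [Ne.symm h]
    · simp [hb]

lemma fst_augK (K : Λ → S × Λ → ℝ) : mapK Prod.fst (augK K) = K := by
  funext l ⟨s, l'⟩
  unfold mapK augK
  rw [Fintype.sum_prod_type]
  rw [Finset.sum_eq_single s (by intro b _ hb; simp [hb]) (by simp)]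
  simp

lemma pl_l1 {K K' : Λ → S × Λ → ℝ} (hK : ∀ l, isP (K l)) (hK' : ∀ l, isP (K' l)) (hu : uinv K')
    (B : ℕ) : ∑ x, |pl K B x - pl K' B x| ≤
      B * ((Fintype.card Λ : ℝ)⁻¹ * ∑ l, ∑ x, |K l x - K' l x|) := by
  induction B with
  | zero => simp [pl]
  | succ B ih =>
    set d := (Fintype.card Λ : ℝ)⁻¹ * ∑ l, ∑ x, |K l x - K' l x| with hd
    have key : ∀ (s : Fin B → S) (y : S × Λ),
        |pl K (B+1) (Fin.snoc (α := fun _ => S) s y.1, y.2) -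
          pl K' (B+1) (Fin.snoc (α := fun _ => S) s y.1, y.2)| ≤
        ∑ l, |pl K B (s, l) - pl K' B (s, l)| * K l y + ∑ l, pl K' B (s, l) * |K l y - K' l y| := by
      intro s y
      rw [pl_snoc, pl_snoc, ← Finset.sum_sub_distrib, ← Finset.sum_add_distrib]
      refine (Finset.abs_sum_le_sum_abs _ _).trans (Finset.sum_le_sum fun l _ => ?_)
      have e : pl K B (s, l) * K l (y.1, y.2) - pl K' B (s, l) * K' l (y.1, y.2) =
        (pl K B (s, l) - pl K' B (s, l)) * K l y + pl K' B (s, l) * (K l y - K' l y) := by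
        simp only [Prod.mk.eta]; ring
      rw [e]
      refine (abs_add_le _ _).trans (le_of_eq ?_)
      rw [abs_mul, abs_mul, abs_of_nonneg ((hK l).1 y), abs_of_nonneg ((isP_pl hK' B).1 (s, l))]
    have e1 : ∑ x, |pl K (B+1) x - pl K' (B+1) x| = ∑ s : Fin B → S, ∑ y : S × Λ,
        |pl K (B+1) (Fin.snoc (α := fun _ => S) s y.1, y.2) -
          pl K' (B+1) (Fin.snoc (α := fun _ => S) s y.1, y.2)| := by
      rw [sum_path]
      simp_rw [Fintype.sum_prod_type]
    rw [e1]
    refine (Finset.sum_le_sum fun s _ => Finset.sum_le_sum fun y _ => key s y).trans ?_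
    simp_rw [Finset.sum_add_distrib]
    rw [sum3 (fun (s : Fin B → S) l => |pl K B (s, l) - pl K' B (s, l)|) (fun l y => K l y),
      sum3 (fun (s : Fin B → S) l => pl K' B (s, l)) (fun l y => |K l y - K' l y|)]
    simp_rw [(hK _).2, mul_one, pl_marg hu]
    rw [← Finset.mul_sum, ← hd, Finset.sum_comm,
      ← Fintype.sum_prod_type (fun x : (Fin B → S) × Λ => |pl K B x - pl K' B x|)]
    push_cast
    linarith

lemma pl_iid {K : Λ → S × Λ → ℝ} (hK : ∀ l, isP (K l)) {p : S → ℝ} (hp : isP p)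
    (B : ℕ) : ∑ x : (Fin B → S) × Λ, |pl K B x - (Fintype.card Λ : ℝ)⁻¹ * ∏ i, p (x.1 i)| ≤
      B * ∑ l', ∑ s, |(Fintype.card Λ : ℝ)⁻¹ * ∑ l, K l (s, l') - (Fintype.card Λ : ℝ)⁻¹ * p s| := by
  induction B with
  | zero => simp [pl]
  | succ B ih =>
    set d := ∑ l', ∑ s, |(Fintype.card Λ : ℝ)⁻¹ * ∑ l, K l (s, l') - (Fintype.card Λ : ℝ)⁻¹ * p s|
      with hd
    set L : ℝ := (Fintype.card Λ : ℝ)⁻¹ with hL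
    have key : ∀ (s : Fin B → S) (y : S × Λ),
        |pl K (B+1) (Fin.snoc (α := fun _ => S) s y.1, y.2) -
          L * ∏ i, p ((Fin.snoc (α := fun _ => S) s y.1 : Fin (B+1) → S) i)| ≤
        ∑ l, |pl K B (s, l) - L * ∏ i, p (s i)| * K l y +
          (∏ i, p (s i)) * |L * ∑ l, K l (y.1, y.2) - L * p y.1| := by
      intro s y
      rw [pl_snoc, Fin.prod_univ_castSucc]
      simp only [Fin.snoc_castSucc, Fin.snoc_last, Prod.mk.eta]
      have e : ∑ l, pl K B (s, l) * K l y - L * ((∏ i, p (s i)) * p y.1) =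
        ∑ l, (pl K B (s, l) - L * ∏ i, p (s i)) * K l y +
          (∏ i, p (s i)) * (L * ∑ l, K l y - L * p y.1) := by
        simp_rw [sub_mul]
        rw [Finset.sum_sub_distrib, ← Finset.mul_sum]; ring
      rw [e]
      refine (abs_add_le _ _).trans ?_
      rw [abs_mul, abs_of_nonneg (Finset.prod_nonneg fun i _ => hp.1 (s i))]
      gcongr
      refine (Finset.abs_sum_le_sum_abs _ _).trans (Finset.sum_le_sum fun l _ => ?_)
      rw [abs_mul, abs_of_nonneg ((hK l).1 y)]
    have e1 : ∑ x : (Fin (B+1) → S) × Λ, |pl K (B+1) x - L * ∏ i, p (x.1 i)| =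
        ∑ s : Fin B → S, ∑ y : S × Λ,
        |pl K (B+1) (Fin.snoc (α := fun _ => S) s y.1, y.2) -
          L * ∏ i, p ((Fin.snoc (α := fun _ => S) s y.1 : Fin (B+1) → S) i)| := by
      rw [sum_path]
      simp_rw [Fintype.sum_prod_type]
    rw [e1]
    refine (Finset.sum_le_sum fun s _ => Finset.sum_le_sum fun y _ => key s y).trans ?_
    simp_rw [Finset.sum_add_distrib]
    rw [sum3 (fun (s : Fin B → S) l => |pl K B (s, l) - L * ∏ i, p (s i)|) (fun l y => K l y),
      ← Finset.sum_mul_sum]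
    have h1 : ∑ s : Fin B → S, ∏ i, p (s i) = 1 := (isP_pi (fun _ : Fin B => hp)).2
    have h2 : ∑ y : S × Λ, |L * ∑ l, K l (y.1, y.2) - L * p y.1| = d := by
      rw [Fintype.sum_prod_type, Finset.sum_comm]
    rw [h1, h2, one_mul]
    simp_rw [(hK _).2, mul_one]
    rw [Finset.sum_comm, ← Fintype.sum_prod_type (fun x : (Fin B → S) × Λ => |pl K B x - L * ∏ i, p (x.1 i)|)]
    push_cast
    linarith

lemma Hn_pl_aug {K : Λ → S × Λ → ℝ} (hK : ∀ l, isP (K l)) (hu : uinv K) (B : ℕ) :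
    Hn (pl (augK K) B) = Real.log (Fintype.card Λ) +
      B * ((Fintype.card Λ : ℝ)⁻¹ * ∑ l, Hn (K l)) := by
  induction B with
  | zero =>
    rw [Hn_unif _ ((Fintype.card Λ : ℝ)⁻¹) (isP_pl (isP_augK hK) 0) (fun _ => rfl), Real.log_inv]
    simp
  | succ B ih =>
    let e : ((Fin B → S × Λ) × Λ) × (S × Λ) → (Fin (B+1) → S × Λ) × Λ :=
      fun x => (Fin.snoc (α := fun _ => S × Λ) x.1.1 (x.2.1, x.1.2), x.2.2)
    have he : Function.Bijective e := by
      constructor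
      · rintro ⟨⟨s, l0⟩, b, l'⟩ ⟨⟨s2, l02⟩, b2, l2'⟩ h
        simp only [e, Prod.mk.injEq, Fin.snoc_inj] at h
        simp_all
      · rintro ⟨s, l'⟩
        refine ⟨((Fin.init (α := fun _ => S × Λ) s, (s (Fin.last B)).2), ((s (Fin.last B)).1, l')), ?_⟩
        simp only [e, Prod.mk.eta]
        rw [Fin.snoc_init_self]
    have h1 : ∀ x, pl (augK K) (B+1) (e x) = pl (augK K) B x.1 * K x.1.2 x.2 := by
      rintro ⟨⟨s, l0⟩, b, l'⟩
      simp only [e]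
      rw [pl_snoc]
      simp [augK]
    rw [← Hn_equiv (Equiv.ofBijective e he)]
    simp only [Equiv.ofBijective_apply, h1]
    rw [Hn_chain (pl (augK K) B) (fun a => K a.2) (fun a _ => (hK a.2).2), ih]
    have h2 : ∑ a, pl (augK K) B a * Hn (K a.2) = (Fintype.card Λ : ℝ)⁻¹ * ∑ l, Hn (K l) := by
      rw [Fintype.sum_prod_type, Finset.sum_comm]
      simp_rw [← Finset.sum_mul, pl_marg (uinv_augK hu)]
      rw [Finset.mul_sum]
    rw [h2]; push_cast; ring

lemma Hn_nu (v : Λ → S → ℝ) (hv : ∀ l, isP (v l)) :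
    Hn (fun x : S × Λ => (Fintype.card Λ : ℝ)⁻¹ * v x.2 x.1) = Real.log (Fintype.card Λ) +
      (Fintype.card Λ : ℝ)⁻¹ * ∑ l, Hn (v l) := by
  have hc := cardpos (Λ := Λ)
  rw [← Hn_equiv (Equiv.prodComm Λ S)]
  have h := Hn_chain (fun _ : Λ => (Fintype.card Λ : ℝ)⁻¹) v (fun a _ => (hv a).2)
  simp only [Equiv.prodComm_apply, Prod.fst_swap, Prod.snd_swap]
  rw [h, ← Finset.mul_sum]
  congr 1
  rw [Hn_unif _ ((Fintype.card Λ : ℝ)⁻¹) ⟨fun _ => by positivity, ?_⟩ (fun _ => rfl), Real.log_inv,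
    neg_neg]
  simp [hc.ne']

end path
end WR

set_option linter.unusedSectionVars false
namespace WR

/-- data for random quantize-and-forward -/
structure RD (V Yr O H : Type*) [Fintype V] [Fintype Yr] [Fintype O] [Fintype H] where
  pV : V → ℝ
  k : V → Yr × O → ℝ
  g : V → H → ℝ
  r : V → H → Yr → ℝ
  hpV : isP pV
  hk : ∀ v, isP (k v)
  hg : ∀ v, isP (g v)
  hr : ∀ v h, isP (r v h)
  cons : ∀ v yr, ∑ h, g v h * r v h yr = ∑ o, k v (yr, o)
  ac : ∀ v h yr, ∑ o, k v (yr, o) = 0 → r v h yr = 0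

section rd
variable {V Yr O H : Type*} [Fintype V] [Fintype Yr] [Fintype O] [Fintype H]
variable {S S' : Type*} [Fintype S] [Fintype S']
variable {Λ : Type*} [Fintype Λ] [DecidableEq Λ] [Nonempty Λ]

def RD.a (D : RD V Yr O H) (v : V) (yr : Yr) : ℝ := ∑ o, D.k v (yr, o)

/-- output channel given codeword and quantization codeword -/
def RD.vk (D : RD V Yr O H) (v : V) (h : H) (o : O) : ℝ :=
  ∑ yr, D.k v (yr, o) / D.a v yr * D.r v h yr

lemma RD.a_nonneg (D : RD V Yr O H) (v : V) (yr : Yr) : 0 ≤ D.a v yr :=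
  Finset.sum_nonneg fun _ _ => (D.hk v).1 _

lemma RD.k_zero (D : RD V Yr O H) {v : V} {yr : Yr} (h : D.a v yr = 0) (o : O) : D.k v (yr, o) = 0 :=
  (Finset.sum_eq_zero_iff_of_nonneg (fun o _ => (D.hk v).1 (yr, o))).1 h o (Finset.mem_univ _)

lemma RD.isP_a (D : RD V Yr O H) (v : V) : isP (D.a v) := by
  refine ⟨D.a_nonneg v, ?_⟩
  unfold RD.a
  rw [← Fintype.sum_prod_type (fun x : Yr × O => D.k v x)]; exact (D.hk v).2

lemma RD.sum_ka (D : RD V Yr O H) (v : V) (yr : Yr) :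
    ∑ o, D.k v (yr, o) / D.a v yr = if D.a v yr = 0 then 0 else 1 := by
  rw [← Finset.sum_div]
  split_ifs with h
  · rw [h]; simp
  · exact div_self h

lemma RD.isP_vk (D : RD V Yr O H) (v : V) (h : H) : isP (D.vk v h) := by
  constructor
  · intro o
    exact Finset.sum_nonneg fun yr _ => mul_nonneg (div_nonneg ((D.hk v).1 _) (D.a_nonneg _ _)) ((D.hr v h).1 _)
  · unfold RD.vk
    rw [Finset.sum_comm]
    simp_rw [← Finset.sum_mul, D.sum_ka]
    refine Eq.trans (Finset.sum_congr rfl fun yr _ => ?_) (D.hr v h).2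
    split_ifs with h0
    · rw [zero_mul, D.ac v h yr h0]
    · rw [one_mul]

/-- normalization of the quantizer -/
def RD.dn (D : RD V Yr O H) (c : V × (Λ → H)) (yr : Yr) : ℝ := ∑ l', D.r c.1 (c.2 l') yr

/-- random quantizer -/
def RD.ee (D : RD V Yr O H) (c : V × (Λ → H)) (yr : Yr) (l' : Λ) : ℝ :=
  if D.dn c yr = 0 then (Fintype.card Λ : ℝ)⁻¹ else D.r c.1 (c.2 l') yr / D.dn c yr

lemma RD.dn_nonneg (D : RD V Yr O H) (c : V × (Λ → H)) (yr : Yr) : 0 ≤ D.dn c yr :=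
  Finset.sum_nonneg fun _ _ => (D.hr _ _).1 _

lemma RD.isP_ee (D : RD V Yr O H) (c : V × (Λ → H)) (yr : Yr) : isP (D.ee c yr) := by
  have hc := cardpos (Λ := Λ)
  unfold RD.ee
  split_ifs with h
  · refine ⟨fun _ => by positivity, by simp [hc.ne']⟩
  · refine ⟨fun l' => div_nonneg ((D.hr _ _).1 _) (D.dn_nonneg _ _), ?_⟩
    rw [← Finset.sum_div]; exact div_self h

lemma RD.r_eq (D : RD V Yr O H) (c : V × (Λ → H)) (yr : Yr) (l' : Λ) :
    D.r c.1 (c.2 l') yr = D.dn c yr * D.ee c yr l' := by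
  unfold RD.ee
  split_ifs with h
  · rw [h, zero_mul]
    exact (Finset.sum_eq_zero_iff_of_nonneg (fun l _ => (D.hr c.1 (c.2 l)).1 yr)).1 h l' (Finset.mem_univ _)
  · field_simp

def RD.pi (D : RD V Yr O H) (c : Λ → V × (Λ → H)) (l : Λ) (x : O × Λ) : ℝ :=
  ∑ yr, D.k (c l).1 (yr, x.1) * D.ee (c l) yr x.2

def RD.nu (D : RD V Yr O H) (c : Λ → V × (Λ → H)) (l : Λ) (x : O × Λ) : ℝ :=
  (Fintype.card Λ : ℝ)⁻¹ * D.vk (c l).1 ((c l).2 x.2) x.1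

lemma RD.isP_pi (D : RD V Yr O H) (c : Λ → V × (Λ → H)) (l : Λ) : isP (D.pi c l) := by
  refine ⟨fun x => Finset.sum_nonneg fun yr _ => mul_nonneg ((D.hk _).1 _) ((D.isP_ee _ _).1 _), ?_⟩
  unfold RD.pi
  rw [Fintype.sum_prod_type]
  rw [sum3 (fun o yr => D.k (c l).1 (yr, o)) (fun yr l' => D.ee (c l) yr l')]
  simp_rw [(D.isP_ee _ _).2, mul_one]
  exact (D.isP_a _).2

lemma RD.isP_nu (D : RD V Yr O H) (c : Λ → V × (Λ → H)) (l : Λ) : isP (D.nu c l) := by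
  have hc := cardpos (Λ := Λ)
  refine ⟨fun x => mul_nonneg (by positivity) ((D.isP_vk _ _).1 _), ?_⟩
  unfold RD.nu
  rw [← Finset.mul_sum, Fintype.sum_prod_type, Finset.sum_comm]
  simp [(D.isP_vk _ _).2, hc.ne']

lemma RD.uinv_nu (D : RD V Yr O H) (c : Λ → V × (Λ → H)) : uinv (D.nu c) := by
  have hc := cardpos (Λ := Λ)
  intro l'
  unfold RD.nu
  simp [← Finset.mul_sum, (D.isP_vk _ _).2, hc.ne']

lemma RD.l1_pi_nu (D : RD V Yr O H) (c : Λ → V × (Λ → H)) (l : Λ) :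
    ∑ x, |D.pi c l x - D.nu c l x| ≤
      ∑ yr, |(Fintype.card Λ : ℝ)⁻¹ * ∑ l', D.r (c l).1 ((c l).2 l') yr - D.a (c l).1 yr| := by
  set L := (Fintype.card Λ : ℝ)⁻¹ with hL
  have key : ∀ x : O × Λ, |D.pi c l x - D.nu c l x| ≤
      ∑ yr, (D.k (c l).1 (yr, x.1) / D.a (c l).1 yr) *
        (|L * D.dn (c l) yr - D.a (c l).1 yr| * D.ee (c l) yr x.2) := by
    intro x
    unfold RD.pi RD.nu RD.vk
    rw [← hL, Finset.mul_sum, ← Finset.sum_sub_distrib]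
    refine (Finset.abs_sum_le_sum_abs _ _).trans (Finset.sum_le_sum fun yr _ => ?_)
    have e : D.k (c l).1 (yr, x.1) * D.ee (c l) yr x.2 -
        L * (D.k (c l).1 (yr, x.1) / D.a (c l).1 yr * D.r (c l).1 ((c l).2 x.2) yr) =
        (D.k (c l).1 (yr, x.1) / D.a (c l).1 yr) *
        ((-(L * D.dn (c l) yr - D.a (c l).1 yr)) * D.ee (c l) yr x.2) := by
      rw [D.r_eq]
      by_cases h : D.a (c l).1 yr = 0
      · rw [D.k_zero h]; ring
      · field_simp; ring
    rw [e, abs_mul, abs_mul, abs_neg, abs_of_nonneg ((D.isP_ee (c l) yr).1 x.2),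
      abs_of_nonneg (div_nonneg ((D.hk _).1 _) (D.a_nonneg _ _))]
  refine (Finset.sum_le_sum fun x _ => key x).trans ?_
  rw [Fintype.sum_prod_type, sum3 (fun o yr => D.k (c l).1 (yr, o) / D.a (c l).1 yr)
    (fun yr l' => |L * D.dn (c l) yr - D.a (c l).1 yr| * D.ee (c l) yr l')]
  refine Finset.sum_le_sum fun yr _ => ?_
  rw [← Finset.mul_sum, (D.isP_ee (c l) yr).2, mul_one, D.sum_ka]
  have h0 : 0 ≤ |L * D.dn (c l) yr - D.a (c l).1 yr| := abs_nonneg _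
  change _ ≤ |L * D.dn (c l) yr - D.a (c l).1 yr|
  split_ifs
  · rw [zero_mul]; exact h0
  · rw [one_mul]

def RD.vS (D : RD V Yr O H) (f : O → S) (v : V) (h : H) : S → ℝ := mg f (D.vk v h)

def RD.pVH (D : RD V Yr O H) (x : V × H) : ℝ := D.pV x.1 * D.g x.1 x.2

def RD.pS (D : RD V Yr O H) (f : O → S) : S → ℝ := out D.pVH (fun x => D.vS f x.1 x.2)

lemma RD.isP_vS (D : RD V Yr O H) (f : O → S) (v : V) (h : H) : isP (D.vS f v h) := (D.isP_vk v h).mg f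

lemma RD.isP_pVH (D : RD V Yr O H) : isP D.pVH := isP_joint D.hpV D.hg

lemma RD.isP_pS (D : RD V Yr O H) (f : O → S) : isP (D.pS f) :=
  isP_out D.isP_pVH (fun x => D.isP_vS f x.1 x.2)

/-- the law of the observations -/
def RD.PS (D : RD V Yr O H) (c : Λ → V × (Λ → H)) (B : ℕ) (f : O → S) : (Fin B → S) → ℝ :=
  mg (fun x : (Fin B → O) × Λ => fun i => f (x.1 i)) (pl (D.pi c) B)

def RD.dd (D : RD V Yr O H) (c : Λ → V × (Λ → H)) : ℝ :=
  (Fintype.card Λ : ℝ)⁻¹ * ∑ l, ∑ x, |D.pi c l x - D.nu c l x|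

def RD.dlt (D : RD V Yr O H) (c : Λ → V × (Λ → H)) (f : O → S) : ℝ :=
  (Fintype.card Λ : ℝ)⁻¹ * ∑ l', ∑ s,
    |(Fintype.card Λ : ℝ)⁻¹ * ∑ l, D.vS f (c l).1 ((c l).2 l') s - D.pS f s|

def RD.avgH (D : RD V Yr O H) (c : Λ → V × (Λ → H)) (f : O → S) : ℝ :=
  (Fintype.card Λ : ℝ)⁻¹ * ∑ l, (Fintype.card Λ : ℝ)⁻¹ * ∑ l', Hn (D.vS f (c l).1 ((c l).2 l'))

lemma RD.mapK_nu (D : RD V Yr O H) (c : Λ → V × (Λ → H)) (f : O → S) (l : Λ) :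
    mapK f (D.nu c) l = fun x => (Fintype.card Λ : ℝ)⁻¹ * D.vS f (c l).1 ((c l).2 x.2) x.1 := by
  funext x
  unfold mapK RD.nu RD.vS mg
  rw [Finset.mul_sum]
  refine Finset.sum_congr rfl fun s _ => ?_
  split_ifs <;> simp

lemma RD.PS_eq (D : RD V Yr O H) (c : Λ → V × (Λ → H)) (B : ℕ) (f : O → S) :
    D.PS c B f = mg Prod.fst (pl (mapK f (D.pi c)) B) := by
  rw [← pl_map, mg_mg]; rfl

lemma RD.isP_PS (D : RD V Yr O H) (c : Λ → V × (Λ → H)) (B : ℕ) (f : O → S) : isP (D.PS c B f) :=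
  (isP_pl (D.isP_pi c) B).mg _

lemma RD.dd_nonneg (D : RD V Yr O H) (c : Λ → V × (Λ → H)) : 0 ≤ D.dd c := by
  unfold RD.dd; positivity

lemma RD.dlt_nonneg (D : RD V Yr O H) (c : Λ → V × (Λ → H)) (f : O → S) : 0 ≤ D.dlt c f := by
  unfold RD.dlt; positivity

lemma RD.l1_pl (D : RD V Yr O H) (c : Λ → V × (Λ → H)) (B : ℕ) (f : O → S) :
    ∑ x, |pl (mapK f (D.pi c)) B x - pl (mapK f (D.nu c)) B x| ≤ B * D.dd c := by
  refine (pl_l1 (isP_mapK f (D.isP_pi c)) (isP_mapK f (D.isP_nu c)) (uinv_mapK f (D.uinv_nu c)) B).trans ?_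
  unfold RD.dd
  gcongr with l
  exact l1_mapK f _ _ l

lemma RD.l1_pl_aug (D : RD V Yr O H) (c : Λ → V × (Λ → H)) (B : ℕ) (f : O → S) :
    ∑ x, |pl (augK (mapK f (D.pi c))) B x - pl (augK (mapK f (D.nu c))) B x| ≤ B * D.dd c := by
  refine (pl_l1 (isP_augK (isP_mapK f (D.isP_pi c))) (isP_augK (isP_mapK f (D.isP_nu c)))
    (uinv_augK (uinv_mapK f (D.uinv_nu c))) B).trans ?_
  unfold RD.dd
  gcongr with l
  rw [l1_augK]
  exact l1_mapK f _ _ l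

lemma log_card_pi (B : ℕ) : Real.log (Fintype.card (Fin B → S)) = B * Real.log (Fintype.card S) := by
  rw [Fintype.card_fun, Fintype.card_fin]; push_cast; rw [Real.log_pow]

lemma log_card_nonneg : 0 ≤ Real.log (Fintype.card S) := Real.log_natCast_nonneg _

/-- the observations are close to iid -/
lemma RD.PS_iid (D : RD V Yr O H) (c : Λ → V × (Λ → H)) (B : ℕ) (f : O → S) :
    |Hn (D.PS c B f) - B * Hn (D.pS f)| ≤
      (B * (D.dd c + D.dlt c f)) * (B * Real.log (Fintype.card S)) + 1 := by
  have hc := cardpos (Λ := Λ)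
  have hp := D.isP_pS f
  have hpp : isP (fun s : Fin B → S => ∏ i, D.pS f (s i)) := WR.isP_pi (fun _ => hp)
  have h1 : Hn (fun s : Fin B → S => ∏ i, D.pS f (s i)) = B * Hn (D.pS f) := by
    have := Hn_iid (ι := Fin B) hp
    simpa using this
  rw [← h1]
  refine (Hn_cont (D.isP_PS c B f) hpp).trans ?_
  rw [log_card_pi]
  have h0 := log_card_nonneg (S := S)
  have e : (fun s : Fin B → S => ∏ i, D.pS f (s i)) =
      mg Prod.fst (fun x : (Fin B → S) × Λ => (Fintype.card Λ : ℝ)⁻¹ * ∏ i, D.pS f (x.1 i)) := by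
    funext s; rw [mg_fst]; simp [hc.ne']
  have hb : ∑ s, |D.PS c B f s - ∏ i, D.pS f (s i)| ≤ B * (D.dd c + D.dlt c f) := by
    have e' : ∀ s, ∏ i, D.pS f (s i) = mg Prod.fst
      (fun x : (Fin B → S) × Λ => (Fintype.card Λ : ℝ)⁻¹ * ∏ i, D.pS f (x.1 i)) s := fun s => congrFun e s
    rw [Finset.sum_congr rfl (fun s _ => by rw [e' s, D.PS_eq c B f])]
    refine (l1_mg _ _ _).trans ?_
    have t : ∀ x : (Fin B → S) × Λ, |pl (mapK f (D.pi c)) B x - (Fintype.card Λ : ℝ)⁻¹ * ∏ i, D.pS f (x.1 i)| ≤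
      |pl (mapK f (D.pi c)) B x - pl (mapK f (D.nu c)) B x| +
      |pl (mapK f (D.nu c)) B x - (Fintype.card Λ : ℝ)⁻¹ * ∏ i, D.pS f (x.1 i)| :=
      fun x => abs_sub_le _ _ _
    refine (Finset.sum_le_sum fun x _ => t x).trans ?_
    rw [Finset.sum_add_distrib, mul_add]
    refine add_le_add (D.l1_pl c B f) ((pl_iid (isP_mapK f (D.isP_nu c)) hp B).trans ?_)
    refine le_of_eq ?_
    unfold RD.dlt
    refine congrArg (fun t : ℝ => (B : ℝ) * t) ?_
    refine Eq.trans ?_ (Finset.mul_sum _ _ _).symm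
    refine Finset.sum_congr rfl fun l' _ => ?_
    refine Eq.trans ?_ (Finset.mul_sum _ _ _).symm
    refine Finset.sum_congr rfl fun s _ => ?_
    simp_rw [D.mapK_nu]
    rw [← mul_sub, abs_mul, abs_of_pos (inv_pos.2 hc), Finset.mul_sum]
  gcongr

lemma RD.Hn_mapnu (D : RD V Yr O H) (c : Λ → V × (Λ → H)) (B : ℕ) (f : O → S) :
    Hn (pl (augK (mapK f (D.nu c))) B) = Real.log (Fintype.card Λ) +
      B * (Real.log (Fintype.card Λ) + D.avgH c f) := by
  have hc := cardpos (Λ := Λ)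
  rw [Hn_pl_aug (isP_mapK f (D.isP_nu c)) (uinv_mapK f (D.uinv_nu c))]
  congr 2
  simp_rw [D.mapK_nu]
  have : ∀ l, Hn (fun x : S × Λ => (Fintype.card Λ : ℝ)⁻¹ * D.vS f (c l).1 ((c l).2 x.2) x.1) = _ :=
    fun l => Hn_nu (fun l' => D.vS f (c l).1 ((c l).2 l')) (fun l' => D.isP_vS f _ _)
  simp_rw [this]
  rw [Finset.sum_add_distrib, mul_add]
  unfold RD.avgH
  congr 1
  simp [hc.ne']

lemma RD.PS_ub (D : RD V Yr O H) (c : Λ → V × (Λ → H)) (B : ℕ) (f : O → S) :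
    Hn (D.PS c B f) ≤ Real.log (Fintype.card Λ) + B * (Real.log (Fintype.card Λ) + D.avgH c f) +
      ((B * D.dd c) * (B * Real.log (Fintype.card S)) + 1) := by
  have hn := isP_pl (isP_mapK f (D.isP_nu c)) B
  have h1 := (abs_le.1 (Hn_cont (D.isP_PS c B f) (hn.mg Prod.fst))).2
  rw [log_card_pi] at h1
  have h2 : ∑ s, |D.PS c B f s - mg Prod.fst (pl (mapK f (D.nu c)) B) s| ≤ B * D.dd c := by
    rw [D.PS_eq]; exact (l1_mg _ _ _).trans (D.l1_pl c B f)
  have h3 : Hn (mg Prod.fst (pl (mapK f (D.nu c)) B)) ≤ Hn (pl (augK (mapK f (D.nu c))) B) := by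
    refine (Hn_mg_le hn.1 _).trans ?_
    have : pl (mapK f (D.nu c)) B = mg (fun x : (Fin B → S × Λ) × Λ => (fun i => (x.1 i).1, x.2))
        (pl (augK (mapK f (D.nu c))) B) := by
      rw [pl_map Prod.fst, fst_augK]
    rw [this]
    exact Hn_mg_le (isP_pl (isP_augK (isP_mapK f (D.isP_nu c))) B).1 _
  rw [D.Hn_mapnu] at h3
  have h0 := log_card_nonneg (S := S)
  have h4 : (∑ s, |D.PS c B f s - mg Prod.fst (pl (mapK f (D.nu c)) B) s|) * (B * Real.log (Fintype.card S)) ≤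
    (B * D.dd c) * (B * Real.log (Fintype.card S)) := by gcongr
  linarith

lemma RD.aug_cont (D : RD V Yr O H) (c : Λ → V × (Λ → H)) (B : ℕ) (f : O → S) :
    |Hn (pl (augK (mapK f (D.pi c))) B) - Hn (pl (augK (mapK f (D.nu c))) B)| ≤
      (B * D.dd c) * (B * (Real.log (Fintype.card S) + Real.log (Fintype.card Λ)) +
        Real.log (Fintype.card Λ)) + 1 := by
  have hp := isP_pl (isP_augK (isP_mapK f (D.isP_pi c))) B
  refine (Hn_cont hp (isP_pl (isP_augK (isP_mapK f (D.isP_nu c))) B)).trans ?_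
  have hc := cardpos (Λ := Λ)
  have h0 := log_card_nonneg (S := S)
  have h0' := log_card_nonneg (S := Λ)
  have hl : Real.log (Fintype.card ((Fin B → S × Λ) × Λ)) ≤
      (B * (Real.log (Fintype.card S) + Real.log (Fintype.card Λ)) + Real.log (Fintype.card Λ)) := by
    obtain ⟨x0⟩ := hp.nonempty
    rw [Fintype.card_prod, Nat.cast_mul]
    have hne : (Fintype.card (Fin B → S × Λ) : ℝ) ≠ 0 := by
      exact_mod_cast (Fintype.card_pos_iff.2 ⟨x0.1⟩).ne'
    rw [Real.log_mul hne hc.ne', log_card_pi, Fintype.card_prod, Nat.cast_mul]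
    by_cases hS : (Fintype.card S : ℝ) = 0
    · rw [hS]; simp; positivity
    · rw [Real.log_mul hS hc.ne']
  have := D.l1_pl_aug c B f
  have h1 : 0 ≤ Real.log (Fintype.card ((Fin B → S × Λ) × Λ)) := log_card_nonneg
  gcongr
  exact mul_nonneg (by positivity) (D.dd_nonneg c)

lemma RD.PS_diff (D : RD V Yr O H) (c : Λ → V × (Λ → H)) (B : ℕ) (f : O → S) (φ : S → S') :
    Hn (pl (augK (mapK f (D.pi c))) B) - Hn (pl (augK (mapK (fun o => φ (f o)) (D.pi c))) B) ≤
      Hn (D.PS c B f) - Hn (D.PS c B (fun o => φ (f o))) := by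
  -- rearranged joint law
  let e : (Fin B → S × Λ) × Λ → (Fin B → S) × ((Fin B → Λ) × Λ) :=
    fun x => (fun i => (x.1 i).1, (fun i => (x.1 i).2, x.2))
  let e' : (Fin B → S' × Λ) × Λ → (Fin B → S') × ((Fin B → Λ) × Λ) :=
    fun x => (fun i => (x.1 i).1, (fun i => (x.1 i).2, x.2))
  have he : Function.Injective e := by
    rintro ⟨x, l⟩ ⟨y, m⟩ h
    simp only [e, Prod.mk.injEq, funext_iff] at h
    refine Prod.ext (funext fun i => Prod.ext (h.1 i) (h.2.1 i)) h.2.2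
  have he' : Function.Injective e' := by
    rintro ⟨x, l⟩ ⟨y, m⟩ h
    simp only [e', Prod.mk.injEq, funext_iff] at h
    refine Prod.ext (funext fun i => Prod.ext (h.1 i) (h.2.1 i)) h.2.2
  have hp := isP_pl (isP_augK (isP_mapK f (D.isP_pi c))) B
  have h := Hn_submod (mg e (pl (augK (mapK f (D.pi c))) B)) (hp.mg e) (fun (s : Fin B → S) i => φ (s i))
  have hpf : pl (mapK f (D.pi c)) B = mg (fun x : (Fin B → S × Λ) × Λ => (fun i => (x.1 i).1, x.2))
        (pl (augK (mapK f (D.pi c))) B) := by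
    rw [pl_map Prod.fst, fst_augK]
  have hPf : D.PS c B f = mg (fun x : (Fin B → S × Λ) × Λ => (fun i => (x.1 i).1))
        (pl (augK (mapK f (D.pi c))) B) := by
    rw [D.PS_eq, hpf, mg_mg]
  have hPφ : D.PS c B (fun o => φ (f o)) = mg (fun (s : Fin B → S) i => φ (s i)) (D.PS c B f) := by
    unfold RD.PS; rw [mg_mg]
  have hm : mapK (fun o => φ (f o)) (D.pi c) = mapK φ (mapK f (D.pi c)) := by
    funext l
    rw [mapK_eq_mg, mapK_eq_mg, mapK_eq_mg, mg_mg]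
  have h2 : mg e' (pl (augK (mapK (fun o => φ (f o)) (D.pi c))) B) =
      mg (fun x : (Fin B → S) × ((Fin B → Λ) × Λ) => ((fun i => φ (x.1 i)), x.2))
        (mg e (pl (augK (mapK f (D.pi c))) B)) := by
    rw [hm, ← map_augK, ← pl_map, mg_mg, mg_mg]
  rw [Hn_mg_inj e he, mg_mg, mg_mg, ← h2, Hn_mg_inj e' he'] at h
  have h3 : mg (fun a => Prod.fst (e a)) (pl (augK (mapK f (D.pi c))) B) = D.PS c B f := hPf.symm
  have h4 : mg (fun a => (fun (s : Fin B → S) i => φ (s i)) (e a).1) (pl (augK (mapK f (D.pi c))) B) =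
      D.PS c B (fun o => φ (f o)) := by
    rw [hPφ, hPf, mg_mg]
  rw [h3, h4] at h
  linarith

lemma mg_lin {ι : Type*} [Fintype ι] (φ : S → S') (w : ι → ℝ) (F : ι → S → ℝ) (s' : S') :
    ∑ i, w i * mg φ (F i) s' = mg φ (fun s => ∑ i, w i * F i s) s' := by
  unfold mg
  simp_rw [Finset.mul_sum]
  rw [Finset.sum_comm]
  refine Finset.sum_congr rfl fun a _ => ?_
  split_ifs <;> simp

lemma RD.dlt_map (D : RD V Yr O H) (c : Λ → V × (Λ → H)) (f : O → S) (φ : S → S') :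
    D.dlt c (fun o => φ (f o)) ≤ D.dlt c f := by
  unfold RD.dlt
  gcongr with l'
  have h1 : ∀ v h, D.vS (fun o => φ (f o)) v h = mg φ (D.vS f v h) := by
    intro v h; unfold RD.vS; rw [mg_mg]
  have h2 : D.pS (fun o => φ (f o)) = mg φ (D.pS f) := by
    funext s'
    unfold RD.pS out
    simp_rw [h1]
    exact mg_lin _ _ _ _
  have h3 : ∀ s', (Fintype.card Λ : ℝ)⁻¹ * ∑ l, D.vS (fun o => φ (f o)) (c l).1 ((c l).2 l') s' =
     mg φ (fun s => (Fintype.card Λ : ℝ)⁻¹ * ∑ l, D.vS f (c l).1 ((c l).2 l') s) s' := by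
    intro s'
    simp_rw [h1, Finset.mul_sum]
    exact mg_lin _ _ _ _
  simp_rw [h3, h2]
  exact l1_mg _ _ _

end rd
end WR

set_option linter.unusedSectionVars false
namespace WR

section rd2
variable {V Yr O H : Type*} [Fintype V] [Fintype Yr] [Fintype O] [Fintype H]
variable {S S' : Type*} [Fintype S] [Fintype S']
variable {Λ : Type*} [Fintype Λ] [DecidableEq Λ] [Nonempty Λ]

def RD.pC (D : RD V Yr O H) (Λ : Type*) [Fintype Λ] (x : V × (Λ → H)) : ℝ := D.pV x.1 * ∏ l', D.g x.1 (x.2 l')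

lemma RD.isP_pC (D : RD V Yr O H) : isP (D.pC Λ) :=
  isP_joint (W := fun v (h : Λ → H) => ∏ l', D.g v (h l')) D.hpV (fun v => WR.isP_pi (fun _ => D.hg v))

def RD.mu (D : RD V Yr O H) (c : Λ → V × (Λ → H)) : ℝ := ∏ l, D.pC Λ (c l)

lemma RD.isP_mu (D : RD V Yr O H) : isP (D.mu (Λ := Λ)) := WR.isP_pi (fun _ => D.isP_pC)

lemma RD.exp_pC (D : RD V Yr O H) (l' : Λ) (φ : V × H → ℝ) :
    ∑ x, D.pC Λ x * φ (x.1, x.2 l') = ∑ x, D.pVH x * φ x := by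
  unfold RD.pC RD.pVH
  rw [Fintype.sum_prod_type, Fintype.sum_prod_type]
  refine Finset.sum_congr rfl fun v _ => ?_
  have := exp_pi_one (p := fun _ : Λ => D.g v) (fun _ => D.hg v) l' (fun h => φ (v, h))
  simp_rw [mul_assoc, ← Finset.mul_sum]
  rw [this]

lemma RD.exp_mu (D : RD V Yr O H) (l l' : Λ) (φ : V × H → ℝ) :
    ∑ c, D.mu c * φ ((c l).1, (c l).2 l') = ∑ x, D.pVH x * φ x := by
  unfold RD.mu
  have := exp_pi_one (p := fun _ : Λ => D.pC Λ) (fun _ => D.isP_pC) l (fun a => φ (a.1, a.2 l'))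
  rw [this, D.exp_pC]

def RD.hS (D : RD V Yr O H) (f : O → S) : ℝ := ∑ x, D.pVH x * Hn (D.vS f x.1 x.2)

lemma exp_avg {α : Type*} [Fintype α] (μ : α → ℝ) (X : Λ → α → ℝ) :
    ∑ c, μ c * ((Fintype.card Λ : ℝ)⁻¹ * ∑ l, X l c) =
      (Fintype.card Λ : ℝ)⁻¹ * ∑ l, ∑ c, μ c * X l c := by
  simp_rw [Finset.mul_sum]
  rw [Finset.sum_comm]
  refine Finset.sum_congr rfl fun c _ => Finset.sum_congr rfl fun l _ => by ring

lemma avg_le {X : Λ → ℝ} {t : ℝ} (h : ∀ l, X l ≤ t) : (Fintype.card Λ : ℝ)⁻¹ * ∑ l, X l ≤ t := by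
  have hc := cardpos (Λ := Λ)
  calc (Fintype.card Λ : ℝ)⁻¹ * ∑ l, X l ≤ (Fintype.card Λ : ℝ)⁻¹ * ∑ _l : Λ, t := by
        gcongr with l; exact h l
    _ = t := by simp [hc.ne']

lemma RD.exp_avgH (D : RD V Yr O H) (f : O → S) : ∑ c : Λ → V × (Λ → H), D.mu c * D.avgH c f = D.hS f := by
  have hc := cardpos (Λ := Λ)
  unfold RD.avgH
  rw [exp_avg]
  simp_rw [exp_avg]
  have : ∀ l l' : Λ, ∑ c, D.mu c * Hn (D.vS f (c l).1 ((c l).2 l')) = D.hS f :=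
    fun l l' => D.exp_mu l l' (fun x => Hn (D.vS f x.1 x.2))
  simp_rw [this]
  simp [hc.ne']

def RD.bad1 (D : RD V Yr O H) (G : ℝ) : ℝ :=
  ∑ x, D.pVH x * ∑ yr, if G * D.a x.1 yr < D.r x.1 x.2 yr then D.r x.1 x.2 yr else 0

def RD.bad2 (D : RD V Yr O H) (f : O → S) (G : ℝ) : ℝ :=
  ∑ x, D.pVH x * ∑ s, if G * D.pS f s < D.vS f x.1 x.2 s then D.vS f x.1 x.2 s else 0

lemma RD.exp_dd (D : RD V Yr O H) {G : ℝ} (hG : 0 < G) :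
    ∑ c : Λ → V × (Λ → H), D.mu c * D.dd c ≤ 2 * D.bad1 G + Real.sqrt (G / Fintype.card Λ) := by
  unfold RD.dd
  rw [exp_avg]
  refine avg_le fun l => ?_
  refine (Finset.sum_le_sum fun c _ => mul_le_mul_of_nonneg_left (D.l1_pi_nu c l) (D.isP_mu.1 c)).trans ?_
  unfold RD.mu
  have := exp_pi_one (p := fun _ : Λ => D.pC Λ) (fun _ => D.isP_pC) l
    (fun a => ∑ yr, |(Fintype.card Λ : ℝ)⁻¹ * ∑ l', D.r a.1 (a.2 l') yr - D.a a.1 yr|)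
  rw [this]
  unfold RD.pC
  rw [Fintype.sum_prod_type]
  simp_rw [mul_assoc, ← Finset.mul_sum]
  have h2 : ∀ v, ∑ h : Λ → H, (∏ l', D.g v (h l')) *
      ∑ yr, |(Fintype.card Λ : ℝ)⁻¹ * ∑ l', D.r v (h l') yr - D.a v yr| ≤ _ :=
    fun v => softcover (ι := Λ) (D.hg v) (D.r v) (D.hr v) (D.a v) (fun yr => (D.cons v yr).symm) hG
  refine (Finset.sum_le_sum fun v _ => mul_le_mul_of_nonneg_left (h2 v) (D.hpV.1 v)).trans ?_
  simp_rw [mul_add]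
  rw [Finset.sum_add_distrib, ← Finset.sum_mul, D.hpV.2, one_mul]
  refine le_of_eq ?_
  congr 1
  unfold RD.bad1 RD.pVH
  rw [Fintype.sum_prod_type, Finset.mul_sum]
  refine Finset.sum_congr rfl fun v _ => ?_
  simp only [mul_assoc]
  rw [← Finset.mul_sum]
  ring

lemma RD.exp_dlt (D : RD V Yr O H) (f : O → S) {G : ℝ} (hG : 0 < G) :
    ∑ c : Λ → V × (Λ → H), D.mu c * D.dlt c f ≤ 2 * D.bad2 f G + Real.sqrt (G / Fintype.card Λ) := by
  unfold RD.dlt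
  rw [exp_avg]
  refine avg_le fun l' => ?_
  refine (softcover (ι := Λ) (D.isP_pC (Λ := Λ)) (fun a => D.vS f a.1 (a.2 l')) (fun a => D.isP_vS f _ _)
    (D.pS f) ?_ hG).trans (le_of_eq ?_)
  · intro s
    exact (D.exp_pC l' (fun x => D.vS f x.1 x.2 s)).symm
  · congr 2
    exact D.exp_pC l' (fun x => ∑ s, if G * D.pS f s < D.vS f x.1 x.2 s then D.vS f x.1 x.2 s else 0)

variable {SY SUY SUZ SZ : Type*} [Fintype SY] [Fintype SUY] [Fintype SUZ] [Fintype SZ]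

def RD.Sec (D : RD V Yr O H) (c : Λ → V × (Λ → H)) (B : ℕ) (fY : O → SY) (fUY : O → SUY) (fUZ : O → SUZ)
    (φ : SUZ → SZ) : ℝ :=
  Hn (D.PS c B fY) + Hn (D.PS c B fUZ) - Hn (D.PS c B fUY) - Hn (D.PS c B (fun o => φ (fUZ o)))

lemma RD.case1_c (D : RD V Yr O H) (c : Λ → V × (Λ → H)) {B : ℕ} (hB : 1 ≤ B) (fY : O → SY) (fUY : O → SUY)
    (fUZ : O → SUZ) (φ : SUZ → SZ) {M : ℝ} (h1 : Real.log (Fintype.card SY) ≤ M)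
    (h2 : Real.log (Fintype.card SUY) ≤ M) (h3 : Real.log (Fintype.card SUZ) ≤ M)
    (h4 : Real.log (Fintype.card SZ) ≤ M) (h5 : Real.log (Fintype.card Λ) ≤ M) :
    B * (Hn (D.pS fY) - D.avgH c fUY + D.avgH c fUZ - D.avgH c (fun o => φ (fUZ o)) -
      Real.log (Fintype.card Λ)) - Real.log (Fintype.card Λ) - 4 -
      8 * B ^ 2 * M * (D.dd c + D.dlt c fY) ≤ D.Sec c B fY fUY fUZ φ := by
  have hM : 0 ≤ M := log_card_nonneg.trans h1
  have hB' : (1:ℝ) ≤ B := by exact_mod_cast hB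
  have hd := D.dd_nonneg c
  have hl := D.dlt_nonneg c fY
  have a1 := (abs_le.1 (D.PS_iid c B fY)).1
  have a2 := D.PS_ub c B fUY
  have a3 := D.PS_diff c B fUZ φ
  have a4 := (abs_le.1 (D.aug_cont c B fUZ)).1
  have a5 := (abs_le.1 (D.aug_cont c B (fun o => φ (fUZ o)))).2
  rw [D.Hn_mapnu] at a4 a5
  have b1 : (B * (D.dd c + D.dlt c fY)) * (B * Real.log (Fintype.card SY)) ≤
    B ^ 2 * M * (D.dd c + D.dlt c fY) := by
    calc _ ≤ (B * (D.dd c + D.dlt c fY)) * (B * M) := by gcongr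
      _ = _ := by ring
  have b2 : (B * D.dd c) * (B * Real.log (Fintype.card SUY)) ≤ B ^ 2 * M * D.dd c := by
    calc _ ≤ (B * D.dd c) * (B * M) := by gcongr
      _ = _ := by ring
  have b3 : ∀ s : ℝ, s ≤ M → (B * D.dd c) * (B * (s + Real.log (Fintype.card Λ)) +
      Real.log (Fintype.card Λ)) ≤ 3 * B ^ 2 * M * D.dd c := by
    intro s hs
    calc _ ≤ (B * D.dd c) * (B * (M + M) + B * M) := by
          gcongr
          nlinarith
      _ = _ := by ring
  have b4 := b3 _ h3
  have b5 := b3 _ h4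
  have b6 : 0 ≤ B ^ 2 * M * D.dlt c fY := by positivity
  unfold RD.Sec
  nlinarith

lemma RD.case2_c (D : RD V Yr O H) (c : Λ → V × (Λ → H)) {B : ℕ} (hB : 1 ≤ B) (fY : O → SY) (fUY : O → SUY)
    (fUZ : O → SUZ) (φ : SUZ → SZ) {M : ℝ} (h1 : Real.log (Fintype.card SY) ≤ M)
    (h2 : Real.log (Fintype.card SUY) ≤ M) (h3 : Real.log (Fintype.card SUZ) ≤ M)
    (h4 : Real.log (Fintype.card SZ) ≤ M) :
    B * (Hn (D.pS fY) - D.avgH c fUY + Hn (D.pS fUZ) - Hn (D.pS (fun o => φ (fUZ o))) -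
      Real.log (Fintype.card Λ)) - Real.log (Fintype.card Λ) - 4 -
      8 * B ^ 2 * M * (D.dd c + D.dlt c fY + D.dlt c fUZ) ≤ D.Sec c B fY fUY fUZ φ := by
  have hM : 0 ≤ M := log_card_nonneg.trans h1
  have hB' : (1:ℝ) ≤ B := by exact_mod_cast hB
  have hd := D.dd_nonneg c
  have hl := D.dlt_nonneg c fY
  have hl2 := D.dlt_nonneg c fUZ
  have hl3 := D.dlt_nonneg c (fun o => φ (fUZ o))
  have a1 := (abs_le.1 (D.PS_iid c B fY)).1
  have a2 := D.PS_ub c B fUY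
  have a4 := (abs_le.1 (D.PS_iid c B fUZ)).1
  have a5 := (abs_le.1 (D.PS_iid c B (fun o => φ (fUZ o)))).2
  have b2 : (B * D.dd c) * (B * Real.log (Fintype.card SUY)) ≤ B ^ 2 * M * D.dd c := by
    calc _ ≤ (B * D.dd c) * (B * M) := by gcongr
      _ = _ := by ring
  have b3 : ∀ s t : ℝ, 0 ≤ t → s ≤ M → (B * (D.dd c + t)) * (B * s) ≤ B ^ 2 * M * (D.dd c + t) := by
    intro s t ht hs
    calc _ ≤ (B * (D.dd c + t)) * (B * M) := by gcongr
      _ = _ := by ring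
  have b1 := b3 _ _ hl h1
  have b4 := b3 _ _ hl2 h3
  have b5 := b3 _ _ hl3 h4
  have b6 : B ^ 2 * M * D.dlt c (fun o => φ (fUZ o)) ≤ B ^ 2 * M * D.dlt c fUZ := by
    gcongr; exact D.dlt_map c fUZ φ
  have b7 : 0 ≤ B ^ 2 * M * D.dlt c fY := by positivity
  have b8 : 0 ≤ B ^ 2 * M * D.dlt c fUZ := by positivity
  have b9 : 0 ≤ B ^ 2 * M * D.dd c := by positivity
  unfold RD.Sec
  nlinarith

theorem RD.case1 (D : RD V Yr O H) {B : ℕ} (hB : 1 ≤ B) (fY : O → SY) (fUY : O → SUY)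
    (fUZ : O → SUZ) (φ : SUZ → SZ) {M : ℝ} (h1 : Real.log (Fintype.card SY) ≤ M)
    (h2 : Real.log (Fintype.card SUY) ≤ M) (h3 : Real.log (Fintype.card SUZ) ≤ M)
    (h4 : Real.log (Fintype.card SZ) ≤ M) (h5 : Real.log (Fintype.card Λ) ≤ M)
    {G1 G2 : ℝ} (hG1 : 0 < G1) (hG2 : 0 < G2) : ∃ c : Λ → V × (Λ → H),
    B * (Hn (D.pS fY) - D.hS fUY + D.hS fUZ - D.hS (fun o => φ (fUZ o)) -
      Real.log (Fintype.card Λ)) - Real.log (Fintype.card Λ) - 4 -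
      8 * B ^ 2 * M * (2 * D.bad1 G1 + Real.sqrt (G1 / Fintype.card Λ) +
        (2 * D.bad2 fY G2 + Real.sqrt (G2 / Fintype.card Λ))) ≤ D.Sec c B fY fUY fUZ φ := by
  have hM : 0 ≤ M := log_card_nonneg.trans h1
  set k : ℝ := B * (Hn (D.pS fY) - Real.log (Fintype.card Λ)) - Real.log (Fintype.card Λ) - 4 with hk
  set κ : ℝ := 8 * B ^ 2 * M with hκ
  have hκ0 : 0 ≤ κ := by positivity
  obtain ⟨c, hc⟩ := exists_le_of_exp (D.isP_mu (Λ := Λ))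
    (f := fun c => B * D.avgH c fUY - B * D.avgH c fUZ + B * D.avgH c (fun o => φ (fUZ o)) +
      κ * D.dd c + κ * D.dlt c fY)
    (t := B * D.hS fUY - B * D.hS fUZ + B * D.hS (fun o => φ (fUZ o)) +
      κ * (2 * D.bad1 G1 + Real.sqrt (G1 / Fintype.card Λ)) +
        κ * (2 * D.bad2 fY G2 + Real.sqrt (G2 / Fintype.card Λ))) (by
      simp_rw [mul_add, mul_sub, mul_left_comm]
      simp only [Finset.sum_add_distrib, Finset.sum_sub_distrib, ← Finset.mul_sum]
      rw [D.exp_avgH, D.exp_avgH, D.exp_avgH]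
      have e1 := mul_le_mul_of_nonneg_left (D.exp_dd (Λ := Λ) hG1) hκ0
      have e2 := mul_le_mul_of_nonneg_left (D.exp_dlt (Λ := Λ) fY hG2) hκ0
      linarith)
  refine ⟨c, ?_⟩
  have := D.case1_c c hB fY fUY fUZ φ h1 h2 h3 h4 h5
  rw [← hκ] at this
  nlinarith

theorem RD.case2 (D : RD V Yr O H) {B : ℕ} (hB : 1 ≤ B) (fY : O → SY) (fUY : O → SUY)
    (fUZ : O → SUZ) (φ : SUZ → SZ) {M : ℝ} (h1 : Real.log (Fintype.card SY) ≤ M)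
    (h2 : Real.log (Fintype.card SUY) ≤ M) (h3 : Real.log (Fintype.card SUZ) ≤ M)
    (h4 : Real.log (Fintype.card SZ) ≤ M)
    {G1 G2 G3 : ℝ} (hG1 : 0 < G1) (hG2 : 0 < G2) (hG3 : 0 < G3) : ∃ c : Λ → V × (Λ → H),
    B * (Hn (D.pS fY) - D.hS fUY + Hn (D.pS fUZ) - Hn (D.pS (fun o => φ (fUZ o))) -
      Real.log (Fintype.card Λ)) - Real.log (Fintype.card Λ) - 4 -
      8 * B ^ 2 * M * (2 * D.bad1 G1 + Real.sqrt (G1 / Fintype.card Λ) +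
        (2 * D.bad2 fY G2 + Real.sqrt (G2 / Fintype.card Λ)) +
        (2 * D.bad2 fUZ G3 + Real.sqrt (G3 / Fintype.card Λ))) ≤ D.Sec c B fY fUY fUZ φ := by
  have hM : 0 ≤ M := log_card_nonneg.trans h1
  set κ : ℝ := 8 * B ^ 2 * M with hκ
  have hκ0 : 0 ≤ κ := by positivity
  obtain ⟨c, hc⟩ := exists_le_of_exp (D.isP_mu (Λ := Λ))
    (f := fun c => B * D.avgH c fUY + κ * D.dd c + κ * D.dlt c fY + κ * D.dlt c fUZ)
    (t := B * D.hS fUY +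
      κ * (2 * D.bad1 G1 + Real.sqrt (G1 / Fintype.card Λ)) +
        κ * (2 * D.bad2 fY G2 + Real.sqrt (G2 / Fintype.card Λ)) +
        κ * (2 * D.bad2 fUZ G3 + Real.sqrt (G3 / Fintype.card Λ))) (by
      simp_rw [mul_add, mul_left_comm]
      simp only [Finset.sum_add_distrib, ← Finset.mul_sum]
      rw [D.exp_avgH]
      have e1 := mul_le_mul_of_nonneg_left (D.exp_dd (Λ := Λ) hG1) hκ0
      have e2 := mul_le_mul_of_nonneg_left (D.exp_dlt (Λ := Λ) fY hG2) hκ0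
      have e3 := mul_le_mul_of_nonneg_left (D.exp_dlt (Λ := Λ) fUZ hG3) hκ0
      linarith)
  refine ⟨c, ?_⟩
  have := D.case2_c c hB fY fUY fUZ φ h1 h2 h3 h4
  rw [← hκ] at this
  nlinarith

end rd2
end WR

set_option linter.unusedSectionVars false
namespace WR

section rd3
variable {V Yr O H : Type*} [Fintype V] [Fintype Yr] [Fintype O] [Fintype H]
variable {S : Type*} [Fintype S]

lemma prod_sum_arrow {α β : Type*} [Fintype α] [Fintype β] {n : ℕ} (F : Fin n → α → β → ℝ)
    (b : Fin n → β) : ∑ a : Fin n → α, ∏ i, F i (a i) (b i) = ∏ i, ∑ a, F i a (b i) :=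
  sum_pi_prod (fun i a => F i a (b i))

/-- memoryless extension -/
def RD.pow (D : RD V Yr O H) (n : ℕ) : RD (Fin n → V) (Fin n → Yr) (Fin n → O) (Fin n → H) where
  pV v := ∏ i, D.pV (v i)
  k v x := ∏ i, D.k (v i) (x.1 i, x.2 i)
  g v h := ∏ i, D.g (v i) (h i)
  r v h y := ∏ i, D.r (v i) (h i) (y i)
  hpV := WR.isP_pi (fun _ => D.hpV)
  hk v := by
    refine ⟨fun x => Finset.prod_nonneg fun i _ => (D.hk _).1 _, ?_⟩
    rw [Fintype.sum_prod_type, sum_arrow_prod (fun (a : Fin n → Yr) (b : Fin n → O) =>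
      ∏ i, D.k (v i) (a i, b i))]
    exact (WR.isP_pi (fun i => D.hk (v i))).2
  hg v := WR.isP_pi (fun i => D.hg (v i))
  hr v h := WR.isP_pi (fun i => D.hr (v i) (h i))
  cons v y := by
    simp_rw [← Finset.prod_mul_distrib]
    rw [sum_pi_prod (fun i h => D.g (v i) h * D.r (v i) h (y i)),
      sum_pi_prod (fun i o => D.k (v i) (y i, o))]
    simp_rw [D.cons]
  ac v h y h0 := by
    rw [sum_pi_prod (fun i o => D.k (v i) (y i, o)), Finset.prod_eq_zero_iff] at h0
    obtain ⟨i, _, hi⟩ := h0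
    exact Finset.prod_eq_zero (Finset.mem_univ i) (D.ac _ _ _ hi)

lemma RD.pow_a (D : RD V Yr O H) {n : ℕ} (v : Fin n → V) (y : Fin n → Yr) :
    (D.pow n).a v y = ∏ i, D.a (v i) (y i) :=
  sum_pi_prod (fun i o => D.k (v i) (y i, o))

lemma RD.pow_vk (D : RD V Yr O H) {n : ℕ} (v : Fin n → V) (h : Fin n → H) :
    (D.pow n).vk v h = fun o => ∏ i, D.vk (v i) (h i) (o i) := by
  funext o
  unfold RD.vk
  simp_rw [D.pow_a]
  rw [← sum_pi_prod (fun i y => D.k (v i) (y, o i) / D.a (v i) y * D.r (v i) (h i) y)]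
  refine Finset.sum_congr rfl fun y _ => ?_
  rw [Finset.prod_mul_distrib, Finset.prod_div_distrib]
  rfl

def fpow (f : O → S) (n : ℕ) (o : Fin n → O) (i : Fin n) : S := f (o i)

lemma RD.pow_vS (D : RD V Yr O H) {n : ℕ} (f : O → S) (v : Fin n → V) (h : Fin n → H) :
    (D.pow n).vS (fpow f n) v h = fun s => ∏ i, D.vS f (v i) (h i) (s i) := by
  funext s
  unfold RD.vS
  rw [D.pow_vk]
  exact mg_pi (fun i => D.vk (v i) (h i)) (fun _ => f) s

lemma RD.sum_pow (D : RD V Yr O H) {n : ℕ} (F : (Fin n → V) × (Fin n → H) → ℝ) :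
    ∑ x, (D.pow n).pVH x * F x =
      ∑ c : Fin n → V × H, (∏ i, D.pVH (c i)) * F (fun i => (c i).1, fun i => (c i).2) := by
  rw [Fintype.sum_prod_type, sum_arrow_prod (fun a b => (D.pow n).pVH (a, b) * F (a, b))]
  refine Finset.sum_congr rfl fun c _ => ?_
  congr 1
  unfold RD.pVH
  rw [Finset.prod_mul_distrib]; rfl

lemma RD.pow_pS (D : RD V Yr O H) {n : ℕ} (f : O → S) :
    (D.pow n).pS (fpow f n) = fun s => ∏ i, D.pS f (s i) := by
  funext s
  unfold RD.pS
  rw [out_pi]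
  unfold out
  rw [D.sum_pow (fun x => (D.pow n).vS (fpow f n) x.1 x.2 s)]
  simp_rw [D.pow_vS]

lemma RD.Hn_pow_pS (D : RD V Yr O H) {n : ℕ} (f : O → S) :
    Hn ((D.pow n).pS (fpow f n)) = n * Hn (D.pS f) := by
  rw [D.pow_pS, Hn_iid (D.isP_pS f), Fintype.card_fin]

lemma RD.pow_hS (D : RD V Yr O H) {n : ℕ} (f : O → S) :
    (D.pow n).hS (fpow f n) = n * D.hS f := by
  unfold RD.hS
  rw [D.sum_pow (fun x => Hn ((D.pow n).vS (fpow f n) x.1 x.2))]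
  simp_rw [D.pow_vS]
  have : ∀ c : Fin n → V × H, Hn (fun s : Fin n → S => ∏ i, D.vS f (c i).1 (c i).2 (s i)) =
      ∑ i, Hn (D.vS f (c i).1 (c i).2) := fun c => Hn_pi (fun i => D.isP_vS f _ _)
  simp_rw [this, Finset.mul_sum]
  rw [Finset.sum_comm]
  have h2 : ∀ i : Fin n, ∑ c : Fin n → V × H, (∏ i, D.pVH (c i)) * Hn (D.vS f (c i).1 (c i).2) =
      ∑ x, D.pVH x * Hn (D.vS f x.1 x.2) := fun i =>
    exp_pi_one (p := fun _ : Fin n => D.pVH) (fun _ => D.isP_pVH) i (fun x => Hn (D.vS f x.1 x.2))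
  simp_rw [h2]
  simp [Finset.mul_sum]

/-- quantization rate -/
def RD.Iq (D : RD V Yr O H) : ℝ := ∑ x : (V × H) × Yr,
  D.pVH x.1 * D.r x.1.1 x.1.2 x.2 * (Real.log (D.r x.1.1 x.1.2 x.2) - Real.log (D.a x.1.1 x.2))

def RD.Cq (D : RD V Yr O H) : ℝ := ∑ x : (V × H) × Yr,
  D.pVH x.1 * D.r x.1.1 x.1.2 x.2 * (Real.log (D.r x.1.1 x.1.2 x.2) - Real.log (D.a x.1.1 x.2) - D.Iq) ^ 2

def RD.bt (D : RD V Yr O H) (f : O → S) : ℝ := info D.pVH (fun x => D.vS f x.1 x.2)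

def RD.Cb (D : RD V Yr O H) (f : O → S) : ℝ := tailC D.pVH (fun x => D.vS f x.1 x.2)

lemma RD.Cq_nonneg (D : RD V Yr O H) : 0 ≤ D.Cq :=
  Finset.sum_nonneg fun x _ => mul_nonneg (mul_nonneg (D.isP_pVH.1 _) ((D.hr _ _).1 _)) (sq_nonneg _)

lemma RD.Cb_nonneg (D : RD V Yr O H) (f : O → S) : 0 ≤ D.Cb f :=
  tailC_nonneg D.isP_pVH (fun x => D.isP_vS f x.1 x.2)

lemma RD.bt_nonneg (D : RD V Yr O H) (f : O → S) : 0 ≤ D.bt f :=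
  info_nonneg D.isP_pVH (fun x => D.isP_vS f x.1 x.2)

lemma RD.pow_bad2 (D : RD V Yr O H) {n : ℕ} (hn : 0 < n) {δ : ℝ} (hδ : 0 < δ) (f : O → S) :
    (D.pow n).bad2 (fpow f n) (Real.exp (n * (D.bt f + δ))) ≤ D.Cb f / (n * δ ^ 2) := by
  unfold RD.bad2
  rw [D.sum_pow (fun x => ∑ s, if Real.exp (n * (D.bt f + δ)) * (D.pow n).pS (fpow f n) s <
    (D.pow n).vS (fpow f n) x.1 x.2 s then (D.pow n).vS (fpow f n) x.1 x.2 s else 0)]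
  simp_rw [D.pow_vS, D.pow_pS]
  exact tail_up D.isP_pVH (fun x => D.isP_vS f x.1 x.2) hδ hn

lemma RD.pow_bad1 (D : RD V Yr O H) {n : ℕ} (hn : 0 < n) {δ : ℝ} (hδ : 0 < δ) :
    (D.pow n).bad1 (Real.exp (n * (D.Iq + δ))) ≤ D.Cq / (n * δ ^ 2) := by
  have h := lln_up (isP_joint D.isP_pVH (W := fun x => D.r x.1 x.2) (fun x => D.hr x.1 x.2))
    (fun x => D.r x.1.1 x.1.2 x.2) (fun x => D.a x.1.1 x.2) (by
      intro x hx
      have h1 : 0 < D.r x.1.1 x.1.2 x.2 := by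
        refine ((D.hr _ _).1 _).lt_of_ne' fun h0 => ?_
        simp only [h0, mul_zero, lt_irrefl] at hx
      refine ⟨h1, (D.a_nonneg _ _).lt_of_ne' fun h0 => ?_⟩
      rw [D.ac _ _ _ h0] at h1
      exact lt_irrefl _ h1) hδ hn D.Iq rfl
  refine le_trans (le_of_eq ?_) h
  unfold RD.bad1
  rw [D.sum_pow (fun x => ∑ y, if Real.exp (n * (D.Iq + δ)) * (D.pow n).a x.1 y <
    (D.pow n).r x.1 x.2 y then (D.pow n).r x.1 x.2 y else 0)]
  simp_rw [D.pow_a, Finset.mul_sum]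
  rw [sum_arrow_prod (fun (c : Fin n → V × H) (y : Fin n → Yr) => (∏ i, D.pVH (c i)) *
    if Real.exp (n * (D.Iq + δ)) * ∏ i, D.a (c i).1 (y i) < (D.pow n).r (fun i => (c i).1) (fun i => (c i).2) y
    then (D.pow n).r (fun i => (c i).1) (fun i => (c i).2) y else 0)]
  refine Finset.sum_congr rfl fun c _ => ?_
  rw [Finset.prod_mul_distrib]
  change _ * (if _ < ∏ i, D.r (c i).1.1 (c i).1.2 (c i).2 then ∏ i, D.r (c i).1.1 (c i).1.2 (c i).2 else 0) = _
  split_ifs <;> simp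

end rd3

lemma sqrt_small {n : ℕ} (hn : 0 < n) {δ m b : ℝ} (hδ : 0 < δ) (hb : b ≤ m) {L : ℕ}
    (hL : Real.exp (n * (m + 2 * δ)) ≤ L) :
    Real.sqrt (Real.exp (n * (b + δ)) / L) ≤ (2 / δ) / n := by
  have hn' : (0:ℝ) < n := by exact_mod_cast hn
  have h1 : Real.exp (n * (b + δ)) / L ≤ Real.exp (- (n * δ)) := by
    calc _ ≤ Real.exp (n * (b + δ)) / Real.exp (n * (m + 2 * δ)) := by gcongr
      _ = Real.exp (n * (b + δ) - n * (m + 2 * δ)) := (Real.exp_sub _ _).symm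
      _ ≤ _ := by
        apply Real.exp_le_exp.2
        nlinarith
  refine (Real.sqrt_le_sqrt h1).trans ?_
  have h2 : Real.exp (-(n * δ)) = (Real.exp (-(n * δ / 2))) ^ 2 := by
    rw [sq, ← Real.exp_add]; congr 1; ring
  rw [h2, Real.sqrt_sq (Real.exp_pos _).le, Real.exp_neg]
  have h3 : n * δ / 2 ≤ Real.exp (n * δ / 2) := by
    have := Real.add_one_le_exp (n * δ / 2); linarith
  calc (Real.exp (n * δ / 2))⁻¹ ≤ (n * δ / 2)⁻¹ := by gcongr
    _ = _ := by field_simp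

/-- choice of the parameters -/
lemma choose_params {T R m M0 E δ : ℝ} (hδ : 0 < δ) (hE : 0 ≤ E) (hM0 : 0 ≤ M0) (hm : 0 ≤ m)
    (hgap : R + m + 4 * δ ≤ T) : ∃ B n : ℕ, 1 ≤ B ∧ 0 < n ∧ ∀ l e Mn : ℝ,
      l ≤ n * (m + 2 * δ) + Real.log 2 → Mn = n * M0 → e ≤ E / n →
      (B * n : ℝ) * R < B * (n * T - l) - l - 4 - 8 * B ^ 2 * Mn * e := by
  obtain ⟨B, hB⟩ := exists_nat_gt ((m + 2 * δ + 1) / (2 * δ))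
  have hB0 : 0 < (B : ℝ) := lt_of_le_of_lt (by positivity) hB
  rw [div_lt_iff₀ (by positivity)] at hB
  obtain ⟨n, hn⟩ := exists_nat_gt (B * Real.log 2 + Real.log 2 + 4 + 8 * B ^ 2 * M0 * E)
  have hl2 : 0 < Real.log 2 := Real.log_pos (by norm_num)
  have hn0 : 0 < (n : ℝ) := lt_of_le_of_lt (by positivity) hn
  refine ⟨B, n, by exact_mod_cast hB0, by exact_mod_cast hn0, ?_⟩
  intro l e Mn hl hMn he
  have h1 : 8 * (B:ℝ) ^ 2 * Mn * e ≤ 8 * B ^ 2 * M0 * E := by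
    rw [hMn]
    calc 8 * (B:ℝ) ^ 2 * (n * M0) * e ≤ 8 * (B:ℝ) ^ 2 * (n * M0) * (E / n) := by gcongr
      _ = _ := by field_simp
  have h2 : (B + 1) * l ≤ (B + 1) * (n * (m + 2 * δ) + Real.log 2) := by gcongr
  have h3 : B * n * (R + m + 4 * δ) ≤ B * n * T := by gcongr
  have h4 : n * (m + 2 * δ + 1) ≤ n * (B * (2 * δ)) := by gcongr
  nlinarith

section final
variable {V Yr O H : Type} [Fintype V] [Fintype Yr] [Fintype O] [Fintype H]
variable {SY SUY SUZ SZ : Type} [Fintype SY] [Fintype SUY] [Fintype SUZ] [Fintype SZ]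

lemma choose_L {n : ℕ} {m δ : ℝ} (hδ : 0 < δ) (hm : 0 ≤ m) : ∃ L : ℕ, 0 < L ∧
    Real.exp (n * (m + 2 * δ)) ≤ L ∧ Real.log L ≤ n * (m + 2 * δ) + Real.log 2 := by
  have h1 : 1 ≤ Real.exp (n * (m + 2 * δ)) := Real.one_le_exp (by positivity)
  have hp : 0 < ⌈Real.exp (n * (m + 2 * δ))⌉₊ := Nat.ceil_pos.2 (by linarith)
  refine ⟨⌈Real.exp (n * (m + 2 * δ))⌉₊, hp, Nat.le_ceil _, ?_⟩
  have h2 := Real.log_le_log (by exact_mod_cast hp) (ceil_le_two h1)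
  rw [Real.log_mul (by norm_num) (by positivity), Real.log_exp] at h2
  linarith

theorem RD.asym1 (D : RD V Yr O H) (fY : O → SY) (fUY : O → SUY) (fUZ : O → SUZ) (φ : SUZ → SZ) {R : ℝ}
    (hR : R < Hn (D.pS fY) - D.hS fUY + D.hS fUZ - D.hS (fun o => φ (fUZ o)) - max D.Iq (D.bt fY)) :
    ∃ (B n L : ℕ) (c : Fin L → (Fin n → V) × (Fin L → Fin n → H)), 0 < B ∧ 0 < n ∧ 0 < L ∧
      (B * n : ℝ) * R < (D.pow n).Sec c B (fpow fY n) (fpow fUY n) (fpow fUZ n) (fpow φ n) := by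
  obtain ⟨m, hm⟩ : ∃ m, m = max D.Iq (D.bt fY) := ⟨_, rfl⟩
  obtain ⟨T, hT⟩ : ∃ T, T = Hn (D.pS fY) - D.hS fUY + D.hS fUZ - D.hS (fun o => φ (fUZ o)) := ⟨_, rfl⟩
  rw [← hm, ← hT] at hR
  have hm0 : 0 ≤ m := by rw [hm]; exact (D.bt_nonneg fY).trans (le_max_right _ _)
  have hmI : D.Iq ≤ m := by rw [hm]; exact le_max_left _ _
  have hmY : D.bt fY ≤ m := by rw [hm]; exact le_max_right _ _
  obtain ⟨δ, hδ0⟩ : ∃ δ, δ = (T - m - R) / 4 := ⟨_, rfl⟩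
  have hδ : 0 < δ := by rw [hδ0]; linarith
  have hl2 : 0 < Real.log 2 := Real.log_pos (by norm_num)
  have c1 := log_card_nonneg (S := SY)
  have c2 := log_card_nonneg (S := SUY)
  have c3 := log_card_nonneg (S := SUZ)
  have c4 := log_card_nonneg (S := SZ)
  obtain ⟨M0, hM0⟩ : ∃ M0, M0 = Real.log (Fintype.card SY) + Real.log (Fintype.card SUY) +
    Real.log (Fintype.card SUZ) + Real.log (Fintype.card SZ) + (m + 2 * δ + Real.log 2) := ⟨_, rfl⟩
  have hM00 : 0 ≤ M0 := by rw [hM0]; positivity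
  obtain ⟨E, hE⟩ : ∃ E, E = 2 * (D.Cq / δ ^ 2) + 2 / δ + (2 * (D.Cb fY / δ ^ 2) + 2 / δ) := ⟨_, rfl⟩
  have hE0 : 0 ≤ E := by
    have := D.Cq_nonneg
    have := D.Cb_nonneg fY
    rw [hE]; positivity
  obtain ⟨B, n, hB, hn, hall⟩ := choose_params (T := T) (R := R) (m := m) hδ hE0 hM00 hm0 (by linarith)
  obtain ⟨L, hL0, hL1, hL2⟩ := choose_L (n := n) hδ hm0
  have hn1 : (1:ℝ) ≤ n := by exact_mod_cast hn
  haveI : Nonempty (Fin L) := ⟨⟨0, hL0⟩⟩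
  have hcard : (Fintype.card (Fin L) : ℝ) = L := by simp
  obtain ⟨c, hc⟩ := (D.pow n).case1 (Λ := Fin L) hB (fpow fY n) (fpow fUY n) (fpow fUZ n) (fpow φ n)
    (M := n * M0) (by rw [log_card_pi]; gcongr; linarith) (by rw [log_card_pi]; gcongr; linarith)
    (by rw [log_card_pi]; gcongr; linarith) (by rw [log_card_pi]; gcongr; linarith)
    (by rw [hcard]; nlinarith) (Real.exp_pos (n * (D.Iq + δ))) (Real.exp_pos (n * (D.bt fY + δ)))
  refine ⟨B, n, L, c, hB, hn, hL0, ?_⟩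
  refine lt_of_lt_of_le ?_ hc
  have e0 : (fun o => fpow φ n (fpow fUZ n o)) = fpow (fun o => φ (fUZ o)) n := rfl
  rw [e0, D.Hn_pow_pS, D.pow_hS, D.pow_hS, D.pow_hS, hcard]
  have e1 := D.pow_bad1 hn hδ
  have e2 := D.pow_bad2 hn hδ fY
  have s1 := sqrt_small hn hδ hmI hL1
  have s2 := sqrt_small hn hδ hmY hL1
  have key := hall (Real.log L) _ _ hL2 rfl (show (2 * (D.Cq / (n * δ ^ 2)) + (2 / δ) / n +
    (2 * (D.Cb fY / (n * δ ^ 2)) + (2 / δ) / n)) ≤ E / n by rw [hE]; apply le_of_eq; field_simp)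
  refine key.trans_le ?_
  have e3 : (n:ℝ) * T = n * Hn (D.pS fY) - n * D.hS fUY + n * D.hS fUZ - n * D.hS (fun o => φ (fUZ o)) := by
    rw [hT]; ring
  rw [e3]
  gcongr

theorem RD.asym2 (D : RD V Yr O H) (fY : O → SY) (fUY : O → SUY) (fUZ : O → SUZ) (φ : SUZ → SZ) {R : ℝ}
    (hR : R < Hn (D.pS fY) - D.hS fUY + Hn (D.pS fUZ) - Hn (D.pS (fun o => φ (fUZ o))) -
      max (max D.Iq (D.bt fY)) (D.bt fUZ)) :
    ∃ (B n L : ℕ) (c : Fin L → (Fin n → V) × (Fin L → Fin n → H)), 0 < B ∧ 0 < n ∧ 0 < L ∧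
      (B * n : ℝ) * R < (D.pow n).Sec c B (fpow fY n) (fpow fUY n) (fpow fUZ n) (fpow φ n) := by
  obtain ⟨m, hm⟩ : ∃ m, m = max (max D.Iq (D.bt fY)) (D.bt fUZ) := ⟨_, rfl⟩
  obtain ⟨T, hT⟩ : ∃ T, T = Hn (D.pS fY) - D.hS fUY + Hn (D.pS fUZ) - Hn (D.pS (fun o => φ (fUZ o))) := ⟨_, rfl⟩
  rw [← hm, ← hT] at hR
  have hm0 : 0 ≤ m := by rw [hm]; exact (D.bt_nonneg fUZ).trans (le_max_right _ _)
  have hmI : D.Iq ≤ m := by rw [hm]; exact (le_max_left _ _).trans (le_max_left _ _)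
  have hmY : D.bt fY ≤ m := by rw [hm]; exact (le_max_right _ _).trans (le_max_left _ _)
  have hmZ : D.bt fUZ ≤ m := by rw [hm]; exact le_max_right _ _
  obtain ⟨δ, hδ0⟩ : ∃ δ, δ = (T - m - R) / 4 := ⟨_, rfl⟩
  have hδ : 0 < δ := by rw [hδ0]; linarith
  have hl2 : 0 < Real.log 2 := Real.log_pos (by norm_num)
  have c1 := log_card_nonneg (S := SY)
  have c2 := log_card_nonneg (S := SUY)
  have c3 := log_card_nonneg (S := SUZ)
  have c4 := log_card_nonneg (S := SZ)
  obtain ⟨M0, hM0⟩ : ∃ M0, M0 = Real.log (Fintype.card SY) + Real.log (Fintype.card SUY) +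
    Real.log (Fintype.card SUZ) + Real.log (Fintype.card SZ) := ⟨_, rfl⟩
  have hM00 : 0 ≤ M0 := by rw [hM0]; positivity
  obtain ⟨E, hE⟩ : ∃ E, E = 2 * (D.Cq / δ ^ 2) + 2 / δ + (2 * (D.Cb fY / δ ^ 2) + 2 / δ) +
    (2 * (D.Cb fUZ / δ ^ 2) + 2 / δ) := ⟨_, rfl⟩
  have hE0 : 0 ≤ E := by
    have := D.Cq_nonneg
    have := D.Cb_nonneg fY
    have := D.Cb_nonneg fUZ
    rw [hE]; positivity
  obtain ⟨B, n, hB, hn, hall⟩ := choose_params (T := T) (R := R) (m := m) hδ hE0 hM00 hm0 (by linarith)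
  obtain ⟨L, hL0, hL1, hL2⟩ := choose_L (n := n) hδ hm0
  have hn1 : (1:ℝ) ≤ n := by exact_mod_cast hn
  haveI : Nonempty (Fin L) := ⟨⟨0, hL0⟩⟩
  have hcard : (Fintype.card (Fin L) : ℝ) = L := by simp
  obtain ⟨c, hc⟩ := (D.pow n).case2 (Λ := Fin L) hB (fpow fY n) (fpow fUY n) (fpow fUZ n) (fpow φ n)
    (M := n * M0) (by rw [log_card_pi]; gcongr; linarith) (by rw [log_card_pi]; gcongr; linarith)
    (by rw [log_card_pi]; gcongr; linarith) (by rw [log_card_pi]; gcongr; linarith)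
    (Real.exp_pos (n * (D.Iq + δ))) (Real.exp_pos (n * (D.bt fY + δ))) (Real.exp_pos (n * (D.bt fUZ + δ)))
  refine ⟨B, n, L, c, hB, hn, hL0, ?_⟩
  refine lt_of_lt_of_le ?_ hc
  have e0 : (fun o => fpow φ n (fpow fUZ n o)) = fpow (fun o => φ (fUZ o)) n := rfl
  rw [e0, D.Hn_pow_pS, D.Hn_pow_pS, D.Hn_pow_pS, D.pow_hS, hcard]
  have e1 := D.pow_bad1 hn hδ
  have e2 := D.pow_bad2 hn hδ fY
  have e4 := D.pow_bad2 hn hδ fUZ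
  have s1 := sqrt_small hn hδ hmI hL1
  have s2 := sqrt_small hn hδ hmY hL1
  have s3 := sqrt_small hn hδ hmZ hL1
  have key := hall (Real.log L) _ _ hL2 rfl (show (2 * (D.Cq / (n * δ ^ 2)) + (2 / δ) / n +
    (2 * (D.Cb fY / (n * δ ^ 2)) + (2 / δ) / n) + (2 * (D.Cb fUZ / (n * δ ^ 2)) + (2 / δ) / n)) ≤ E / n by
      rw [hE]; apply le_of_eq; field_simp)
  refine key.trans_le ?_
  have e3 : (n:ℝ) * T = n * Hn (D.pS fY) - n * D.hS fUY + n * Hn (D.pS fUZ) -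
      n * Hn (D.pS (fun o => φ (fUZ o))) := by
    rw [hT]; ring
  rw [e3]
  gcongr

end final
end WR

set_option linter.unusedSectionVars false
namespace WR

section hmm
variable {Λ Xr Yr : Type} [Fintype Λ] [Nonempty Λ] [Fintype Xr] [Fintype Yr]

/-- forward filter of a hidden state -/
def hst (e : ℕ → Λ → Xr → ℝ) (τ : ℕ → (ℕ → Yr) → Λ → Λ → ℝ) (y : ℕ → Yr) (x : ℕ → Xr) : ℕ → Λ → ℝ
  | 0, _ => (Fintype.card Λ : ℝ)⁻¹
  | t + 1, l' => ∑ l, hst e τ y x t l * e t l (x t) * τ t y l l'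

def rl (e : ℕ → Λ → Xr → ℝ) (τ : ℕ → (ℕ → Yr) → Λ → Λ → ℝ) (t : ℕ) (y : ℕ → Yr) (x : ℕ → Xr)
    (ξ : Xr) : ℝ :=
  if ∑ l, hst e τ y x t l = 0 then e t (Classical.arbitrary Λ) ξ
  else (∑ l, hst e τ y x t l * e t l ξ) / ∑ l, hst e τ y x t l

variable {e : ℕ → Λ → Xr → ℝ} {τ : ℕ → (ℕ → Yr) → Λ → Λ → ℝ}

lemma hst_nonneg (he : ∀ t l, isP (e t l)) (hτ : ∀ t y l, isP (τ t y l)) (y : ℕ → Yr) (x : ℕ → Xr)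
    (t : ℕ) (l : Λ) : 0 ≤ hst e τ y x t l := by
  induction t generalizing l with
  | zero => exact inv_nonneg.2 (Nat.cast_nonneg _)
  | succ t ih =>
    exact Finset.sum_nonneg fun l _ => mul_nonneg (mul_nonneg (ih l) ((he _ _).1 _)) ((hτ _ _ _).1 _)

lemma hst_congr (hl : ∀ t (y y' : ℕ → Yr), (∀ j ≤ t, y j = y' j) → τ t y = τ t y')
    {y y' : ℕ → Yr} {x x' : ℕ → Xr} (t : ℕ) (h : ∀ j < t, y j = y' j ∧ x j = x' j) :
    hst e τ y x t = hst e τ y' x' t := by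
  induction t with
  | zero => rfl
  | succ t ih =>
    funext l'
    simp only [hst]
    rw [ih (fun j hj => h j (by omega)), (h t (by omega)).2,
      hl t y y' (fun j hj => (h j (by omega)).1)]

lemma isP_rl (he : ∀ t l, isP (e t l)) (hτ : ∀ t y l, isP (τ t y l)) (t : ℕ) (y : ℕ → Yr)
    (x : ℕ → Xr) : isP (rl e τ t y x) := by
  unfold rl
  by_cases h : ∑ l, hst e τ y x t l = 0
  · simp only [h, if_true]; exact he _ _
  · simp only [h, if_false]
    refine ⟨fun ξ => div_nonneg (Finset.sum_nonneg fun l _ => mul_nonneg (hst_nonneg he hτ y x t l)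
      ((he _ _).1 _)) (Finset.sum_nonneg fun l _ => hst_nonneg he hτ y x t l), ?_⟩
    rw [← Finset.sum_div, Finset.sum_comm]
    simp_rw [← Finset.mul_sum, (he _ _).2, mul_one]
    exact div_self h

lemma rl_prod (he : ∀ t l, isP (e t l)) (hτ : ∀ t y l, isP (τ t y l)) (y : ℕ → Yr)
    (x : ℕ → Xr) (t : ℕ) : ∏ s ∈ Finset.range t, rl e τ s y x (x s) = ∑ l, hst e τ y x t l := by
  induction t with
  | zero => simp [hst, (cardpos (Λ := Λ)).ne']
  | succ t ih =>
    rw [Finset.prod_range_succ, ih]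
    have h1 : ∑ l', hst e τ y x (t + 1) l' = ∑ l, hst e τ y x t l * e t l (x t) := by
      simp only [hst]
      rw [Finset.sum_comm]
      simp_rw [← Finset.mul_sum, (hτ _ _ _).2, mul_one]
    rw [h1]
    unfold rl
    by_cases h : ∑ l, hst e τ y x t l = 0
    · have h2 := (Finset.sum_eq_zero_iff_of_nonneg (fun l _ => hst_nonneg he hτ y x t l)).1 h
      rw [h, zero_mul]
      symm
      exact Finset.sum_eq_zero fun l hl => by rw [h2 l hl, zero_mul]
    · rw [if_neg h]; field_simp

/-- extension of a finite sequence -/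
def ext0 {S : Type*} [Nonempty S] {t : ℕ} (f : Fin t → S) (j : ℕ) : S :=
  if h : j < t then f ⟨j, h⟩ else Classical.arbitrary S

variable [Nonempty Xr] [Nonempty Yr]

def rl1 (e : ℕ → Λ → Xr → ℝ) (τ : ℕ → (ℕ → Yr) → Λ → Λ → ℝ) (T : ℕ) :
    (t : Fin T) → (Fin t.1 → Yr) → (Fin t.1 → Xr) → Xr → ℝ := fun t yp xp =>
  rl e τ t.1 (ext0 yp) (ext0 xp)

lemma RL_rl1 (he : ∀ t l, isP (e t l)) (hτ : ∀ t y l, isP (τ t y l))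
    (hl : ∀ t (y y' : ℕ → Yr), (∀ j ≤ t, y j = y' j) → τ t y = τ t y') {T : ℕ}
    (yr : Fin T → Yr) (xr : Fin T → Xr) :
    RL (rl1 e τ T) yr xr = ∑ l, hst e τ (ext0 yr) (ext0 xr) T l := by
  rw [← rl_prod he hτ, ← Fin.prod_univ_eq_prod_range (fun s => rl e τ s (ext0 yr) (ext0 xr) (ext0 xr s))]
  unfold RL
  refine Finset.prod_congr rfl fun t _ => ?_
  have hx : ext0 xr t.1 = xr t := by simp [ext0]
  rw [hx]
  unfold rl1 rl
  rw [hst_congr hl t.1 (y := ext0 fun j : Fin t.1 => yr ⟨j.1, lt_trans j.2 t.isLt⟩) (y' := ext0 yr)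
    (x := ext0 fun j : Fin t.1 => xr ⟨j.1, lt_trans j.2 t.isLt⟩) (x' := ext0 xr)]
  intro j hj
  have : j < T := hj.trans t.2
  simp [ext0, hj, this]

/-- block-wise transitions -/
def btau (n : ℕ) (E : Λ → (Fin n → Yr) → Λ → ℝ) (t : ℕ) (y : ℕ → Yr) (l l' : Λ) : ℝ :=
  if (t + 1) % n = 0 then E l (fun i => y (t + 1 - n + i.1)) l' else if l = l' then 1 else 0

lemma isP_btau {n : ℕ} {E : Λ → (Fin n → Yr) → Λ → ℝ} (hE : ∀ l y, isP (E l y)) (t : ℕ)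
    (y : ℕ → Yr) (l : Λ) : isP (btau n E t y l) := by
  unfold btau
  by_cases h : (t + 1) % n = 0
  · simp only [h, if_true]; exact hE _ _
  · simp only [h, if_false]
    exact ⟨fun a => by beta_reduce; split_ifs <;> norm_num, by simp⟩

lemma btau_loc {n : ℕ} {E : Λ → (Fin n → Yr) → Λ → ℝ} (t : ℕ) (y y' : ℕ → Yr)
    (h : ∀ j ≤ t, y j = y' j) : btau n E t y = btau n E t y' := by
  funext l l'
  unfold btau
  by_cases h0 : (t + 1) % n = 0
  · simp only [h0, if_true]
    congr 1
    funext i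
    apply h
    have := i.2
    have : n ≤ t + 1 := Nat.le_of_dvd (by omega) (Nat.dvd_of_mod_eq_zero h0)
    omega
  · simp only [h0, if_false]

/-- filter along one block -/
lemma hst_blk {n : ℕ} (hn : 0 < n) (e0 : Λ → Fin n → Xr → ℝ) (E : Λ → (Fin n → Yr) → Λ → ℝ)
    (y : ℕ → Yr) (x : ℕ → Xr) (j : ℕ) (l' : Λ) :
    hst (fun t l => e0 l ⟨t % n, Nat.mod_lt _ hn⟩) (btau n E) y x (n * (j + 1)) l' =
      ∑ l, hst (fun t l => e0 l ⟨t % n, Nat.mod_lt _ hn⟩) (btau n E) y x (n * j) l *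
        (∏ i : Fin n, e0 l i (x (n * j + i.1))) * E l (fun i => y (n * j + i.1)) l' := by
  obtain ⟨m, rfl⟩ : ∃ m, n = m + 1 := ⟨n - 1, by omega⟩
  obtain ⟨n, hnm⟩ : ∃ n, n = m + 1 := ⟨_, rfl⟩
  have key : ∀ i (hi : i ≤ m) l, hst (fun t l => e0 l ⟨t % (m+1), Nat.mod_lt _ hn⟩) (btau (m+1) E) y x
      ((m+1) * j + i) l = hst (fun t l => e0 l ⟨t % (m+1), Nat.mod_lt _ hn⟩) (btau (m+1) E) y x
      ((m+1) * j) l * ∏ i' : Fin i, e0 l ⟨i'.1, by have := i'.2; omega⟩ (x ((m+1) * j + i'.1)) := by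
    intro i
    induction i with
    | zero => intro _ l; simp
    | succ i ih =>
      intro hi l
      rw [← add_assoc]
      simp only [hst]
      have hmod : ((m+1) * j + i + 1) % (m+1) ≠ 0 := by
        rw [add_assoc, Nat.mul_add_mod, Nat.mod_eq_of_lt (by omega)]; omega
      have hmod2 : ((m+1) * j + i) % (m+1) = i := by
        rw [Nat.mul_add_mod, Nat.mod_eq_of_lt (by omega)]
      simp only [btau, hmod, if_false]
      simp only [mul_ite, mul_one, mul_zero, Finset.sum_ite_eq', Finset.mem_univ, if_true]
      rw [ih (by omega), Fin.prod_univ_castSucc, mul_assoc]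
      congr 2
      simp only [hmod2, Fin.val_last]
  rw [show (m+1) * (j+1) = ((m+1) * j + m) + 1 by ring]
  simp only [hst]
  refine Finset.sum_congr rfl fun l _ => ?_
  rw [key m le_rfl, Fin.prod_univ_castSucc (n := m)]
  have hmod : ((m+1) * j + m + 1) % (m+1) = 0 := by
    rw [add_assoc, Nat.mul_add_mod]; simp
  have hmod2 : ((m+1) * j + m) % (m+1) = m := by
    rw [Nat.mul_add_mod, Nat.mod_eq_of_lt (by omega)]
  simp only [btau, hmod, if_true, hmod2]
  rw [show (m+1) * j + m + 1 - (m+1) = (m+1) * j by omega, ← mul_assoc]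
  rfl

/-- law of whole path equals product form -/
lemma pl_hst {n : ℕ} (hn : 0 < n) {Q : Type*} [Fintype Q] (e0 : Λ → Fin n → Xr → ℝ)
    (E : Λ → (Fin n → Yr) → Λ → ℝ)
    (G : Q → ℝ) (gx : Q → Xr) (gy : Q → Yr) (y : ℕ → Yr) (x : ℕ → Xr) (B : ℕ)
    (w : Fin B → Fin n → Q) (hy : ∀ j i, gy (w j i) = y (n * j.1 + i.1))
    (hx : ∀ j i, gx (w j i) = x (n * j.1 + i.1)) (l : Λ) :
    pl (fun l (z : (Fin n → Q) × Λ) => (∏ i, G (z.1 i) * e0 l i (gx (z.1 i))) *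
      E l (fun i => gy (z.1 i)) z.2) B (w, l) = (∏ j, ∏ i, G (w j i)) *
      hst (fun t l => e0 l ⟨t % n, Nat.mod_lt _ hn⟩) (btau n E) y x (n * B) l := by
  induction B generalizing l with
  | zero => simp [pl, hst]
  | succ B ih =>
    simp only [pl]
    rw [hst_blk hn, Fin.prod_univ_castSucc, Finset.mul_sum]
    refine Finset.sum_congr rfl fun l0 _ => ?_
    rw [ih (Fin.init w) (fun j i => hy j.castSucc i) (fun j i => hx j.castSucc i)]
    simp only [Finset.prod_mul_distrib, hy, hx, Fin.val_last, Fin.init]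
    ring

end hmm

end WR

set_option linter.unusedSectionVars false
namespace WR

lemma info_joint {α β : Type*} [Fintype α] [Fintype β] (p : α → ℝ) (W : α → β → ℝ)
    (hW : ∀ a, isP (W a)) :
    info p W = Hn (mg Prod.snd (fun x : α × β => p x.1 * W x.1 x.2)) + Hn p -
      Hn (fun x : α × β => p x.1 * W x.1 x.2) := by
  rw [Hn_chain p W (fun a _ => (hW a).2)]
  have : mg Prod.snd (fun x : α × β => p x.1 * W x.1 x.2) = out p W := by
    funext b; rw [mg_snd]; rfl
  rw [this]; unfold info; ring

section conc
variable {X Xr Yr Y Z U V H : Type} [Fintype X] [Fintype Xr] [Fintype Yr] [Fintype Y] [Fintype Z]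
  [Fintype U] [Fintype V] [Fintype H]

/-- all letter variables `(u,x,xr,yr,y,z)` -/
abbrev QQ (U X Xr Yr Y Z : Type) := U × X × Xr × Yr × Y × Z

def GG (pU : U → ℝ) (px : U → X → ℝ) (W : X × Xr → Yr × Y × Z → ℝ) (q : QQ U X Xr Yr Y Z) : ℝ :=
  pU q.1 * px q.1 q.2.1 * W (q.2.1, q.2.2.1) q.2.2.2

def Jt {T : ℕ} (pU : U → ℝ) (px : U → X → ℝ) (W : X × Xr → Yr × Y × Z → ℝ)
    (relay : (t : Fin T) → (Fin t.1 → Yr) → (Fin t.1 → Xr) → Xr → ℝ)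
    (w : Fin T → QQ U X Xr Yr Y Z) : ℝ :=
  (∏ t, GG pU px W (w t)) * RL relay (fun t => (w t).2.2.2.1) (fun t => (w t).2.2.1)

def eqQ (T : ℕ) : ((Fin T → U) × (Fin T → Y) × (Fin T → Z)) ×
    ((Fin T → X) × (Fin T → Xr) × (Fin T → Yr)) ≃ (Fin T → QQ U X Xr Yr Y Z) where
  toFun p t := (p.1.1 t, p.2.1 t, p.2.2.1 t, p.2.2.2 t, p.1.2.1 t, p.1.2.2 t)
  invFun w := ((fun t => (w t).1, fun t => (w t).2.2.2.2.1, fun t => (w t).2.2.2.2.2),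
    (fun t => (w t).2.1, fun t => (w t).2.2.1, fun t => (w t).2.2.2.1))
  left_inv _ := rfl
  right_inv _ := rfl

variable {T : ℕ} (pU : U → ℝ) (px : U → X → ℝ) (W : X × Xr → Yr × Y × Z → ℝ)
    (relay : (t : Fin T) → (Fin t.1 → Yr) → (Fin t.1 → Xr) → Xr → ℝ)

lemma joint_Jt (u : Fin T → U) (y : Fin T → Y) (z : Fin T → Z) :
    (∏ t, pU (u t)) * Chn relay W (fun x => ∏ t, px (u t) (x t)) (y, z) =
      mg (fun w : Fin T → QQ U X Xr Yr Y Z => ((fun t => (w t).1), (fun t => (w t).2.2.2.2.1),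
        (fun t => (w t).2.2.2.2.2))) (Jt pU px W relay) (u, y, z) := by
  rw [mg_eq_sum (eqQ T) (fun _ => rfl)]
  unfold Chn
  rw [Finset.mul_sum]
  refine Finset.sum_congr rfl fun w _ => ?_
  simp only [Jt, GG, eqQ, Equiv.coe_fn_mk, Finset.prod_mul_distrib]
  ring

lemma joint_Y : (fun x : (Fin T → U) × (Fin T → Y) => (∏ t, pU (x.1 t)) *
      ∑ z, Chn relay W (fun x' => ∏ t, px (x.1 t) (x' t)) (x.2, z)) =
    mg (fun w : Fin T → QQ U X Xr Yr Y Z => ((fun t => (w t).1), (fun t => (w t).2.2.2.2.1)))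
      (Jt pU px W relay) := by
  funext ⟨u, y⟩
  simp only
  rw [Finset.mul_sum]
  simp_rw [joint_Jt]
  refine (mg_eq_sum (f := fun x : (Fin T → U) × (Fin T → Y) × (Fin T → Z) => (x.1, x.2.1))
    (Equiv.prodAssoc _ _ _) (fun _ => rfl) _ (u, y)).symm.trans ?_
  rw [mg_mg]

def swp (α β γ : Type*) : (α × γ) × β ≃ α × β × γ where
  toFun p := (p.1.1, p.2, p.1.2)
  invFun p := ((p.1, p.2.2), p.2.1)
  left_inv _ := rfl
  right_inv _ := rfl

lemma joint_Z : (fun x : (Fin T → U) × (Fin T → Z) => (∏ t, pU (x.1 t)) *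
      ∑ y, Chn relay W (fun x' => ∏ t, px (x.1 t) (x' t)) (y, x.2)) =
    mg (fun w : Fin T → QQ U X Xr Yr Y Z => ((fun t => (w t).1), (fun t => (w t).2.2.2.2.2)))
      (Jt pU px W relay) := by
  funext ⟨u, z⟩
  simp only
  rw [Finset.mul_sum]
  simp_rw [joint_Jt]
  refine (mg_eq_sum (f := fun x : (Fin T → U) × (Fin T → Y) × (Fin T → Z) => (x.1, x.2.2))
    (swp _ _ _) (fun _ => rfl) _ (u, z)).symm.trans ?_
  rw [mg_mg]

def sq (f : QQ U X Xr Yr Y Z → H) (w : Fin T → QQ U X Xr Yr Y Z) (t : Fin T) : H := f (w t)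

lemma info_diff (hpx : ∀ u, isP (px u)) (hW : ∀ x, isP (W x)) (hrelay : ∀ t yp xp, isP (relay t yp xp)) :
    info (fun u : Fin T → U => ∏ t, pU (u t))
        (fun u y => ∑ z, Chn relay W (fun x => ∏ t, px (u t) (x t)) (y, z)) -
      info (fun u : Fin T → U => ∏ t, pU (u t))
        (fun u z => ∑ y, Chn relay W (fun x => ∏ t, px (u t) (x t)) (y, z)) =
    Hn (mg (sq (T := T) (fun q : QQ U X Xr Yr Y Z => q.2.2.2.2.1)) (Jt pU px W relay)) +
    Hn (mg (sq (T := T) (fun q : QQ U X Xr Yr Y Z => (q.1, q.2.2.2.2.2))) (Jt pU px W relay)) -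
    Hn (mg (sq (T := T) (fun q : QQ U X Xr Yr Y Z => (q.1, q.2.2.2.2.1))) (Jt pU px W relay)) -
    Hn (mg (sq (T := T) (fun q : QQ U X Xr Yr Y Z => q.2.2.2.2.2)) (Jt pU px W relay)) := by
  have hC : ∀ u : Fin T → U, isP (Chn relay W (fun x => ∏ t, px (u t) (x t))) := fun u =>
    isP_Chn hrelay hW (isP_pi (fun t => hpx (u t)))
  rw [info_joint _ _ (fun u => ?_), info_joint _ _ (fun u => ?_), joint_Y, joint_Z, mg_mg, mg_mg]
  · have e1 : ∀ {S S' : Type} [Fintype S] [Fintype S'] (f : QQ U X Xr Yr Y Z → S)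
        (g : QQ U X Xr Yr Y Z → S'),
        Hn (mg (sq (T := T) (fun q => (f q, g q))) (Jt pU px W relay)) =
        Hn (mg (fun w : Fin T → QQ U X Xr Yr Y Z => ((fun t => f (w t)), (fun t => g (w t))))
          (Jt pU px W relay)) := by
      intro S S' _ _ f g
      rw [← Hn_mg_inj (fun x : Fin T → S × S' => ((fun t => (x t).1), (fun t => (x t).2))), mg_mg]
      · rfl
      · intro a b h
        simp only [Prod.mk.injEq] at h
        funext t
        exact Prod.ext (congrFun h.1 t) (congrFun h.2 t)
    rw [e1 (fun q => q.1) (fun q => q.2.2.2.2.2), e1 (fun q => q.1) (fun q => q.2.2.2.2.1)]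
    have a1 : ∀ {S : Type} (f : QQ U X Xr Yr Y Z → S), sq (T := T) f = fun w t => f (w t) := fun f => rfl
    rw [a1, a1]
    ring
  · refine ⟨fun y => Finset.sum_nonneg fun z _ => (hC u).1 _, ?_⟩
    rw [← (hC u).2, Fintype.sum_prod_type_right]
  · refine ⟨fun y => Finset.sum_nonneg fun z _ => (hC u).1 _, ?_⟩
    rw [← (hC u).2, Fintype.sum_prod_type]

/-- projection to (yr, o) -/
def prj (q : QQ U X Xr Yr Y Z) : Yr × (U × Y × Z) := (q.2.2.2.1, (q.1, q.2.2.2.2))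

variable {Λ : Type} [Fintype Λ] [Nonempty Λ]

lemma mapK_conc (D : RD V Yr (U × Y × Z) H) (κ : V → Xr → ℝ)
    (hk : ∀ v, D.k v = mg prj (fun q : QQ U X Xr Yr Y Z => GG pU px W q * κ v q.2.2.1)) {n : ℕ}
    (c : Λ → (Fin n → V) × (Λ → Fin n → H)) :
    mapK (fun (w : Fin n → QQ U X Xr Yr Y Z) i => (prj (w i)).2)
      (fun l (z : (Fin n → QQ U X Xr Yr Y Z) × Λ) =>
        (∏ i, GG pU px W (z.1 i) * κ ((c l).1 i) (z.1 i).2.2.1) *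
      (D.pow n).ee (c l) (fun i => (z.1 i).2.2.2.1) z.2) = (D.pow n).pi c := by
  funext l ⟨o, l'⟩
  unfold mapK RD.pi
  simp only
  have h1 : ∀ yr : Fin n → Yr, (D.pow n).k (c l).1 (yr, o) =
      ∑ w : Fin n → QQ U X Xr Yr Y Z, if (fun i => (w i).2.2.2.1) = yr then
        (if (fun i => (prj (w i)).2) = o then
          ∏ i, GG pU px W (w i) * κ ((c l).1 i) (w i).2.2.1 else 0) else 0 := by
    intro yr
    have h2 := mg_pi (fun i => fun q : QQ U X Xr Yr Y Z => GG pU px W q * κ ((c l).1 i) q.2.2.1)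
      (fun _ => prj) (fun i => (yr i, o i))
    have h3 : (D.pow n).k (c l).1 (yr, o) = ∏ i, D.k ((c l).1 i) (yr i, o i) := rfl
    rw [h3]
    simp_rw [hk]
    rw [← h2]
    unfold mg
    refine Finset.sum_congr rfl fun w _ => ?_
    rw [← ite_and]
    congr 1
    simp only [eq_iff_iff]
    constructor
    · intro h
      exact ⟨funext fun i => congrArg Prod.fst (congrFun h i), funext fun i => congrArg Prod.snd (congrFun h i)⟩
    · rintro ⟨h, h'⟩
      funext i
      exact Prod.ext (congrFun h i) (congrFun h' i)
  simp_rw [h1, Finset.sum_mul]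
  rw [Finset.sum_comm]
  refine Finset.sum_congr rfl fun w _ => ?_
  simp only [ite_mul, zero_mul, Finset.sum_ite_eq, Finset.mem_univ, if_true]

variable [Nonempty Xr] [Nonempty Yr]

theorem PS_conc (D : RD V Yr (U × Y × Z) H) {κ : V → Xr → ℝ} (hκ : ∀ v, isP (κ v))
    (hk : ∀ v, D.k v = mg prj (fun q : QQ U X Xr Yr Y Z => GG pU px W q * κ v q.2.2.1)) {n : ℕ}
    (hn : 0 < n) (B : ℕ) (c : Λ → (Fin n → V) × (Λ → Fin n → H)) :
    ∃ relay : (t : Fin (B * n)) → (Fin t.1 → Yr) → (Fin t.1 → Xr) → Xr → ℝ,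
      (∀ t yp xp, isP (relay t yp xp)) ∧ ∀ {S : Type} [Fintype S] (f : U × Y × Z → S),
        Hn ((D.pow n).PS c B (fpow f n)) =
          Hn (mg (sq (T := B * n) (fun q : QQ U X Xr Yr Y Z => f (prj q).2)) (Jt pU px W relay)) := by
  obtain ⟨e, he⟩ : ∃ e : ℕ → Λ → Xr → ℝ, e = fun t l => κ ((c l).1 ⟨t % n, Nat.mod_lt _ hn⟩) := ⟨_, rfl⟩
  obtain ⟨τ, hτ⟩ : ∃ τ : ℕ → (ℕ → Yr) → Λ → Λ → ℝ, τ = btau n (fun l => (D.pow n).ee (c l)) := ⟨_, rfl⟩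
  have heP : ∀ t l, isP (e t l) := fun t l => by rw [he]; exact hκ _
  have hτP : ∀ t y l, isP (τ t y l) := fun t y l => by
    rw [hτ]; exact isP_btau (fun l y => (D.pow n).isP_ee _ _) _ _ _
  have hloc : ∀ t (y y' : ℕ → Yr), (∀ j ≤ t, y j = y' j) → τ t y = τ t y' := fun t y y' h => by
    rw [hτ]; exact btau_loc t y y' h
  refine ⟨rl1 e τ (B * n), fun t yp xp => isP_rl heP hτP _ _ _, ?_⟩
  intro S _ f
  have hJ : ∀ w : Fin (B * n) → QQ U X Xr Yr Y Z, Jt pU px W (rl1 e τ (B * n)) w =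
      ∑ l, pl (fun l (z : (Fin n → QQ U X Xr Yr Y Z) × Λ) =>
        (∏ i, GG pU px W (z.1 i) * κ ((c l).1 i) (z.1 i).2.2.1) *
        (D.pow n).ee (c l) (fun i => (z.1 i).2.2.2.1) z.2) B (blk B n _ w, l) := by
    intro w
    unfold Jt
    rw [RL_rl1 heP hτP hloc, Finset.mul_sum]
    refine Finset.sum_congr rfl fun l _ => ?_
    rw [pl_hst hn (fun l i => κ ((c l).1 i)) (fun l => (D.pow n).ee (c l)) (GG pU px W)
      (fun q => q.2.2.1) (fun q => q.2.2.2.1) (ext0 fun t => (w t).2.2.2.1) (ext0 fun t => (w t).2.2.1)]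
    · rw [prod_blk, mul_comm n B, he, hτ]
      rfl
    · intro j i
      have h1 : n * j.1 + i.1 < B * n := by
        have := (finProdFinEquiv (j, i)).2
        rw [finProdFinEquiv_apply_val] at this
        simp only at this
        omega
      rw [blk_apply, ext0, dif_pos h1]
      congr 5
      apply Fin.ext
      rw [finProdFinEquiv_apply_val]; simp only; ring
    · intro j i
      have h1 : n * j.1 + i.1 < B * n := by
        have := (finProdFinEquiv (j, i)).2
        rw [finProdFinEquiv_apply_val] at this
        simp only at this
        omega
      rw [blk_apply, ext0, dif_pos h1]
      congr 4
      apply Fin.ext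
      rw [finProdFinEquiv_apply_val]; simp only; ring
  unfold RD.PS
  rw [← mapK_conc pU px W D κ hk c, ← pl_map, mg_mg]
  rw [← Hn_equiv (blk B n S)]
  congr 1
  funext s
  unfold mg
  simp_rw [hJ]
  rw [Fintype.sum_prod_type, ← (blk B n (QQ U X Xr Yr Y Z)).sum_comp]
  refine Finset.sum_congr rfl fun w _ => ?_
  have hc : ((fun (i : Fin B) => fpow f n fun i_1 => (prj (blk B n (QQ U X Xr Yr Y Z) w i i_1)).2) = blk B n S s) ↔
      sq (fun q : QQ U X Xr Yr Y Z => f (prj q).2) w = s := by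
    rw [← (blk B n S).apply_eq_iff_eq]
    rfl
  by_cases h : sq (fun q : QQ U X Xr Yr Y Z => f (prj q).2) w = s
  · have h' := hc.2 h
    simp only [h, h', if_true]
  · have h' := fun h' => h (hc.1 h')
    rw [if_neg h]
    exact Finset.sum_eq_zero fun l _ => if_neg h'

theorem inner (D : RD V Yr (U × Y × Z) H) {κ : V → Xr → ℝ} (hκ : ∀ v, isP (κ v))
    (hpU : isP pU) (hpx : ∀ u, isP (px u)) (hW : ∀ x, isP (W x))
    (hk : ∀ v, D.k v = mg prj (fun q : QQ U X Xr Yr Y Z => GG pU px W q * κ v q.2.2.1)) {R : ℝ}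
    (hR0 : 0 ≤ R)
    (hR : ∃ (B n L : ℕ) (c : Fin L → (Fin n → V) × (Fin L → Fin n → H)), 0 < B ∧ 0 < n ∧ 0 < L ∧
      (B * n : ℝ) * (R * Real.log 2) < (D.pow n).Sec c B (fpow (fun o => o.2.1) n)
        (fpow (fun o => (o.1, o.2.1)) n) (fpow (fun o => (o.1, o.2.2)) n) (fpow Prod.snd n)) :
    ∀ ε > (0 : ℝ), ∃ (n : ℕ) (enc : ℕ → (Fin n → X) → ℝ)
      (relay : (t : Fin n) → (Fin t.1 → Yr) → (Fin t.1 → Xr) → Xr → ℝ)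
      (dec : (Fin n → Y) → ℕ),
      0 < n ∧
      (∀ m, IsPmf (enc m)) ∧
      (∀ t yp xp, IsPmf (relay t yp xp)) ∧
      (∑' a : ℕ × (Fin n → X) × (Fin n → Xr) × (Fin n → Yr) × (Fin n → Y) × (Fin n → Z),
          relayInduced n (nMsg n R) W enc relay a *
            (if dec a.2.2.2.2.1 = a.1 then 0 else 1)) ≤ ε ∧
      TV
        (pmap (fun a : ℕ × (Fin n → X) × (Fin n → Xr) × (Fin n → Yr) × (Fin n → Y) ×
            (Fin n → Z) => (a.1, a.2.2.2.2.2))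
          (relayInduced n (nMsg n R) W enc relay))
        (fun mz : ℕ × (Fin n → Z) => unifPmf (nMsg n R) mz.1 *
          pmap (fun a : ℕ × (Fin n → X) × (Fin n → Xr) × (Fin n → Yr) × (Fin n → Y) ×
              (Fin n → Z) => a.2.2.2.2.2)
            (relayInduced n (nMsg n R) W enc relay) mz.2) ≤ ε := by
  obtain ⟨B, n, L, c, hB, hn, hL, hlt⟩ := hR
  have : Nonempty (Fin L) := ⟨⟨0, hL⟩⟩
  obtain ⟨relay, hrelay, hPS⟩ := PS_conc pU px W D hκ hk hn B c
  refine outer W hW (Nat.mul_pos hB hn) (WR.isP_pi (fun _ : Fin (B * n) => hpU))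
    (fun u x => ∏ t, px (u t) (x t)) (fun u => WR.isP_pi (fun t => hpx (u t))) relay hrelay hR0 ?_
  rw [info_diff pU px W relay hpx hW hrelay]
  refine lt_of_lt_of_eq (by push_cast; exact hlt) ?_
  unfold RD.Sec
  rw [hPS, hPS, hPS]
  have h4 := hPS (fun o : U × Y × Z => o.2.2)
  have h5 : (fun o : Fin n → U × Y × Z => fpow Prod.snd n (fpow (fun o : U × Y × Z => (o.1, o.2.2)) n o)) =
    fpow (fun o : U × Y × Z => o.2.2) n := rfl
  rw [h5, h4]
  rfl

end conc
end WR

set_option linter.unusedSectionVars false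
namespace WR

lemma mg_right {α β γ : Type*} [Fintype α] [Fintype β] (f : β → γ) (p : α → ℝ) (k : α → β → ℝ) :
    mg (fun x : α × β => (x.1, f x.2)) (fun x => p x.1 * k x.1 x.2) =
      fun x => p x.1 * mg f (k x.1) x.2 := by
  funext ⟨a, c⟩
  unfold mg
  rw [Fintype.sum_prod_type, Finset.sum_eq_single a]
  · simp only [Prod.mk.injEq, true_and]
    rw [Finset.mul_sum]
    refine Finset.sum_congr rfl fun b _ => ?_
    split_ifs <;> simp
  · intro b _ hb
    refine Finset.sum_eq_zero fun c _ => if_neg ?_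
    simp [hb]
  · simp

lemma mg_left' {α β γ : Type*} [Fintype α] [Fintype β] [Fintype γ] (t : α → γ) (p : α → ℝ)
    (k : γ → β → ℝ) :
    mg (fun x : α × β => (t x.1, x.2)) (fun x => p x.1 * k (t x.1) x.2) =
      fun x => mg t p x.1 * k x.1 x.2 := by
  funext ⟨c, b⟩
  unfold mg
  rw [Fintype.sum_prod_type, Finset.sum_mul]
  refine Finset.sum_congr rfl fun a _ => ?_
  rw [Finset.sum_eq_single b]
  · simp only [Prod.mk.injEq, and_true]
    by_cases h : t a = c
    · simp [h]
    · simp [h]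
  · intro b' _ hb
    refine if_neg ?_
    simp [hb]
  · simp

lemma Hn_mg_congr {α β γ : Type*} [Fintype α] [Fintype β] [Fintype γ] (p : α → ℝ) (f : α → β)
    (g : α → γ) (h : ∀ a b, f a = f b ↔ g a = g b) : Hn (mg f p) = Hn (mg g p) := by
  rw [Hn_mg_eq, Hn_mg_eq]
  congr 1
  refine Finset.sum_congr rfl fun a _ => ?_
  congr 2
  unfold mg
  refine Finset.sum_congr rfl fun b _ => ?_
  by_cases h' : f b = f a
  · rw [if_pos h', if_pos ((h b a).1 h')]
  · rw [if_neg h', if_neg (fun h2 => h' ((h b a).2 h2))]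

lemma cond_ent {α β Ω : Type*} [Fintype α] [Fintype β] [Fintype Ω] (p : α → ℝ) (k : α → β → ℝ)
    (hk : ∀ a, isP (k a)) (F : Ω → α) (G : Ω → β) (N : Ω → ℝ)
    (h : (fun x : α × β => p x.1 * k x.1 x.2) = mg (fun n => (F n, G n)) N) :
    p = mg F N ∧ ∑ a, p a * Hn (k a) = Hn (mg (fun n => (F n, G n)) N) - Hn (mg F N) := by
  have h1 : p = mg F N := by
    have := congrArg (mg Prod.fst) h
    rw [mg_mg] at this
    rw [← this]
    funext a
    rw [mg_fst]
    simp [← Finset.mul_sum, (hk a).2]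
  refine ⟨h1, ?_⟩
  rw [← h, Hn_chain p k (fun a _ => (hk a).2), ← h1]
  ring

lemma mk_ent {α β γ : Type*} [Fintype α] [Fintype β] [Fintype γ] (p : α → ℝ) (k : β → γ → ℝ)
    (hk : ∀ a, isP (k a)) (t : α → β) :
    Hn (fun x : α × γ => p x.1 * k (t x.1) x.2) - Hn p = ∑ b, mg t p b * Hn (k b) := by
  rw [Hn_chain p (fun a => k (t a)) (fun a _ => (hk _).2), sum_mg_mul]
  ring

section single
variable {X Xr Yr Y Z U V H : Type} [Fintype X] [Fintype Xr] [Fintype Yr] [Fintype Y] [Fintype Z]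
  [Fintype U] [Fintype V] [Fintype H]

section rdq
variable {O S : Type} [Fintype O] [Fintype S]

/-- joint law of `((v, yr, o), h)` -/
def RD.NN (D : RD V Yr O H) (q : V × Yr → H → ℝ) (x : (V × Yr × O) × H) : ℝ :=
  D.pV x.1.1 * D.k x.1.1 x.1.2 * q (x.1.1, x.1.2.1) x.2

variable (D : RD V Yr O H) {q : V × Yr → H → ℝ}

def eqA : ((V × H) × O) × Yr ≃ (V × Yr × O) × H where
  toFun p := ((p.1.1.1, p.2, p.1.2), p.1.1.2)
  invFun p := (((p.1.1, p.2), p.1.2.2), p.1.2.1)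
  left_inv _ := rfl
  right_inv _ := rfl

def eqB : ((V × H) × Yr) × O ≃ (V × Yr × O) × H where
  toFun p := ((p.1.1.1, p.1.2, p.2), p.1.1.2)
  invFun p := (((p.1.1, p.2), p.1.2.1), p.1.2.2)
  left_inv _ := rfl
  right_inv _ := rfl

lemma RD.C1 (hgr : ∀ v h yr, D.g v h * D.r v h yr = D.a v yr * q (v, yr) h)
    : (fun x : (V × H) × O => D.pVH x.1 * D.vk x.1.1 x.1.2 x.2) =
    mg (fun n : (V × Yr × O) × H => ((n.1.1, n.2), n.1.2.2)) (D.NN q) := by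
  funext ⟨⟨v, h⟩, o⟩
  rw [mg_eq_sum eqA (fun _ => rfl)]
  unfold RD.vk RD.pVH
  rw [Finset.mul_sum]
  refine Finset.sum_congr rfl fun yr _ => ?_
  simp only [RD.NN, eqA, Equiv.coe_fn_mk]
  have := hgr v h yr
  by_cases ha : D.a v yr = 0
  · rw [D.k_zero ha]; simp
  · rw [show D.pV v * D.g v h * (D.k v (yr, o) / D.a v yr * D.r v h yr) =
      D.pV v * D.k v (yr, o) / D.a v yr * (D.g v h * D.r v h yr) by ring, this]
    field_simp

lemma RD.C1f (hgr : ∀ v h yr, D.g v h * D.r v h yr = D.a v yr * q (v, yr) h)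
    (f : O → S) : (fun x : (V × H) × S => D.pVH x.1 * D.vS f x.1.1 x.1.2 x.2) =
    mg (fun n : (V × Yr × O) × H => ((n.1.1, n.2), f n.1.2.2)) (D.NN q) := by
  have h1 := mg_right f D.pVH (fun x => D.vk x.1 x.2)
  rw [D.C1 hgr, mg_mg] at h1
  rw [h1]; rfl

lemma RD.C2 (hgr : ∀ v h yr, D.g v h * D.r v h yr = D.a v yr * q (v, yr) h)
    : (fun x : (V × H) × Yr => D.pVH x.1 * D.r x.1.1 x.1.2 x.2) =
    mg (fun n : (V × Yr × O) × H => ((n.1.1, n.2), n.1.2.1)) (D.NN q) := by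
  funext ⟨⟨v, h⟩, yr⟩
  rw [mg_eq_sum eqB (fun _ => rfl)]
  simp only [RD.NN, eqB, Equiv.coe_fn_mk, RD.pVH]
  rw [mul_assoc, hgr]
  unfold RD.a
  rw [Finset.sum_mul, Finset.mul_sum]
  refine Finset.sum_congr rfl fun o _ => ?_
  ring

lemma RD.NNfst (hq : ∀ x, isP (q x))
    : mg Prod.fst (D.NN q) = fun x => D.pV x.1 * D.k x.1 x.2 := by
  funext x
  rw [mg_fst]
  simp only [RD.NN]
  rw [← Finset.mul_sum, (hq _).2, mul_one]

lemma RD.C3 (hq : ∀ x, isP (q x))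
    (f : Yr × O → S) : (fun x : V × S => D.pV x.1 * mg f (D.k x.1) x.2) =
    mg (fun n : (V × Yr × O) × H => (n.1.1, f n.1.2)) (D.NN q) := by
  rw [← mg_right, ← D.NNfst hq, mg_mg]

lemma RD.Iq_eq (hq : ∀ x, isP (q x)) (hgr : ∀ v h yr, D.g v h * D.r v h yr = D.a v yr * q (v, yr) h)
    : D.Iq = Hn (mg (fun n : (V × Yr × O) × H => (n.1.1, n.1.2.1)) (D.NN q)) -
    Hn (mg (fun n : (V × Yr × O) × H => n.1.1) (D.NN q)) -
    Hn (mg (fun n : (V × Yr × O) × H => ((n.1.1, n.2), n.1.2.1)) (D.NN q)) +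
    Hn (mg (fun n : (V × Yr × O) × H => (n.1.1, n.2)) (D.NN q)) := by
  have h2 := (cond_ent D.pVH (fun x => D.r x.1 x.2) (fun x => D.hr _ _) _ _ _ (D.C2 hgr)).2
  have ha : ∀ v, D.a v = mg Prod.fst (D.k v) := fun v => by funext y; rw [mg_fst]; rfl
  have h3 := (cond_ent D.pV (fun v => mg Prod.fst (D.k v)) (fun v => (D.hk v).mg _) _ _ _
    (D.C3 hq Prod.fst)).2
  have e1 : D.Iq = (∑ v, D.pV v * Hn (D.a v)) - ∑ x, D.pVH x * Hn (D.r x.1 x.2) := by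
    unfold RD.Iq
    simp_rw [mul_sub]
    rw [Finset.sum_sub_distrib]
    have t1 : ∑ x : (V × H) × Yr, D.pVH x.1 * D.r x.1.1 x.1.2 x.2 * Real.log (D.r x.1.1 x.1.2 x.2) =
        - ∑ x, D.pVH x * Hn (D.r x.1 x.2) := by
      rw [Fintype.sum_prod_type, ← Finset.sum_neg_distrib]
      refine Finset.sum_congr rfl fun x _ => ?_
      unfold Hn Real.negMulLog
      rw [Finset.mul_sum, ← Finset.sum_neg_distrib]
      refine Finset.sum_congr rfl fun y _ => by ring
    have t2 : ∑ x : (V × H) × Yr, D.pVH x.1 * D.r x.1.1 x.1.2 x.2 * Real.log (D.a x.1.1 x.2) =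
        - ∑ v, D.pV v * Hn (D.a v) := by
      rw [Fintype.sum_prod_type, Fintype.sum_prod_type, ← Finset.sum_neg_distrib]
      refine Finset.sum_congr rfl fun v _ => ?_
      unfold Hn Real.negMulLog
      rw [Finset.sum_comm, Finset.mul_sum, ← Finset.sum_neg_distrib]
      refine Finset.sum_congr rfl fun y _ => ?_
      simp only [RD.pVH]
      have hc : ∑ h, D.g v h * D.r v h y = D.a v y := D.cons v y
      rw [← Finset.sum_mul]
      simp_rw [mul_assoc]
      rw [← Finset.mul_sum, hc]
      ring
    rw [t1, t2]; ring
  rw [e1]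
  simp_rw [ha]
  rw [h2, h3]
  ring

lemma RD.hS_eq (hgr : ∀ v h yr, D.g v h * D.r v h yr = D.a v yr * q (v, yr) h)
    (f : O → S) : D.hS f =
    Hn (mg (fun n : (V × Yr × O) × H => ((n.1.1, n.2), f n.1.2.2)) (D.NN q)) -
    Hn (mg (fun n : (V × Yr × O) × H => (n.1.1, n.2)) (D.NN q)) :=
  (cond_ent D.pVH (fun x => D.vS f x.1 x.2) (fun x => D.isP_vS f _ _) _ _ _ (D.C1f hgr f)).2

lemma RD.pS_eq (hgr : ∀ v h yr, D.g v h * D.r v h yr = D.a v yr * q (v, yr) h)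
    (f : O → S) : D.pS f = mg (fun n : (V × Yr × O) × H => f n.1.2.2) (D.NN q) := by
  have h := congrArg (mg Prod.snd) (D.C1f hgr f)
  rw [mg_mg] at h
  rw [← h]
  funext s
  rw [mg_snd]
  rfl

lemma RD.bt_eq (f : O → S) : D.bt f = Hn (D.pS f) - D.hS f := rfl

lemma RD.markov (hq : ∀ x, isP (q x))
    (f : O → S) :
    Hn (mg (fun n : (V × Yr × O) × H => ((n.1.1, n.1.2.1, f n.1.2.2), n.2)) (D.NN q)) -
    Hn (mg (fun n : (V × Yr × O) × H => (n.1.1, n.1.2.1, f n.1.2.2)) (D.NN q)) =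
    Hn (mg (fun n : (V × Yr × O) × H => ((n.1.1, n.1.2.1), n.2)) (D.NN q)) -
    Hn (mg (fun n : (V × Yr × O) × H => (n.1.1, n.1.2.1)) (D.NN q)) := by
  have hN : D.NN q = fun x => mg Prod.fst (D.NN q) x.1 * q (x.1.1, x.1.2.1) x.2 := by
    rw [D.NNfst hq]; rfl
  have a1 := mg_left' (fun x : V × Yr × O => (x.1, x.2.1, f x.2.2)) (mg Prod.fst (D.NN q))
    (fun s => q (s.1, s.2.1))
  have a2 := mg_left' (fun x : V × Yr × O => (x.1, x.2.1)) (mg Prod.fst (D.NN q)) q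
  have b1 := mk_ent (mg (fun x : V × Yr × O => (x.1, x.2.1, f x.2.2)) (mg Prod.fst (D.NN q))) q hq
    (fun s => (s.1, s.2.1))
  have b2 := mk_ent (mg (fun x : V × Yr × O => (x.1, x.2.1)) (mg Prod.fst (D.NN q))) q hq
    (fun s => s)
  simp only at a1 a2
  rw [← hN] at a1 a2
  rw [← a1, mg_mg, mg_mg] at b1
  rw [← a2, mg_mg, mg_mg] at b2
  rw [b1, b2]

end rdq

end single
end WR

set_option linter.unusedSectionVars false
namespace WR

lemma pmap_eq {α β : Type*} [Fintype α] (f : α → β) (p : α → ℝ) : pmap f p = mg f p := by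
  funext b; unfold pmap mg; rw [tsum_fintype]

lemma H2_eq {α : Type*} [Fintype α] (p : α → ℝ) : H2 p = Hn p / Real.log 2 := by
  unfold H2 Hn Real.negMulLog Real.logb
  rw [tsum_fintype, Finset.sum_div]
  refine Finset.sum_congr rfl fun a _ => by ring

lemma disint {α β : Type*} [Fintype α] [Fintype β] {p : α × β → ℝ} (hp : isP p) {d : β → ℝ}
    (hd : isP d) : ∃ (pa : α → ℝ) (k : α → β → ℝ), isP pa ∧ (∀ a, isP (k a)) ∧
      (∀ a b, p (a, b) = pa a * k a b) ∧ ∀ a b, k a b = p (a, b) / pa a ∨ k a b = d b := by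
  have hm := hp.mg Prod.fst
  refine ⟨mg Prod.fst p, fun a b => if mg Prod.fst p a = 0 then d b else p (a, b) / mg Prod.fst p a,
    hm, ?_, ?_, ?_⟩
  · intro a
    by_cases h : mg Prod.fst p a = 0
    · simp only [h, if_true]; exact hd
    · simp only [h, if_false]
      refine ⟨fun b => div_nonneg (hp.1 _) (hm.1 _), ?_⟩
      rw [← Finset.sum_div, ← mg_fst, div_self h]
  · intro a b
    by_cases h : mg Prod.fst p a = 0
    · simp only [h, zero_mul]
      have := le_mg hp.1 Prod.fst (a, b)
      simp only [h] at this
      exact le_antisymm this (hp.1 _)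
    · simp only [h, if_false]; field_simp
  · intro a b
    by_cases h : mg Prod.fst p a = 0
    · simp [h]
    · simp [h]

section fin
variable {X Xr Yr Y Z U V H : Type} [Fintype X] [Fintype Xr] [Fintype Yr] [Fintype Y] [Fintype Z]
  [Fintype U] [Fintype V] [Fintype H]

lemma isP_GG {pU : U → ℝ} {px : U → X → ℝ} {W : X × Xr → Yr × Y × Z → ℝ} {κ : Xr → ℝ}
    (hκ : isP κ) (hpU : isP pU) (hpx : ∀ u, isP (px u)) (hW : ∀ x, isP (W x)) :
    isP (fun q : QQ U X Xr Yr Y Z => GG pU px W q * κ q.2.2.1) ∧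
      mg (fun q : QQ U X Xr Yr Y Z => q.1) (fun q => GG pU px W q * κ q.2.2.1) = pU := by
  have h1 : mg (fun q : QQ U X Xr Yr Y Z => q.1) (fun q => GG pU px W q * κ q.2.2.1) = pU := by
    funext u
    refine (mg_fst _ u).trans ?_
    rw [Fintype.sum_prod_type]
    simp_rw [Fintype.sum_prod_type (α₁ := Xr)]
    simp only [GG]
    have : ∀ x xr, ∑ o : Yr × Y × Z, pU u * px u x * W (x, xr) o * κ xr = pU u * px u x * κ xr := by
      intro x xr
      rw [← Finset.sum_mul, ← Finset.mul_sum, (hW _).2, mul_one]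
    simp_rw [this, ← Finset.mul_sum, hκ.2, mul_one, ← Finset.mul_sum, (hpx _).2, mul_one]
  refine ⟨⟨fun q => mul_nonneg (mul_nonneg (mul_nonneg (hpU.1 _) ((hpx _).1 _)) ((hW _).1 _)) (hκ.1 _), ?_⟩, h1⟩
  rw [← sum_mg (fun q : QQ U X Xr Yr Y Z => q.1), h1, hpU.2]

lemma exists_RD {pU : U → ℝ} {px : U → X → ℝ} {W : X × Xr → Yr × Y × Z → ℝ} {κ : V → Xr → ℝ}
    {pV : V → ℝ} {q : V × Yr → H → ℝ} (hpV : isP pV) (hq : ∀ x, isP (q x))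
    (hκ : ∀ v, isP (κ v)) (hpU : isP pU) (hpx : ∀ u, isP (px u)) (hW : ∀ x, isP (W x)) :
    ∃ D : RD V Yr (U × Y × Z) H, D.pV = pV ∧
      (∀ v, D.k v = mg prj (fun q : QQ U X Xr Yr Y Z => GG pU px W q * κ v q.2.2.1)) ∧
      (∀ v h yr, D.g v h * D.r v h yr = D.a v yr * q (v, yr) h) := by
  have hk : ∀ v, isP (mg prj (fun q : QQ U X Xr Yr Y Z => GG pU px W q * κ v q.2.2.1)) := fun v =>
    (isP_GG (hκ v) hpU hpx hW).1.mg _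
  obtain ⟨k, hkd⟩ : ∃ k : V → Yr × (U × Y × Z) → ℝ, k = fun v => mg prj (fun q : QQ U X Xr Yr Y Z => GG pU px W q * κ v q.2.2.1) := ⟨_, rfl⟩
  have hk' : ∀ v, isP (k v) := fun v => by rw [hkd]; exact hk v
  have ha : ∀ v, isP (fun yr => ∑ o, k v (yr, o)) := fun v =>
    ⟨fun y => Finset.sum_nonneg fun o _ => (hk' v).1 _, by rw [← (hk' v).2, Fintype.sum_prod_type]⟩
  have hj : ∀ v, isP (fun x : H × Yr => (∑ o, k v (x.2, o)) * q (v, x.2) x.1) := fun v =>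
    ⟨fun x => mul_nonneg ((ha v).1 _) ((hq _).1 _), by
      rw [Fintype.sum_prod_type_right]
      simp only [← Finset.mul_sum, (hq _).2, mul_one]
      exact (ha v).2⟩
  choose g r hg hr hgr hdis using fun v => disint (hj v) (ha v)
  refine ⟨⟨pV, k, g, r, hpV, hk', hg, hr, ?_, ?_⟩, rfl, fun v => congrFun hkd v, fun v h yr => (hgr v h yr).symm⟩
  · intro v yr
    simp_rw [← hgr]
    rw [← Finset.mul_sum, (hq _).2, mul_one]
  · intro v h yr h0
    rcases hdis v h yr with h1 | h1
    · rw [h1, h0]; simp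
    · rw [h1, h0]

def eqP : ((V × Yr × U × Y × Z) × H) × (X × Xr) ≃ U × X × V × Xr × Yr × Y × Z × H where
  toFun p := (p.1.1.2.2.1, p.2.1, p.1.1.1, p.2.2, p.1.1.2.1, p.1.1.2.2.2.1, p.1.1.2.2.2.2, p.1.2)
  invFun a := (((a.2.2.1, a.2.2.2.2.1, a.1, a.2.2.2.2.2.1, a.2.2.2.2.2.2.1), a.2.2.2.2.2.2.2), (a.2.1, a.2.2.2.1))
  left_inv _ := rfl
  right_inv _ := rfl

def eqK : (Yr × U × Y × Z) × (X × Xr) ≃ QQ U X Xr Yr Y Z where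
  toFun p := (p.1.2.1, p.2.1, p.2.2, p.1.1, p.1.2.2)
  invFun a := ((a.2.2.2.1, a.1, a.2.2.2.2), (a.2.1, a.2.2.1))
  left_inv _ := rfl
  right_inv _ := rfl

def pN (a : U × X × V × Xr × Yr × Y × Z × H) : (V × Yr × U × Y × Z) × H :=
  ((a.2.2.1, a.2.2.2.2.1, a.1, a.2.2.2.2.2.1, a.2.2.2.2.2.2.1), a.2.2.2.2.2.2.2)

lemma NN_eq {pU : U → ℝ} {px : U → X → ℝ} {W : X × Xr → Yr × Y × Z → ℝ} {κ : V → Xr → ℝ}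
    {pV : V → ℝ} {q : V × Yr → H → ℝ} {p₁ : U × X → ℝ} {p₂ : V × Xr → ℝ}
    (h₁ : ∀ u x, p₁ (u, x) = pU u * px u x) (h₂ : ∀ v x, p₂ (v, x) = pV v * κ v x)
    (D : RD V Yr (U × Y × Z) H) (hV : D.pV = pV)
    (hk : ∀ v, D.k v = mg prj (fun q : QQ U X Xr Yr Y Z => GG pU px W q * κ v q.2.2.1)) :
    D.NN q = mg pN (relayJoint p₁ p₂ W q) := by
  funext n
  rw [mg_eq_sum eqP (fun _ => rfl)]
  unfold RD.NN
  rw [hk, mg_eq_sum eqK (fun _ => rfl), Finset.mul_sum, Finset.sum_mul, hV]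
  refine Finset.sum_congr rfl fun c _ => ?_
  simp only [relayJoint, eqP, eqK, Equiv.coe_fn_mk, GG, h₁, h₂]
  ring

end fin
end WR

set_option linter.unusedSectionVars false
namespace WR

section fin2
variable {X Xr Yr Y Z U V H : Type} [Fintype X] [Fintype Xr] [Fintype Yr] [Fintype Y] [Fintype Z]
  [Fintype U] [Fintype V] [Fintype H]

theorem rates {pU : U → ℝ} {px : U → X → ℝ} {W : X × Xr → Yr × Y × Z → ℝ} {κ : V → Xr → ℝ}
    {pV : V → ℝ} {q : V × Yr → H → ℝ} {p₁ : U × X → ℝ} {p₂ : V × Xr → ℝ}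
    (hpU : isP pU) (hpx : ∀ u, isP (px u)) (hW : ∀ x, isP (W x)) (hκ : ∀ v, isP (κ v))
    (hq : ∀ x, isP (q x))
    (h₁ : ∀ u x, p₁ (u, x) = pU u * px u x) (h₂ : ∀ v x, p₂ (v, x) = pV v * κ v x)
    (D : RD V Yr (U × Y × Z) H) (hV : D.pV = pV)
    (hk : ∀ v, D.k v = mg prj (fun q : QQ U X Xr Yr Y Z => GG pU px W q * κ v q.2.2.1))
    (hgr : ∀ v h yr, D.g v h * D.r v h yr = D.a v yr * q (v, yr) h) :
    ∃ hu : ℝ,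
      RBCY p₁ p₂ W q * Real.log 2 = hu + D.hS (fun o => o.2.1) - D.hS (fun o => (o.1, o.2.1)) ∧
      RBCZ p₁ p₂ W q * Real.log 2 = hu + D.hS (fun o => o.2.2) - D.hS (fun o => (o.1, o.2.2)) ∧
      RMACY p₁ p₂ W q * Real.log 2 = hu + Hn (D.pS fun o => o.2.1) - D.hS (fun o => (o.1, o.2.1)) - D.Iq ∧
      RMACZ p₁ p₂ W q * Real.log 2 = hu + Hn (D.pS fun o => o.2.2) - D.hS (fun o => (o.1, o.2.2)) - D.Iq ∧
      IUZ p₁ p₂ W q * Real.log 2 = hu + Hn (D.pS fun o => o.2.2) - Hn (D.pS fun o => (o.1, o.2.2)) := by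
  have hl : Real.log 2 ≠ 0 := (Real.log_pos (by norm_num)).ne'
  have hN := NN_eq (q := q) h₁ h₂ D hV hk
  obtain ⟨P, hP⟩ : ∃ P, P = relayJoint p₁ p₂ W q := ⟨_, rfl⟩
  have hi : Hn (mg (fun a => (a.2.2.1, a.1)) P) = Hn (mg (fun a => a.1) P) + Hn (mg (fun a => a.2.2.1) P) := by
    have h3 : (fun x : V × U => D.pV x.1 * (fun _ => pU) x.1 x.2) = _ :=
      Eq.trans (by
        funext x
        rw [hk, mg_mg]
        exact congrArg (fun s => D.pV x.1 * s x.2) (isP_GG (hκ x.1) hpU hpx hW).2.symm)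
        (D.C3 hq (fun x : Yr × (U × Y × Z) => x.2.1))
    have h4 := cond_ent D.pV (fun _ => pU) (fun _ => hpU) _ _ _ h3
    have h5 : pU = mg (fun n : (V × Yr × U × Y × Z) × H => n.1.2.2.1) (D.NN q) := by
      have := congrArg (mg Prod.snd) h3
      rw [mg_mg] at this
      rw [← this]
      funext u
      rw [mg_snd]
      simp [← Finset.sum_mul, D.hpV.2]
    have h6 := h4.2
    rw [← Finset.sum_mul, D.hpV.2, one_mul] at h6
    rw [h5, hN, mg_mg, mg_mg, mg_mg, ← hP] at h6
    simp only [pN] at h6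
    linarith
  have mY := D.markov hq (fun o : U × Y × Z => (o.1, o.2.1))
  have mZ := D.markov hq (fun o : U × Y × Z => (o.1, o.2.2))
  have iq := D.Iq_eq hq hgr
  have s1 := D.hS_eq hgr (fun o : U × Y × Z => o.2.1)
  have s2 := D.hS_eq hgr (fun o : U × Y × Z => (o.1, o.2.1))
  have s3 := D.hS_eq hgr (fun o : U × Y × Z => o.2.2)
  have s4 := D.hS_eq hgr (fun o : U × Y × Z => (o.1, o.2.2))
  rw [D.pS_eq hgr, D.pS_eq hgr, D.pS_eq hgr]
  rw [hN, ← hP] at mY mZ iq s1 s2 s3 s4 ⊢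
  simp only [mg_mg, pN] at mY mZ iq s1 s2 s3 s4 ⊢
  have e1 := Hn_mg_congr P (fun a => (a.1, a.2.2.1)) (fun a => (a.2.2.1, a.1))
    (by intro a b; simp only [Prod.mk.injEq]; tauto)
  have e2 := Hn_mg_congr P (fun a => ((a.2.2.1, a.2.2.2.2.1), a.2.2.2.2.2.2.2)) (fun a => ((a.2.2.1, a.2.2.2.2.2.2.2), a.2.2.2.2.1))
    (by intro a b; simp only [Prod.mk.injEq]; tauto)
  have e3 := Hn_mg_congr P (fun a => ((a.2.2.2.2.2.1, a.2.2.2.2.2.2.2), a.2.2.1)) (fun a => ((a.2.2.1, a.2.2.2.2.2.2.2), a.2.2.2.2.2.1))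
    (by intro a b; simp only [Prod.mk.injEq]; tauto)
  have e4 := Hn_mg_congr P (fun a => (a.1, (a.2.2.2.2.2.1, a.2.2.2.2.2.2.2), a.2.2.1)) (fun a => ((a.2.2.1, a.2.2.2.2.2.2.2), a.1, a.2.2.2.2.2.1))
    (by intro a b; simp only [Prod.mk.injEq]; tauto)
  have e5 := Hn_mg_congr P (fun a => (a.2.2.2.2.1, a.1, a.2.2.1, a.2.2.2.2.2.1)) (fun a => (a.2.2.1, a.2.2.2.2.1, a.1, a.2.2.2.2.2.1))
    (by intro a b; simp only [Prod.mk.injEq]; tauto)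
  have e6 := Hn_mg_congr P (fun a => (a.2.2.2.2.2.2.2, a.1, a.2.2.1, a.2.2.2.2.2.1)) (fun a => ((a.2.2.1, a.2.2.2.2.2.2.2), a.1, a.2.2.2.2.2.1))
    (by intro a b; simp only [Prod.mk.injEq]; tauto)
  have e7 := Hn_mg_congr P (fun a => (a.2.2.2.2.1, a.2.2.2.2.2.2.2, a.1, a.2.2.1, a.2.2.2.2.2.1)) (fun a => ((a.2.2.1, a.2.2.2.2.1, a.1, a.2.2.2.2.2.1), a.2.2.2.2.2.2.2))
    (by intro a b; simp only [Prod.mk.injEq]; tauto)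
  have e8 := Hn_mg_congr P (fun a => ((a.1, a.2.2.1), a.2.2.2.2.2.1)) (fun a => (a.1, a.2.2.1, a.2.2.2.2.2.1))
    (by intro a b; simp only [Prod.mk.injEq]; tauto)
  have e9 := Hn_mg_congr P (fun a => ((a.2.2.2.2.2.2.1, a.2.2.2.2.2.2.2), a.2.2.1)) (fun a => ((a.2.2.1, a.2.2.2.2.2.2.2), a.2.2.2.2.2.2.1))
    (by intro a b; simp only [Prod.mk.injEq]; tauto)
  have e10 := Hn_mg_congr P (fun a => (a.1, (a.2.2.2.2.2.2.1, a.2.2.2.2.2.2.2), a.2.2.1)) (fun a => ((a.2.2.1, a.2.2.2.2.2.2.2), a.1, a.2.2.2.2.2.2.1))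
    (by intro a b; simp only [Prod.mk.injEq]; tauto)
  have e11 := Hn_mg_congr P (fun a => (a.2.2.2.2.1, a.1, a.2.2.1, a.2.2.2.2.2.2.1)) (fun a => (a.2.2.1, a.2.2.2.2.1, a.1, a.2.2.2.2.2.2.1))
    (by intro a b; simp only [Prod.mk.injEq]; tauto)
  have e12 := Hn_mg_congr P (fun a => (a.2.2.2.2.2.2.2, a.1, a.2.2.1, a.2.2.2.2.2.2.1)) (fun a => ((a.2.2.1, a.2.2.2.2.2.2.2), a.1, a.2.2.2.2.2.2.1))
    (by intro a b; simp only [Prod.mk.injEq]; tauto)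
  have e13 := Hn_mg_congr P (fun a => (a.2.2.2.2.1, a.2.2.2.2.2.2.2, a.1, a.2.2.1, a.2.2.2.2.2.2.1)) (fun a => ((a.2.2.1, a.2.2.2.2.1, a.1, a.2.2.2.2.2.2.1), a.2.2.2.2.2.2.2))
    (by intro a b; simp only [Prod.mk.injEq]; tauto)
  have e14 := Hn_mg_congr P (fun a => ((a.1, a.2.2.1), a.2.2.2.2.2.2.1)) (fun a => (a.1, a.2.2.1, a.2.2.2.2.2.2.1))
    (by intro a b; simp only [Prod.mk.injEq]; tauto)
  refine ⟨Hn (mg (fun a => a.1) P), ?_, ?_, ?_, ?_, ?_⟩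
  · unfold RBCY CMI
    simp only [pmap_eq, H2_eq, mg_mg, ← hP]
    simp only [sub_mul, add_mul, div_mul_cancel₀ _ hl]
    linarith
  · unfold RBCZ CMI
    simp only [pmap_eq, H2_eq, mg_mg, ← hP]
    simp only [sub_mul, add_mul, div_mul_cancel₀ _ hl]
    linarith
  · unfold RMACY MI CMI
    simp only [pmap_eq, H2_eq, mg_mg, ← hP]
    simp only [sub_mul, add_mul, div_mul_cancel₀ _ hl]
    linarith
  · unfold RMACZ MI CMI
    simp only [pmap_eq, H2_eq, mg_mg, ← hP]
    simp only [sub_mul, add_mul, div_mul_cancel₀ _ hl]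
    linarith
  · unfold IUZ MI
    simp only [pmap_eq, H2_eq, mg_mg, ← hP]
    simp only [sub_mul, add_mul, div_mul_cancel₀ _ hl]

end fin2
end WR

theorem WR.exists_isP (α : Type*) [Fintype α] [Nonempty α] : ∃ d : α → ℝ, WR.isP d := by
  refine ⟨fun a => if a = Classical.arbitrary α then 1 else 0, fun a => ?_, by simp⟩
  dsimp only
  split_ifs <;> norm_num

/-- Strong-secrecy lower bound for the wiretap relay channel (noisy network
coding with an eavesdropper).  For every single-letter pmf of the factored form
`p(u,x) p(u_r,x_r) W(y_r,y,z|x,x_r) q(ŷ_r|u_r,y_r)` and every rate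
`0 ≤ R < max{R_NNC − R_BC-Z, min{R_NNC − I(U;Z), R_MAC-Y − R_MAC-Z}}`, the rate `R` is an
achievable strong-secrecy rate; hence the strong secrecy capacity `C_s` is at least the
supremum of these quantities over all such pmfs. -/
theorem wiretap_relay_nnc_achievability
    {𝒳 𝒳r 𝒴r 𝒴 𝒵 𝒰 𝒰r 𝒴h : Type}
    [Fintype 𝒳] [Fintype 𝒳r] [Fintype 𝒴r] [Fintype 𝒴] [Fintype 𝒵]
    [Fintype 𝒰] [Fintype 𝒰r] [Fintype 𝒴h]
    [Nonempty 𝒳] [Nonempty 𝒳r] [Nonempty 𝒴r] [Nonempty 𝒴] [Nonempty 𝒵]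
    (W : 𝒳 × 𝒳r → 𝒴r × 𝒴 × 𝒵 → ℝ) (hW : ∀ x, IsPmf (W x))
    (p₁ : 𝒰 × 𝒳 → ℝ) (hp₁ : IsPmf p₁)
    (p₂ : 𝒰r × 𝒳r → ℝ) (hp₂ : IsPmf p₂)
    (q : 𝒰r × 𝒴r → 𝒴h → ℝ) (hq : ∀ a, IsPmf (q a))
    (R : ℝ) (hR0 : 0 ≤ R)
    (hR : R < max
      (RNNC p₁ p₂ W q - RBCZ p₁ p₂ W q)
      (min (RNNC p₁ p₂ W q - IUZ p₁ p₂ W q) (RMACY p₁ p₂ W q - RMACZ p₁ p₂ W q))) :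
    ∀ ε > (0 : ℝ), ∃ (n : ℕ) (enc : ℕ → (Fin n → 𝒳) → ℝ)
      (relay : (t : Fin n) → (Fin t.1 → 𝒴r) → (Fin t.1 → 𝒳r) → 𝒳r → ℝ)
      (dec : (Fin n → 𝒴) → ℕ),
      0 < n ∧
      (∀ m, IsPmf (enc m)) ∧
      (∀ t yp xp, IsPmf (relay t yp xp)) ∧
      (∑' a : ℕ × (Fin n → 𝒳) × (Fin n → 𝒳r) × (Fin n → 𝒴r) × (Fin n → 𝒴) × (Fin n → 𝒵),
          relayInduced n (nMsg n R) W enc relay a *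
            (if dec a.2.2.2.2.1 = a.1 then 0 else 1)) ≤ ε ∧
      TV
        (pmap (fun a : ℕ × (Fin n → 𝒳) × (Fin n → 𝒳r) × (Fin n → 𝒴r) × (Fin n → 𝒴) ×
            (Fin n → 𝒵) => (a.1, a.2.2.2.2.2))
          (relayInduced n (nMsg n R) W enc relay))
        (fun mz : ℕ × (Fin n → 𝒵) => unifPmf (nMsg n R) mz.1 *
          pmap (fun a : ℕ × (Fin n → 𝒳) × (Fin n → 𝒳r) × (Fin n → 𝒴r) × (Fin n → 𝒴) ×
              (Fin n → 𝒵) => a.2.2.2.2.2)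
            (relayInduced n (nMsg n R) W enc relay) mz.2) ≤ ε := by
  have hp₁' := WR.isP_iff.1 hp₁
  have hp₂' := WR.isP_iff.1 hp₂
  obtain ⟨d₁, hd₁⟩ := WR.exists_isP 𝒳
  obtain ⟨d₂, hd₂⟩ := WR.exists_isP 𝒳r
  obtain ⟨pU, px, hpU, hpx, h₁, -⟩ := WR.disint hp₁' hd₁
  obtain ⟨pV, κ, hpV, hκ, h₂, -⟩ := WR.disint hp₂' hd₂
  have hW' : ∀ x, WR.isP (W x) := fun x => WR.isP_iff.1 (hW x)
  have hq' : ∀ x, WR.isP (q x) := fun x => WR.isP_iff.1 (hq x)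
  obtain ⟨D, hV, hk, hgr⟩ := WR.exists_RD hpV hq' hκ hpU hpx hW'
  obtain ⟨hu, r1, r2, r3, r4, r5⟩ := WR.rates hpU hpx hW' hκ hq' h₁ h₂ D hV hk hgr
  have hl : 0 < Real.log 2 := Real.log_pos (by norm_num)
  refine WR.inner pU px W D hκ hpU hpx hW' hk hR0 ?_
  have b1 := D.bt_eq (fun o : 𝒰 × 𝒴 × 𝒵 => o.2.1)
  have b2 := D.bt_eq (fun o : 𝒰 × 𝒴 × 𝒵 => (o.1, o.2.2))
  unfold RNNC at hR
  rcases lt_max_iff.1 hR with hR | hR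
  · have k1 := lt_of_lt_of_le hR (sub_le_sub_right (min_le_left _ _) _)
    have k2 := lt_of_lt_of_le hR (sub_le_sub_right (min_le_right _ _) _)
    have k1 := mul_lt_mul_of_pos_right k1 hl
    have k2 := mul_lt_mul_of_pos_right k2 hl
    rw [sub_mul] at k1 k2
    refine D.asym1 (fun o => o.2.1) (fun o => (o.1, o.2.1)) (fun o => (o.1, o.2.2)) Prod.snd ?_
    refine lt_sub_comm.1 (max_lt ?_ ?_)
    · linarith
    · rw [b1]; linarith
  · obtain ⟨hR, k3⟩ := lt_min_iff.1 hR
    have k1 := lt_of_lt_of_le hR (sub_le_sub_right (min_le_left _ _) _)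
    have k2 := lt_of_lt_of_le hR (sub_le_sub_right (min_le_right _ _) _)
    have k1 := mul_lt_mul_of_pos_right k1 hl
    have k2 := mul_lt_mul_of_pos_right k2 hl
    have k3 := mul_lt_mul_of_pos_right k3 hl
    rw [sub_mul] at k1 k2 k3
    refine D.asym2 (fun o => o.2.1) (fun o => (o.1, o.2.1)) (fun o => (o.1, o.2.2)) Prod.snd ?_
    refine lt_sub_comm.1 (max_lt (max_lt ?_ ?_) ?_)
    · linarith
    · rw [b1]; linarith
    · rw [b2]; linarith
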